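/- arXiv:1409.5634 — 2 statements merged into one kernel-verified Lean document; each statement's English description precedes it below -/
import Mathlib

section
/- Let q be a prime power with q ≡ 5 or 9 (mod 12). Then there exists a Cameron–Liebler line class of PG(3,q) with parameter x = (q² − 1)/2: a set ℒ of 2-dimensional subspaces of the vector space 𝔽_q⁴ such that for every 2-dimensional subspace ℓ of 𝔽_q⁴, the number of elements m ∈ ℒ with m ≠ ℓ and m ∩ ℓ ≠ {0} equals ((q² − 1)/2)·(q + 1) + (q² − 1)·[ℓ ∈ ℒ] (where [ℓ ∈ ℒ] is 1 if ℓ ∈ ℒ and 0 otherwise). -/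
open scoped Classical

lemma CL_identity {F : Type*} [Field F] (h2 : (2 : F) ≠ 0) {a b c x1 y1 x2 y2 : F}
    (e1 : y1 ^ 2 = x1 ^ 3 + a * x1 ^ 2 + b * x1 + c)
    (e2 : y2 ^ 2 = x2 ^ 3 + a * x2 ^ 2 + b * x2 + c)
    (hy1 : y1 ≠ 0) (hy2 : y2 ≠ 0) (hx : x1 - x2 ≠ 0) :
    (-(y1 + (y1 - y2) / (x1 - x2) * (((y1 - y2) / (x1 - x2)) ^ 2 - a - x1 - x2 - x1))) *
    (-(y1 + (y1 + y2) / (x1 - x2) * (((y1 + y2) / (x1 - x2)) ^ 2 - a - x1 - x2 - x1))) =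
    -((((3 * x1 ^ 2 + 2 * a * x1 + b) / (2 * y1)) ^ 2 - a - x1 - x1) -
      (((3 * x2 ^ 2 + 2 * a * x2 + b) / (2 * y2)) ^ 2 - a - x2 - x2)) *
      (2 * y1 * y2 / (x1 - x2) ^ 2) ^ 2 := by
  have hc : c = y1 ^ 2 - (x1 ^ 3 + a * x1 ^ 2 + b * x1) := by rw [e1]; ring
  have hb : b = ((y1 ^ 2 - (x1 ^ 3 + a * x1 ^ 2)) - (y2 ^ 2 - (x2 ^ 3 + a * x2 ^ 2))) / (x1 - x2) := by
    field_simp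
    rw [e1, e2]; ring
  rw [hb]
  field_simp
  ring

namespace CLEll
open WeierstrassCurve WeierstrassCurve.Affine

abbrev W {F : Type*} [Field F] (a b c : F) : WeierstrassCurve.Affine F := ⟨0, a, 0, b, c⟩

variable {F : Type*} [Field F]

lemma nons (h2 : (2 : F) ≠ 0) {a b c : F} (hr : ∀ x : F, x ^ 3 + a * x ^ 2 + b * x + c ≠ 0) (x y : F) :
    (W a b c).Nonsingular x y ↔ y ^ 2 = x ^ 3 + a * x ^ 2 + b * x + c := by
  rw [nonsingular_iff, equation_iff]
  simp only
  constructor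
  · rintro ⟨h, -⟩
    linear_combination h
  · intro h
    refine ⟨by linear_combination h, Or.inr ?_⟩
    intro h'
    have : 2 * y = 0 := by linear_combination h'
    have hy : y = 0 := by simpa [h2] using this
    apply hr x
    rw [← h, hy]; ring

noncomputable def pX {a b c : F} : (W a b c).Point → F
  | .zero => 0
  | .some x _ _ => x

noncomputable def pY {a b c : F} : (W a b c).Point → F
  | .zero => 0
  | .some _ y _ => y

lemma pY_ne (h2 : (2 : F) ≠ 0) {a b c : F} (hr : ∀ x : F, x ^ 3 + a * x ^ 2 + b * x + c ≠ 0)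
    (P : (W a b c).Point) (hP : P ≠ 0) : pY P ≠ 0 := by
  rcases P with _ | ⟨x, y, h⟩
  · exact absurd rfl hP
  · intro hy
    change y = 0 at hy
    apply hr x
    rw [← (nons h2 hr x y).1 h, hy]; ring

lemma pY_neg {a b c : F} (P : (W a b c).Point) : pY (-P) = - pY P := by
  rcases P with _ | ⟨x, y, h⟩
  · change (0 : F) = - 0
    simp
  · change (W a b c).negY x y = - y
    simp [negY]

lemma pX_neg {a b c : F} (P : (W a b c).Point) : pX (-P) = pX P := by
  rcases P with _ | ⟨x, y, h⟩
  · rfl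
  · rfl

lemma dbl_ne (h2 : (2 : F) ≠ 0) {a b c : F} (hr : ∀ x : F, x ^ 3 + a * x ^ 2 + b * x + c ≠ 0)
    (P : (W a b c).Point) (hP : P + P = 0) : P = 0 := by
  by_contra h
  have h1 : P = -P := eq_neg_of_add_eq_zero_left hP
  have h3 : pY P = - pY P := by rw [← pY_neg, ← h1]
  have : 2 * pY P = 0 := by linear_combination h3
  rcases mul_eq_zero.1 this with h4 | h4
  · exact h2 h4
  · exact pY_ne h2 hr P h h4

/-- key: `y(R+U) y(R-U)` is minus a square times `x(2R)-x(2U)`. -/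
lemma key (h2 : (2 : F) ≠ 0) {a b c : F} (hr : ∀ x : F, x ^ 3 + a * x ^ 2 + b * x + c ≠ 0)
    (R U : (W a b c).Point) (hR : R ≠ 0) (hU : U ≠ 0) :
    ∃ s : F, s ≠ 0 ∧ pY (R + U) * pY (R - U) = -(pX (R + R) - pX (U + U)) * s ^ 2 := by
  by_cases hRU : R = U
  · subst hRU
    refine ⟨1, one_ne_zero, ?_⟩
    have : pY (R - R) = 0 := by rw [sub_self]; rfl
    rw [this]; ring
  by_cases hRU' : R = -U
  · subst hRU'
    refine ⟨1, one_ne_zero, ?_⟩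
    have : pY (-U + U) = 0 := by rw [neg_add_cancel]; rfl
    rw [this, ← neg_add, pX_neg]; ring
  have hyR := pY_ne h2 hr R hR
  have hyU := pY_ne h2 hr U hU
  rcases R with _ | ⟨x1, y1, h1⟩
  · exact absurd rfl hR
  rcases U with _ | ⟨x2, y2, h3⟩
  · exact absurd rfl hU
  have hx : x1 ≠ x2 := by
    intro hx
    rcases (Point.X_eq_iff (h₁ := h1) (h₂ := h3)).1 hx with h | h
    · exact hRU h
    · exact hRU' h
  change y1 ≠ 0 at hyR
  change y2 ≠ 0 at hyU
  have e1 := (nons h2 hr _ _).1 h1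
  have e2 := (nons h2 hr _ _).1 h3
  have hn1 : y1 ≠ (W a b c).negY x1 y1 := by
    simp only [negY]
    intro h
    have : 2 * y1 = 0 := by linear_combination h
    exact mul_ne_zero h2 hyR this
  have hn2 : y2 ≠ (W a b c).negY x2 y2 := by
    simp only [negY]
    intro h
    have : 2 * y2 = 0 := by linear_combination h
    exact mul_ne_zero h2 hyU this
  have hx' : x1 - x2 ≠ 0 := sub_ne_zero.2 hx
  refine ⟨2 * y1 * y2 / (x1 - x2) ^ 2, div_ne_zero (mul_ne_zero (mul_ne_zero h2 hyR) hyU) (pow_ne_zero _ hx'), ?_⟩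
  rw [sub_eq_add_neg, Point.neg_some, Point.add_of_X_ne hx, Point.add_of_X_ne hx,
    Point.add_self_of_Y_ne hn1, Point.add_self_of_Y_ne hn2]
  simp only [pX, pY, addY, negAddY, addX, slope_of_X_ne hx, slope_of_Y_ne rfl hn1, slope_of_Y_ne rfl hn2]
  have := CL_identity h2 e1 e2 hyR hyU hx'
  simp only [negY]
  convert this using 1
  · ring_nf
  · ring_nf

variable [Fintype F]

instance {a b c : F} : Finite (W a b c).Point :=
  Finite.of_injective (fun P => (pX P, pY P, decide (P = 0))) (by
    intro P Q h
    rcases P with _ | ⟨x1, y1, h1⟩ <;> rcases Q with _ | ⟨x2, y2, h3⟩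
    · rfl
    · simp only [Prod.mk.injEq, decide_eq_decide] at h
      exact (h.2.2.1 rfl).symm
    · simp only [Prod.mk.injEq, decide_eq_decide] at h
      exact (h.2.2.2 rfl)
    · simp only [Prod.mk.injEq, pX, pY] at h
      simp [h.1, h.2.1])

noncomputable instance {a b c : F} : Fintype (W a b c).Point := Fintype.ofFinite _

noncomputable def S (a b c : F) : Finset (F × F) :=
  Finset.univ.filter (fun p => p.2 ^ 2 = p.1 ^ 3 + a * p.1 ^ 2 + b * p.1 + c)

lemma transfer (h2 : (2 : F) ≠ 0) {a b c : F} (hr : ∀ x : F, x ^ 3 + a * x ^ 2 + b * x + c ≠ 0)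
    (H : F → F → ℤ) :
    ∑ P ∈ (Finset.univ : Finset (W a b c).Point).erase 0, H (pX P) (pY P) =
      ∑ p ∈ S a b c, H p.1 p.2 := by
  refine Finset.sum_bij (fun P _ => (pX P, pY P)) ?_ ?_ ?_ ?_
  · intro P hP
    rcases P with _ | ⟨x1, y1, h1⟩
    · exact absurd rfl (Finset.ne_of_mem_erase hP)
    · simpa [S, pX, pY] using (nons h2 hr _ _).1 h1
  · intro P hP Q hQ h
    rcases P with _ | ⟨x1, y1, h1⟩
    · exact absurd rfl (Finset.ne_of_mem_erase hP)
    rcases Q with _ | ⟨x2, y2, h3⟩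
    · exact absurd rfl (Finset.ne_of_mem_erase hQ)
    simp only [Prod.mk.injEq, pX, pY] at h
    simp [h.1, h.2]
  · rintro ⟨x, y⟩ hp
    have : y ^ 2 = x ^ 3 + a * x ^ 2 + b * x + c := by simpa [S] using hp
    exact ⟨.some x y ((nons h2 hr _ _).2 this), Finset.mem_erase.2 ⟨Point.some_ne_zero _, Finset.mem_univ _⟩, rfl⟩
  · intros; rfl

lemma main (h2 : (2 : F) ≠ 0) (hη : quadraticChar F (-1) = 1) {a b c : F}
    (hr : ∀ x : F, x ^ 3 + a * x ^ 2 + b * x + c ≠ 0) :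
    (∑ p ∈ S a b c, quadraticChar F p.2) ^ 2 =
      2 * ((S a b c).card : ℤ) + ∑ p ∈ S a b c, ∑ p' ∈ S a b c, quadraticChar F (p.1 - p'.1) := by
  set η := quadraticChar F with hηd
  have hT : ∑ p ∈ S a b c, η p.2 = ∑ P : (W a b c).Point, η (pY P) := by
    rw [← transfer h2 hr (fun _ y => η y)]
    refine Finset.sum_erase _ ?_
    exact MulChar.map_zero η
  have hcard : ((S a b c).card : ℤ) = ∑ P : (W a b c).Point, if P = 0 then 0 else 1 := by
    rw [Finset.card_eq_sum_ones]
    push_cast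
    rw [← transfer h2 hr (fun _ _ => 1)]
    symm
    rw [← Finset.sum_erase (a := 0) _ (by simp)]
    refine Finset.sum_congr rfl ?_
    intro P hP
    rw [if_neg (Finset.ne_of_mem_erase hP)]
  have hdbl : Function.Injective (fun P : (W a b c).Point => P + P) := by
    intro P Q h
    have h' : P + P = Q + Q := h
    have : (P - Q) + (P - Q) = 0 := by
      rw [show (P - Q) + (P - Q) = (P + P) - (Q + Q) by abel, h', sub_self]
    exact sub_eq_zero.1 (dbl_ne h2 hr _ this)
  have hbd : Function.Bijective (fun P : (W a b c).Point => P + P) := Finite.injective_iff_bijective.1 hdbl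
  have hpm : Function.Bijective (fun P : (W a b c).Point × (W a b c).Point => (P.1 + P.2, P.1 - P.2)) := by
    apply Finite.injective_iff_bijective.1
    rintro ⟨R, U⟩ ⟨R', U'⟩ h
    simp only [Prod.mk.injEq] at h
    have hR : R = R' := by
      apply hdbl
      change R + R = R' + R'
      rw [show R + R = (R + U) + (R - U) by abel, h.1, h.2]; abel
    subst hR
    have := h.1
    rw [add_left_cancel this]
  have hsq : (∑ P : (W a b c).Point, η (pY P)) ^ 2 =
      ∑ x : (W a b c).Point × (W a b c).Point, η (pY (x.1 + x.2) * pY (x.1 - x.2)) := by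
    rw [sq, Finset.sum_mul_sum, ← Finset.sum_product', Finset.univ_product_univ]
    rw [← hpm.sum_comp (fun x : (W a b c).Point × (W a b c).Point => η (pY x.1) * η (pY x.2))]
    simp only [map_mul]
  have hterm : ∀ R U : (W a b c).Point, η (pY (R + U) * pY (R - U)) =
      (if R = 0 then (if U = 0 then 0 else 1) else 0) + (if U = 0 then (if R = 0 then 0 else 1) else 0)
      + (if R = 0 then 0 else if U = 0 then 0 else η (pX (R + R) - pX (U + U))) := by
    intro R U
    have h1 : ∀ s : F, s ≠ 0 → η (s ^ 2) = 1 := fun s hs => quadraticChar_sq_one' hs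
    by_cases hR : R = 0
    · subst hR
      by_cases hU : U = 0
      · subst hU
        have : pY ((0 : (W a b c).Point) + 0) = 0 := by rw [add_zero]; rfl
        rw [this, zero_mul, MulChar.map_zero]; simp
      · have := h1 _ (pY_ne h2 hr U hU)
        rw [zero_add, zero_sub, pY_neg, show pY U * -pY U = (-1) * (pY U) ^ 2 by ring, map_mul, hη, this]
        simp [hU]
    · by_cases hU : U = 0
      · subst hU
        have := h1 _ (pY_ne h2 hr R hR)
        rw [add_zero, sub_zero, ← sq, this]
        simp [hR]
      · obtain ⟨s, hs, h⟩ := key h2 hr R U hR hU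
        rw [h, map_mul, h1 s hs, neg_eq_neg_one_mul, map_mul, hη]
        simp [hR, hU]
  have hthird : ∑ R : (W a b c).Point, ∑ U : (W a b c).Point,
      (if R = 0 then 0 else if U = 0 then 0 else η (pX (R + R) - pX (U + U))) =
      ∑ p ∈ S a b c, ∑ p' ∈ S a b c, η (p.1 - p'.1) := by
    have hz : ∀ P : (W a b c).Point, P + P = 0 ↔ P = 0 :=
      fun P => ⟨dbl_ne h2 hr P, fun h => by rw [h, add_zero]⟩
    have e1 : ∀ R : (W a b c).Point, ∑ U : (W a b c).Point,
      (if R = 0 then 0 else if U = 0 then 0 else η (pX (R + R) - pX (U + U))) =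
      if R = 0 then 0 else ∑ p' ∈ S a b c, η (pX (R + R) - p'.1) := by
      intro R
      split_ifs with hR
      · simp
      · rw [← transfer h2 hr (fun x _ => η (pX (R + R) - x))]
        have h3 := hbd.sum_comp (fun U => if U = 0 then 0 else η (pX (R + R) - pX U))
        simp only [hz] at h3
        rw [h3, ← Finset.sum_erase (a := 0) _ (by simp)]
        refine Finset.sum_congr rfl ?_
        intro P hP
        rw [if_neg (Finset.ne_of_mem_erase hP)]
    simp only [e1]
    rw [← transfer h2 hr (fun x _ => ∑ p' ∈ S a b c, η (x - p'.1))]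
    have h3 := hbd.sum_comp (fun R => if R = 0 then 0 else ∑ p' ∈ S a b c, η (pX R - p'.1))
    simp only [hz] at h3
    rw [h3, ← Finset.sum_erase (a := 0) _ (by simp)]
    refine Finset.sum_congr rfl ?_
    intro P hP
    rw [if_neg (Finset.ne_of_mem_erase hP)]
  rw [hT, hsq, Fintype.sum_prod_type]
  simp only [hterm, Finset.sum_add_distrib, hthird]
  congr 1
  rw [hcard, two_mul]
  congr 1
  · rw [Finset.sum_eq_single 0]
    · simp
    · intro b _ hb; simp [hb]
    · simp
  · refine Finset.sum_congr rfl ?_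
    intro R _
    simp

end CLEll

namespace CLEll
variable {F : Type*} [Field F] [Fintype F]

lemma fiber {R : Type*} [CommRing R] (hF : ringChar F ≠ 2) (a b c : F) (H : F → R) :
    ∑ p ∈ S a b c, H p.1 =
      ∑ x : F, H x * (1 + ((quadraticChar F (x ^ 3 + a * x ^ 2 + b * x + c) : ℤ) : R)) := by
  rw [S, Finset.sum_filter, Fintype.sum_prod_type]
  refine Finset.sum_congr rfl ?_
  intro x _
  have h := quadraticChar_card_sqrts hF (x ^ 3 + a * x ^ 2 + b * x + c)
  simp only
  rw [← Finset.sum_filter, Finset.sum_const, nsmul_eq_mul, mul_comm]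
  congr 1
  have h' : ((Finset.univ.filter (fun y : F => y ^ 2 = x ^ 3 + a * x ^ 2 + b * x + c)).card : ℤ)
     = quadraticChar F (x ^ 3 + a * x ^ 2 + b * x + c) + 1 := by
    rw [← h]
    congr 2
    ext y; simp
  have := congrArg (fun z : ℤ => (z : R)) h'
  push_cast at this
  rw [this, add_comm]

lemma chi_sq {χ : MulChar F ℂ} (hF : ringChar F ≠ 2) (hχ : orderOf χ = 4) (y : F) :
    χ y ^ 2 = ((quadraticChar F y : ℤ) : ℂ) := by
  have h4 : ∀ z : F, z ≠ 0 → χ z ^ 4 = 1 := by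
    intro z hz
    have : (χ ^ 4) z = 1 := by
      rw [← hχ, pow_orderOf_eq_one, MulChar.one_apply (isUnit_iff_ne_zero.2 hz)]
    rwa [MulChar.pow_apply' _ (by norm_num)] at this
  have hsq : ∀ z : F, z ≠ 0 → IsSquare z → χ z ^ 2 = 1 := by
    rintro z hz ⟨w, rfl⟩
    have := h4 w (by rintro rfl; simp at hz)
    rw [map_mul, ← this]; ring
  by_cases hy : y = 0
  · subst hy; rw [MulChar.map_zero, MulChar.map_zero]; simp
  rcases quadraticChar_dichotomy hy with h | h
  · rw [h, hsq y hy ((quadraticChar_one_iff_isSquare hy).1 h)]; simp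
  · rw [h]
    have h5 : (χ y ^ 2 - 1) * (χ y ^ 2 + 1) = 0 := by linear_combination h4 y hy
    rcases mul_eq_zero.1 h5 with h6 | h6
    · exfalso
      have h7 : χ ^ 2 = 1 := by
        ext z
        rw [MulChar.pow_apply' _ (by norm_num), MulChar.one_apply z.isUnit]
        rcases quadraticChar_dichotomy z.ne_zero with hz | hz
        · exact hsq z z.ne_zero ((quadraticChar_one_iff_isSquare z.ne_zero).1 hz)
        · have : quadraticChar F (z * y) = 1 := by rw [map_mul, hz, h]; norm_num
          have h8 := hsq _ (mul_ne_zero z.ne_zero hy)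
            ((quadraticChar_one_iff_isSquare (mul_ne_zero z.ne_zero hy)).1 this)
          rw [map_mul, mul_pow, sub_eq_zero.1 h6, mul_one] at h8
          exact h8
      have := orderOf_dvd_of_pow_eq_one h7
      rw [hχ] at this
      norm_num at this
    · rw [eq_neg_of_add_eq_zero_left h6]; simp

lemma normS {χ : MulChar F ℂ} (hF : ringChar F ≠ 2) (hχ : orderOf χ = 4)
    (hη : quadraticChar F (-1) = 1) {a b c : F}
    (hr : ∀ x : F, x ^ 3 + a * x ^ 2 + b * x + c ≠ 0) :
    Complex.normSq (∑ x : F, χ (x ^ 3 + a * x ^ 2 + b * x + c)) = Fintype.card F := by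
  have h2 : (2 : F) ≠ 0 := Ring.two_ne_zero hF
  obtain ⟨d, hd⟩ := quadraticChar_exists_neg_one' hF
  have hd0 : (d : F) ≠ 0 := d.ne_zero
  generalize (d : F) = d at hd hd0
  set η := quadraticChar F with hηd
  set f : F → F := fun x => x ^ 3 + a * x ^ 2 + b * x + c with hf
  have hg : ∀ x : F, (d * x) ^ 3 + (d * a) * (d * x) ^ 2 + (d ^ 2 * b) * (d * x) + d ^ 3 * c = d ^ 3 * f x := by
    intro x; simp only [hf]; ring
  have hbij : Function.Bijective (fun x : F => d * x) := mulLeft_bijective₀ d hd0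
  have hr' : ∀ x : F, x ^ 3 + (d * a) * x ^ 2 + (d ^ 2 * b) * x + d ^ 3 * c ≠ 0 := by
    intro x
    obtain ⟨z, rfl⟩ := hbij.2 x
    simp only
    rw [hg]
    exact mul_ne_zero (pow_ne_zero _ hd0) (hr z)
  have hηd3 : ∀ z, η (d ^ 3 * z) = - η z := by
    intro z; rw [map_mul, map_pow, hd]; ring
  have hη0 : ∀ x : F, ∑ x' : F, η (x - x') = 0 := by
    intro x
    have := (Equiv.subLeft x).sum_comp (fun z => η z)
    simp only [Equiv.subLeft_apply] at this
    rw [this]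
    exact quadraticChar_sum_zero hF
  have hη0' : ∀ x : F, ∑ x' : F, η (x' - x) = 0 := by
    intro x
    have := (Equiv.subRight x).sum_comp (fun z => η z)
    simp only [Equiv.subRight_apply] at this
    rw [this]
    exact quadraticChar_sum_zero hF
  have m1 := main h2 hη hr
  have m2 := main h2 hη hr'
  have n1 : ((S a b c).card : ℤ) = ∑ x : F, (1 + η (f x)) := by
    have := fiber hF a b c (fun _ => (1 : ℤ))
    rw [Finset.card_eq_sum_ones]
    push_cast
    rw [this]
    simp [hf, hηd]
  have n2 : ((S (d * a) (d ^ 2 * b) (d ^ 3 * c)).card : ℤ) = ∑ x : F, (1 - η (f x)) := by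
    have := fiber hF (d * a) (d ^ 2 * b) (d ^ 3 * c) (fun _ => (1 : ℤ))
    rw [Finset.card_eq_sum_ones]
    push_cast
    rw [this, ← hbij.sum_comp]
    simp only [hg, ← hηd, hηd3]
    simp [sub_eq_add_neg]
  have s1 : ∑ p ∈ S a b c, ∑ p' ∈ S a b c, η (p.1 - p'.1) =
      ∑ x : F, ∑ x' : F, η (x - x') * (1 + η (f x')) * (1 + η (f x)) := by
    rw [fiber hF a b c (fun x => ∑ p' ∈ S a b c, η (x - p'.1))]
    refine Finset.sum_congr rfl ?_
    intro x _
    rw [fiber hF a b c (fun x' => η (x - x')), Finset.sum_mul]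
    rfl
  have s2 : ∑ p ∈ S (d * a) (d ^ 2 * b) (d ^ 3 * c), ∑ p' ∈ S (d * a) (d ^ 2 * b) (d ^ 3 * c), η (p.1 - p'.1) =
      ∑ x : F, ∑ x' : F, - η (x - x') * (1 - η (f x')) * (1 - η (f x)) := by
    rw [fiber hF _ _ _ (fun x => ∑ p' ∈ S (d * a) (d ^ 2 * b) (d ^ 3 * c), η (x - p'.1)), ← hbij.sum_comp]
    refine Finset.sum_congr rfl ?_
    intro x _
    rw [fiber hF _ _ _ (fun x' => η (d * x - x')), ← hbij.sum_comp, Finset.sum_mul]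
    simp only [hg, ← hηd, hηd3, ← mul_sub, map_mul, hd]
    refine Finset.sum_congr rfl ?_
    intro x' _
    simp only [Int.cast_id]
    ring
  set T1 : ℤ := ∑ p ∈ S a b c, η p.2 with hT1
  set T2 : ℤ := ∑ p ∈ S (d * a) (d ^ 2 * b) (d ^ 3 * c), η p.2 with hT2
  have hsum : T1 ^ 2 + T2 ^ 2 = 4 * Fintype.card F := by
    rw [m1, m2, n1, n2, s1, s2]
    have e1 : (∑ x : F, ∑ x' : F, η (x - x') * (1 + η (f x')) * (1 + η (f x))) +
       ∑ x : F, ∑ x' : F, - η (x - x') * (1 - η (f x')) * (1 - η (f x)) = 0 := by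
      have e2 : ∀ x x' : F, η (x - x') * (1 + η (f x')) * (1 + η (f x)) +
          - η (x - x') * (1 - η (f x')) * (1 - η (f x)) =
          2 * η (f x) * η (x - x') + 2 * η (f x') * η (x - x') := by
        intro x x'; ring
      rw [← Finset.sum_add_distrib]
      simp only [← Finset.sum_add_distrib, e2]
      simp only [Finset.sum_add_distrib]
      rw [Finset.sum_comm (f := fun x x' => 2 * η (f x') * η (x - x'))]
      simp only [← Finset.mul_sum, hη0, hη0']
      simp
    have e3 : (∑ x : F, (1 + η (f x))) + ∑ x : F, (1 - η (f x)) = 2 * Fintype.card F := by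
      rw [← Finset.sum_add_distrib]
      have : ∀ x, (1 + η (f x)) + (1 - η (f x)) = 2 := by intro x; ring
      simp only [this]
      simp [mul_comm]
    linear_combination e1 + 2 * e3
  have t1 : (T1 : ℂ) = ∑ x : F, χ (f x) * (1 + (η (f x) : ℂ)) := by
    rw [← fiber hF a b c (fun x => χ (f x)), hT1]
    push_cast
    refine Finset.sum_congr rfl ?_
    intro p hp
    have : p.2 ^ 2 = f p.1 := by simpa [S] using hp
    rw [← this, map_pow, chi_sq hF hχ]
  have t2 : (T2 : ℂ) = χ d ^ 3 * ∑ x : F, χ (f x) * (1 - (η (f x) : ℂ)) := by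
    have : ∑ p ∈ S (d * a) (d ^ 2 * b) (d ^ 3 * c),
       χ (p.1 ^ 3 + (d * a) * p.1 ^ 2 + (d ^ 2 * b) * p.1 + d ^ 3 * c) = (T2 : ℂ) := by
      rw [hT2]
      push_cast
      refine Finset.sum_congr rfl ?_
      intro p hp
      have : p.2 ^ 2 = p.1 ^ 3 + (d * a) * p.1 ^ 2 + (d ^ 2 * b) * p.1 + d ^ 3 * c := by simpa [S] using hp
      rw [← this, map_pow, chi_sq hF hχ]
    rw [← this, fiber hF _ _ _ (fun x => χ (x ^ 3 + (d * a) * x ^ 2 + (d ^ 2 * b) * x + d ^ 3 * c)),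
      ← hbij.sum_comp, Finset.mul_sum]
    refine Finset.sum_congr rfl ?_
    intro x _
    simp only [hg, ← hηd, hηd3, map_mul, map_pow]
    push_cast
    ring
  have hχd : χ d ^ 2 = -1 := by rw [chi_sq hF hχ, ← hηd, hd]; simp
  have h2S : 2 * ∑ x : F, χ (f x) = T1 + χ d * T2 := by
    rw [t1, t2, ← mul_assoc, show χ d * χ d ^ 3 = (χ d ^ 2) ^ 2 by ring, hχd]
    rw [neg_one_sq, one_mul, ← Finset.sum_add_distrib, Finset.mul_sum]
    refine Finset.sum_congr rfl ?_
    intro x _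
    ring
  have hI : χ d = Complex.I ∨ χ d = -Complex.I := by
    apply sq_eq_sq_iff_eq_or_eq_neg.1
    rw [hχd, Complex.I_sq]
  have h4 : Complex.normSq (2 * ∑ x : F, χ (f x)) = (T1 : ℝ) ^ 2 + (T2 : ℝ) ^ 2 := by
    rw [h2S]
    rcases hI with h | h <;> rw [h, Complex.normSq_apply] <;> simp <;> ring
  rw [map_mul] at h4
  have h5 : (T1 : ℝ) ^ 2 + (T2 : ℝ) ^ 2 = 4 * Fintype.card F := by exact_mod_cast hsum
  rw [h5] at h4
  have h6 : Complex.normSq 2 = 4 := by rw [Complex.normSq_apply]; norm_num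
  rw [h6] at h4
  linarith

end CLEll

namespace CLExt
variable {F E : Type*} [Field F] [Fintype F] [Field E] [Fintype E] [Algebra F E]

lemma norm_cubic (h3 : Module.finrank F E = 3) (θ : E) :
    ∃ a b c : F, ∀ t : F, Algebra.norm F (algebraMap F E t + θ) = t ^ 3 + a * t ^ 2 + b * t + c := by
  have : FiniteDimensional F E := FiniteDimensional.of_finrank_pos (by omega)
  let B : Module.Basis (Fin 3) F E := Module.finBasisOfFinrankEq F E h3
  set M := Algebra.leftMulMatrix B θ with hM
  refine ⟨M 0 0 + M 1 1 + M 2 2,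
    M 0 0 * M 1 1 + M 0 0 * M 2 2 + M 1 1 * M 2 2 - M 0 1 * M 1 0 - M 0 2 * M 2 0 - M 1 2 * M 2 1,
    M.det, ?_⟩
  intro t
  rw [Algebra.norm_eq_matrix_det B, map_add, AlgHom.commutes, ← hM, Matrix.det_fin_three, Matrix.det_fin_three]
  simp [Matrix.algebraMap_matrix_apply]
  ring

lemma indep (h3 : Module.finrank F E = 3) {θ : E} (hθ : θ ∉ Set.range (algebraMap F E)) {s r t : F}
    (h : algebraMap F E s + algebraMap F E r * θ + algebraMap F E t * θ ^ 2 = 0) :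
    s = 0 ∧ r = 0 ∧ t = 0 := by
  have : FiniteDimensional F E := FiniteDimensional.of_finrank_pos (by omega)
  have hd : (minpoly F θ).natDegree = 3 := by
    have h1 := minpoly.degree_dvd (K := F) (x := θ) (Algebra.IsIntegral.isIntegral θ)
    rw [h3] at h1
    rcases (Nat.dvd_prime Nat.prime_three).1 h1 with h2 | h2
    · exact absurd ((minpoly.natDegree_eq_one_iff).1 h2) hθ
    · exact h2
  set p : Polynomial F := Polynomial.C s + Polynomial.C r * Polynomial.X + Polynomial.C t * Polynomial.X ^ 2 with hp
  have hp0 : p = 0 := by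
    by_contra hne
    have h4 := minpoly.degree_le_of_ne_zero F θ hne (by simp [hp, h])
    have h5 : p.natDegree ≤ 2 := by rw [hp]; compute_degree
    have h6 := Polynomial.natDegree_le_natDegree h4
    omega
  have c0 : p.coeff 0 = 0 := by rw [hp0]; simp
  have c1 : p.coeff 1 = 0 := by rw [hp0]; simp
  have c2 : p.coeff 2 = 0 := by rw [hp0]; simp
  simp [hp, Polynomial.coeff_X, Polynomial.coeff_C] at c0 c1 c2
  exact ⟨c0, c1, c2⟩

lemma bij (h3 : Module.finrank F E = 3) {θ : E} (hθ : θ ∉ Set.range (algebraMap F E)) :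
    Function.Bijective (fun x : F × F × F =>
      algebraMap F E x.1 + algebraMap F E x.2.1 * θ + algebraMap F E x.2.2 * θ ^ 2) := by
  rw [Fintype.bijective_iff_injective_and_card]
  constructor
  · rintro ⟨s, r, t⟩ ⟨s', r', t'⟩ h
    simp only at h
    have := indep h3 hθ (s := s - s') (r := r - r') (t := t - t') (by
      simp only [map_sub]; linear_combination h)
    simp only [sub_eq_zero] at this
    simp [this.1, this.2.1, this.2.2]
  · have := Module.card_eq_pow_finrank (K := F) (V := E)
    rw [this, h3]
    simp only [Fintype.card_prod]
    ring

/-- The lifted quartic character. -/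
noncomputable def chiE (χ : MulChar F ℂ) (x : E) : ℂ := χ (Algebra.norm F x)

noncomputable def SS (χ : MulChar F ℂ) (θ : E) : ℂ := ∑ t : F, chiE χ (algebraMap F E t + θ)

lemma chiE_mul (χ : MulChar F ℂ) (x y : E) : chiE χ (x * y) = chiE χ x * chiE χ y := by
  simp [chiE]

lemma chiE_alg (h3 : Module.finrank F E = 3) (χ : MulChar F ℂ) (s : F) :
    chiE χ (algebraMap F E s) = χ s ^ 3 := by
  simp [chiE, Algebra.norm_algebraMap, h3]

lemma chi_pow4 {χ : MulChar F ℂ} (hχ : orderOf χ = 4) {z : F} (hz : z ≠ 0) : χ z ^ 4 = 1 := by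
  have : (χ ^ 4) z = 1 := by
    rw [← hχ, pow_orderOf_eq_one, MulChar.one_apply (isUnit_iff_ne_zero.2 hz)]
  rwa [MulChar.pow_apply' _ (by norm_num)] at this

lemma chiE_pow4 (h3 : Module.finrank F E = 3) {χ : MulChar F ℂ} (hχ : orderOf χ = 4) {z : E} (hz : z ≠ 0) :
    chiE (F := F) χ z ^ 4 = 1 := by
  have : FiniteDimensional F E := FiniteDimensional.of_finrank_pos (by omega)
  exact chi_pow4 hχ (Algebra.norm_ne_zero_iff.2 hz)

lemma conj_of_pow4 {u : ℂ} (hu : u ^ 4 = 1) : (starRingEnd ℂ) u * u = 1 := by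
  rw [mul_comm, Complex.mul_conj, Complex.normSq_eq_norm_sq, Complex.norm_eq_one_of_pow_eq_one hu (by norm_num)]
  simp

lemma chi3_sum {χ : MulChar F ℂ} (hχ : orderOf χ = 4) : ∑ s : F, χ s ^ 3 = 0 := by
  have hne : χ ^ 3 ≠ 1 := by
    intro h
    have := orderOf_dvd_of_pow_eq_one h
    rw [hχ] at this
    norm_num at this
  have := MulChar.sum_eq_zero_of_ne_one hne
  rw [← this]
  refine Finset.sum_congr rfl ?_
  intro s _
  rw [MulChar.pow_apply' _ (by norm_num)]

lemma funceq (h3 : Module.finrank F E = 3) {χ : MulChar F ℂ} (hχ : orderOf χ = 4)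
    {ψ : AddChar F ℂ} (hψ : ψ.IsPrimitive) (l : E →ₗ[F] F) (hl : l ≠ 0)
    {θ : E} (hθ : θ ∉ Set.range (algebraMap F E)) :
    ∃ u : ℂ, u ^ 4 = 1 ∧ (starRingEnd ℂ) (SS χ θ) * u * (∑ x : E, chiE χ x * ψ (l x)) =
      Fintype.card F * (∑ r : F, χ r ^ 3 * ψ r) * SS χ θ := by
  have : FiniteDimensional F E := FiniteDimensional.of_finrank_pos (by omega)
  obtain ⟨w, hw0, hw1, hw2, hw3⟩ : ∃ w : E, w ≠ 0 ∧ l w = 0 ∧ l (w * θ) = 0 ∧ l (w * θ ^ 2) = 1 := by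
    let T : E →ₗ[F] F × F := l.prod (l ∘ₗ LinearMap.mulRight F θ)
    have hT : ¬ Function.Injective T := by
      intro hinj
      have := LinearMap.finrank_le_finrank_of_injective hinj
      rw [h3] at this
      simp at this
    have hk : LinearMap.ker T ≠ ⊥ := fun h => hT (LinearMap.ker_eq_bot.1 h)
    obtain ⟨w, hwk, hw⟩ := Submodule.exists_mem_ne_zero_of_ne_bot hk
    have hTw : T w = 0 := hwk
    have h1 : l w = 0 := congrArg Prod.fst hTw
    have h2 : l (w * θ) = 0 := congrArg Prod.snd hTw
    have h4 : l (w * θ ^ 2) ≠ 0 := by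
      intro h4
      apply hl
      ext y
      obtain ⟨⟨s, r, t⟩, hx⟩ := (bij h3 hθ).2 (y / w)
      have hy : y = s • w + r • (w * θ) + t • (w * θ ^ 2) := by
        simp only at hx
        rw [eq_div_iff hw] at hx
        rw [← hx]
        simp only [Algebra.smul_def]
        ring
      rw [hy]
      simp [h1, h2, h4]
    refine ⟨(l (w * θ ^ 2))⁻¹ • w, ?_, ?_, ?_, ?_⟩
    · exact smul_ne_zero (inv_ne_zero h4) hw
    · simp [h1]
    · simp [h2]
    · simp [h4]
  set G := ∑ x : E, chiE χ x * ψ (l x) with hG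
  have hne : ∀ m : F, algebraMap F E m + θ ≠ 0 := by
    intro m h
    apply hθ
    exact ⟨-m, by rw [map_neg]; linear_combination -h⟩
  have hshift : ∀ y : E, y ≠ 0 → ∑ x : E, chiE χ x * ψ (l (x * y)) = (starRingEnd ℂ) (chiE χ y) * G := by
    intro y hy
    have hb : Function.Bijective (fun x : E => x * y) := mulRight_bijective₀ y hy
    have hGs := hb.sum_comp (fun x => chiE χ x * ψ (l x))
    rw [hG, ← hGs, Finset.mul_sum]
    refine Finset.sum_congr rfl ?_
    intro x _
    simp only [chiE_mul]
    have := conj_of_pow4 (chiE_pow4 h3 hχ hy)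
    linear_combination (- chiE χ x * ψ (l (x * y))) * this
  have hL : ∑ m : F, ∑ x : E, chiE χ x * ψ (l (x * (w * (algebraMap F E m + θ)))) =
      (starRingEnd ℂ) (SS χ θ) * (starRingEnd ℂ) (chiE χ w) * G := by
    rw [SS, map_sum, Finset.sum_mul, Finset.sum_mul]
    refine Finset.sum_congr rfl ?_
    intro m _
    rw [hshift _ (mul_ne_zero hw0 (hne m)), chiE_mul, map_mul]
    ring
  have hR : ∑ m : F, ∑ x : E, chiE χ x * ψ (l (x * (w * (algebraMap F E m + θ)))) =
      Fintype.card F * (∑ r : F, χ r ^ 3 * ψ r) * SS χ θ := by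
    rw [Finset.sum_comm]
    have e1 : ∀ x : E, ∑ m : F, chiE χ x * ψ (l (x * (w * (algebraMap F E m + θ)))) =
        chiE χ x * ψ (l (x * w * θ)) * (if l (x * w) = 0 then (Fintype.card F : ℂ) else 0) := by
      intro x
      have := AddChar.sum_mulShift (l (x * w)) hψ
      have h' : (if l (x * w) = 0 then (Fintype.card F : ℂ) else 0) = ∑ m : F, ψ (m * l (x * w)) := by
        rw [this]; split_ifs <;> simp
      rw [h', Finset.mul_sum]
      refine Finset.sum_congr rfl ?_
      intro m _
      have : x * (w * (algebraMap F E m + θ)) = m • (x * w) + x * w * θ := by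
        rw [Algebra.smul_def]; ring
      rw [this, map_add, map_smul, AddChar.map_add_eq_mul, smul_eq_mul]
      ring
    simp only [e1]
    rw [← (bij h3 hθ).sum_comp, Fintype.sum_prod_type]
    simp only [Fintype.sum_prod_type]
    have l1 : ∀ s r t : F, l ((algebraMap F E s + algebraMap F E r * θ + algebraMap F E t * θ ^ 2) * w) = t := by
      intro s r t
      have : (algebraMap F E s + algebraMap F E r * θ + algebraMap F E t * θ ^ 2) * w =
        s • w + r • (w * θ) + t • (w * θ ^ 2) := by
        simp only [Algebra.smul_def]; ring
      rw [this]; simp [hw1, hw2, hw3]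
    have l2 : ∀ s r : F, l ((algebraMap F E s + algebraMap F E r * θ + algebraMap F E 0 * θ ^ 2) * w * θ) = r := by
      intro s r
      have : (algebraMap F E s + algebraMap F E r * θ + algebraMap F E 0 * θ ^ 2) * w * θ =
        s • (w * θ) + r • (w * θ ^ 2) := by
        simp only [Algebra.smul_def, map_zero]; ring
      rw [this]; simp [hw2, hw3]
    have e2 : ∀ s r : F, ∑ t : F, chiE χ (algebraMap F E s + algebraMap F E r * θ + algebraMap F E t * θ ^ 2) *
        ψ (l ((algebraMap F E s + algebraMap F E r * θ + algebraMap F E t * θ ^ 2) * w * θ)) *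
        (if l ((algebraMap F E s + algebraMap F E r * θ + algebraMap F E t * θ ^ 2) * w) = 0 then (Fintype.card F : ℂ) else 0)
        = chiE χ (algebraMap F E s + algebraMap F E r * θ) * ψ r * Fintype.card F := by
      intro s r
      simp only [l1]
      rw [Finset.sum_eq_single 0]
      · rw [l2]; simp
      · intro t _ ht; simp [ht]
      · simp
    simp only [e2]
    rw [Finset.sum_comm]
    have e3 : ∀ r : F, ∑ s : F, chiE χ (algebraMap F E s + algebraMap F E r * θ) = χ r ^ 3 * SS χ θ := by
      intro r
      by_cases hr : r = 0
      · subst hr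
        rw [MulChar.map_zero]
        simp only [map_zero, zero_mul, add_zero, chiE_alg h3, chi3_sum hχ]
        simp
      · have hb : Function.Bijective (fun x : F => r * x) := mulLeft_bijective₀ r hr
        rw [← hb.sum_comp, SS, Finset.mul_sum]
        refine Finset.sum_congr rfl ?_
        intro s _
        rw [← chiE_alg h3 χ r, ← chiE_mul]
        congr 1
        rw [map_mul]; ring
    rw [Finset.mul_sum, Finset.sum_mul]
    refine Finset.sum_congr rfl ?_
    intro r _
    rw [← Finset.sum_mul, ← Finset.sum_mul, e3]
    ring
  refine ⟨(starRingEnd ℂ) (chiE χ w), ?_, ?_⟩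
  · rw [← map_pow, chiE_pow4 h3 hχ hw0, map_one]
  · rw [← hL, hR]

lemma norm_SS (h3 : Module.finrank F E = 3) {χ : MulChar F ℂ} (hF : ringChar F ≠ 2) (hχ : orderOf χ = 4)
    (hη : quadraticChar F (-1) = 1) {θ : E} (hθ : θ ∉ Set.range (algebraMap F E)) :
    Complex.normSq (SS χ θ) = Fintype.card F := by
  have : FiniteDimensional F E := FiniteDimensional.of_finrank_pos (by omega)
  obtain ⟨a, b, c, h⟩ := norm_cubic h3 θ
  have hr : ∀ x : F, x ^ 3 + a * x ^ 2 + b * x + c ≠ 0 := by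
    intro x
    rw [← h, Algebra.norm_ne_zero_iff]
    intro hx
    apply hθ
    exact ⟨-x, by rw [map_neg]; linear_combination -hx⟩
  rw [← CLEll.normS hF hχ hη hr, SS]
  simp only [chiE, h]

def isG (z : ℂ) : Prop := ∃ m n : ℤ, z = m + n * Complex.I

lemma isG_add {x y : ℂ} (hx : isG x) (hy : isG y) : isG (x + y) := by
  obtain ⟨m, n, rfl⟩ := hx
  obtain ⟨m', n', rfl⟩ := hy
  exact ⟨m + m', n + n', by push_cast; ring⟩

lemma isG_mul {x y : ℂ} (hx : isG x) (hy : isG y) : isG (x * y) := by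
  obtain ⟨m, n, rfl⟩ := hx
  obtain ⟨m', n', rfl⟩ := hy
  refine ⟨m * m' - n * n', m * n' + n * m', ?_⟩
  push_cast
  linear_combination (n * n' : ℂ) * Complex.I_sq

lemma isG_conj {x : ℂ} (hx : isG x) : isG ((starRingEnd ℂ) x) := by
  obtain ⟨m, n, rfl⟩ := hx
  refine ⟨m, -n, ?_⟩
  simp

lemma pow4_cases {u : ℂ} (hu : u ^ 4 = 1) : u = 1 ∨ u = -1 ∨ u = Complex.I ∨ u = -Complex.I := by
  have h : (u ^ 2 - 1) * (u ^ 2 + 1) = 0 := by linear_combination hu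
  rcases mul_eq_zero.1 h with h | h
  · have h' : (u - 1) * (u + 1) = 0 := by linear_combination h
    rcases mul_eq_zero.1 h' with h | h
    · exact Or.inl (sub_eq_zero.1 h)
    · exact Or.inr (Or.inl (eq_neg_of_add_eq_zero_left h))
  · have h' : (u - Complex.I) * (u + Complex.I) = 0 := by linear_combination h - Complex.I_sq
    rcases mul_eq_zero.1 h' with h | h
    · exact Or.inr (Or.inr (Or.inl (sub_eq_zero.1 h)))
    · exact Or.inr (Or.inr (Or.inr (eq_neg_of_add_eq_zero_left h)))

lemma isG_chi {χ : MulChar F ℂ} (hχ : orderOf χ = 4) (z : F) : isG (χ z) := by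
  by_cases hz : z = 0
  · subst hz; exact ⟨0, 0, by rw [MulChar.map_zero]; simp⟩
  · rcases pow4_cases (chi_pow4 hχ hz) with h | h | h | h <;> rw [h]
    · exact ⟨1, 0, by simp⟩
    · exact ⟨-1, 0, by simp⟩
    · exact ⟨0, 1, by simp⟩
    · exact ⟨0, -1, by simp⟩

lemma isG_SS {χ : MulChar F ℂ} (hχ : orderOf χ = 4) (θ : E) : isG (SS χ θ) := by
  refine Finset.sum_induction _ isG (fun _ _ => isG_add) ⟨0, 0, by simp⟩ ?_
  intro t _
  exact isG_chi hχ _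

lemma gauss_sq_unit {z : ℂ} {q : ℤ} (hq : Odd q) (hz : isG z) {v : ℂ} (hv : v ^ 4 = 1)
    (h : z ^ 2 = q ^ 2 * v) : z ^ 4 = q ^ 4 := by
  obtain ⟨m, n, rfl⟩ := hz
  have key : ∀ s : ℤ, s = 1 ∨ s = -1 → v = s * Complex.I → False := by
    intro s hs hvs
    rw [hvs] at h
    have hre := congrArg Complex.re h
    have him := congrArg Complex.im h
    have e1 : ((m : ℂ) + n * Complex.I) ^ 2 = ((m ^ 2 - n ^ 2 : ℤ) : ℂ) + ((2 * m * n : ℤ) : ℂ) * Complex.I := by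
      push_cast
      linear_combination (n ^ 2 : ℂ) * Complex.I_sq
    have e2 : (q : ℂ) ^ 2 * (s * Complex.I) = ((q ^ 2 * s : ℤ) : ℂ) * Complex.I := by push_cast; ring
    rw [e1, e2] at him
    simp only [Complex.add_im, Complex.mul_im, Complex.intCast_im, Complex.intCast_re, Complex.I_im, Complex.I_re] at him
    have him' : 2 * m * n = q ^ 2 * s := by
      have : ((2 * m * n : ℤ) : ℝ) = ((q ^ 2 * s : ℤ) : ℝ) := by linarith
      exact_mod_cast this
    have ho : Odd (q ^ 2 * s) := by
      apply Odd.mul hq.pow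
      rcases hs with rfl | rfl <;> decide
    rw [← him'] at ho
    rw [← Int.not_even_iff_odd] at ho
    exact ho ⟨m * n, by ring⟩
  have e : ((m : ℂ) + n * Complex.I) ^ 4 = q ^ 4 * v ^ 2 := by
    rw [show ((m : ℂ) + n * Complex.I) ^ 4 = (((m : ℂ) + n * Complex.I) ^ 2) ^ 2 by ring, h]; ring
  rw [e]
  rcases pow4_cases hv with hv | hv | hv | hv
  · rw [hv]; ring
  · rw [hv]; ring
  · exact (key 1 (Or.inl rfl) (by rw [hv]; simp)).elim
  · exact (key (-1) (Or.inr rfl) (by rw [hv]; simp)).elim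

lemma SS_ratio (h3 : Module.finrank F E = 3) {χ : MulChar F ℂ} (hF : ringChar F ≠ 2) (hχ : orderOf χ = 4)
    (hη : quadraticChar F (-1) = 1) {θ θ' : E} (hθ : θ ∉ Set.range (algebraMap F E))
    (hθ' : θ' ∉ Set.range (algebraMap F E)) : ∃ u : ℂ, u ^ 4 = 1 ∧ SS χ θ = u * SS χ θ' := by
  have hfd : FiniteDimensional F E := FiniteDimensional.of_finrank_pos (by omega)
  have hN := norm_SS h3 hF hχ hη hθ
  have hN' := norm_SS h3 hF hχ hη hθ'
  have hq0 : (Fintype.card F : ℂ) ≠ 0 := by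
    have := Fintype.card_ne_zero (α := F)
    exact_mod_cast this
  obtain ⟨ψ, hψ⟩ : ∃ ψ : AddChar F ℂ, ψ.IsPrimitive := by
    obtain ⟨ψ, hψ⟩ := (AddChar.exists_apply_ne_zero (α := F) (a := 1)).2 one_ne_zero
    exact ⟨ψ, AddChar.IsPrimitive.of_ne_one (fun h => hψ (by rw [h]; simp))⟩
  have hodd : Odd (Fintype.card F : ℤ) := by
    have := FiniteField.odd_card_of_char_ne_two hF
    exact_mod_cast Nat.odd_iff.2 this
  obtain ⟨l, hl⟩ : ∃ l : E →ₗ[F] F, l ≠ 0 := by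
    refine ⟨(Module.finBasisOfFinrankEq F E h3).coord 0, ?_⟩
    intro h
    have := congrArg (fun g => g ((Module.finBasisOfFinrankEq F E h3) 0)) h
    simp at this
  obtain ⟨u, hu, e⟩ := funceq h3 hχ hψ l hl hθ
  obtain ⟨u', hu', e'⟩ := funceq h3 hχ hψ l hl hθ'
  set G := ∑ x : E, chiE χ x * ψ (l x)
  set g := ∑ r : F, χ r ^ 3 * ψ r with hg
  have hg0 : g ≠ 0 := by
    have hne : χ ^ 3 ≠ 1 := by
      intro h
      have := orderOf_dvd_of_pow_eq_one h
      rw [hχ] at this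
      norm_num at this
    have := gaussSum_ne_zero_of_nontrivial hq0 hne hψ
    rw [gaussSum] at this
    simpa only [MulChar.pow_apply' _ (show 3 ≠ 0 by norm_num)] using this
  set s := SS χ θ
  set s' := SS χ θ'
  have hm : s * (starRingEnd ℂ) s = Fintype.card F := by rw [Complex.mul_conj, hN]; simp
  have hm' : s' * (starRingEnd ℂ) s' = Fintype.card F := by rw [Complex.mul_conj, hN']; simp
  have hs : s ≠ 0 := by
    intro h; rw [h, zero_mul] at hm; exact hq0 hm.symm
  have hs' : s' ≠ 0 := by
    intro h; rw [h, zero_mul] at hm'; exact hq0 hm'.symm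
  have hG : G ≠ 0 := by
    intro h
    rw [h, mul_zero] at e
    exact mul_ne_zero (mul_ne_zero hq0 hg0) hs e.symm
  have hu0 : u' ≠ 0 := by rintro rfl; norm_num at hu'
  set z := s * (starRingEnd ℂ) s' with hz
  have hzz : (starRingEnd ℂ) s * s' * u = z * u' := by
    have : G * ((Fintype.card F : ℂ) * g) * ((starRingEnd ℂ) s * s' * u) =
       G * ((Fintype.card F : ℂ) * g) * (z * u') := by
      rw [hz]
      linear_combination ((Fintype.card F : ℂ) * g) * s' * e - ((Fintype.card F : ℂ) * g) * s * e'
    exact mul_left_cancel₀ (mul_ne_zero hG (mul_ne_zero hq0 hg0)) this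
  have hz2 : z ^ 2 = ((Fintype.card F : ℤ) : ℂ) ^ 2 * (u / u') := by
    rw [mul_div_assoc', eq_div_iff hu0]
    push_cast
    calc z ^ 2 * u' = z * (z * u') := by ring
      _ = (s * (starRingEnd ℂ) s) * (s' * (starRingEnd ℂ) s') * u := by rw [← hzz, hz]; ring
      _ = _ := by rw [hm, hm']; ring
  have hz4 := gauss_sq_unit hodd (isG_mul (isG_SS hχ θ) (isG_conj (isG_SS hχ θ')))
    (by rw [div_pow, hu, hu', div_one]) hz2
  push_cast at hz4
  refine ⟨z / Fintype.card F, ?_, ?_⟩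
  · rw [div_pow, div_eq_one_iff_eq (pow_ne_zero _ hq0)]
    exact hz4
  · rw [div_mul_eq_mul_div, eq_div_iff hq0, hz, ← hm']; ring

end CLExt

namespace CLCount
variable {F V : Type*} [Field F] [Fintype F] [AddCommGroup V] [Module F V] [Fintype V]

lemma card_sub (m : Submodule F V) :
    (∑ v : V, if v ∈ m then (1 : ℝ) else 0) = (Fintype.card F : ℝ) ^ Module.finrank F m := by
  have h1 := Module.card_eq_pow_finrank (K := F) (V := m)
  rw [Finset.sum_boole, ← Fintype.card_subtype]
  rw [show Fintype.card {x // x ∈ m} = Fintype.card F ^ Module.finrank F m by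
    rw [← h1]]
  push_cast
  rfl

lemma sum_span (w : V → ℝ) (w0 : w 0 = 0) (hom : ∀ (c : F) (v : V), c ≠ 0 → w (c • v) = w v)
    {u : V} (hu : u ≠ 0) :
    (∑ v : V, if v ∈ Submodule.span F {u} then w v else 0) = ((Fintype.card F : ℝ) - 1) * w u := by
  rw [← Finset.sum_filter, Finset.sum_subtype (p := fun v => v ∈ Submodule.span F {u}) _ (by simp) w]
  rw [← (LinearEquiv.toSpanNonzeroSingleton F V u hu).toEquiv.sum_comp]
  have : ∀ c : F, w (((LinearEquiv.toSpanNonzeroSingleton F V u hu).toEquiv c : Submodule.span F {u}) : V)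
      = w u - (if c = 0 then w u else 0) := by
    intro c
    have : (((LinearEquiv.toSpanNonzeroSingleton F V u hu).toEquiv c : Submodule.span F {u}) : V) = c • u := rfl
    rw [this]
    split_ifs with h
    · simp [h, w0]
    · simp [hom c u h]
  simp only [this]
  simp [Finset.sum_sub_distrib]
  ring

lemma finrank_pair {u v : V} (hu : u ≠ 0) (hv : v ∉ Submodule.span F {u}) :
    Module.finrank F (Submodule.span F {u, v}) = 2 := by
  have hli : LinearIndependent F ![u, v] := by
    rw [LinearIndependent.pair_iff' hu]
    intro a ha
    exact hv (Submodule.mem_span_singleton.2 ⟨a, ha⟩)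
  have := finrank_span_eq_card hli
  rw [show Set.range ![u, v] = {u, v} by simp [Set.pair_comm]] at this
  simpa using this

lemma unique_line {u v : V} (hu : u ≠ 0) (hv : v ∉ Submodule.span F {u}) {m : Submodule F V}
    (hm : Module.finrank F m = 2) (h1 : u ∈ m) (h2 : v ∈ m) : m = Submodule.span F {u, v} := by
  symm
  apply Submodule.eq_of_le_of_finrank_eq
  · rw [Submodule.span_le]
    rintro x (rfl | rfl)
    · exact h1
    · exact h2
  · rw [finrank_pair hu hv, hm]

/-- The finite set of lines. -/
noncomputable def lines (F V : Type*) [Field F] [AddCommGroup V] [Module F V] [Fintype V] :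
    Finset (Submodule F V) :=
  (Set.toFinite {m : Submodule F V | Module.finrank F m = 2}).toFinset

lemma mem_lines {m : Submodule F V} : m ∈ lines F V ↔ Module.finrank F m = 2 := by
  simp [lines]

lemma pair_count {u : V} (hu : u ≠ 0) (v : V) :
    (∑ m ∈ lines F V, if u ∈ m then (if v ∈ m then (1 : ℝ) else 0) else 0) =
      1 + (if v ∈ Submodule.span F {u} then (∑ m ∈ lines F V, if u ∈ m then (1 : ℝ) else 0) - 1 else 0) := by
  split_ifs with hv
  · rw [add_sub_cancel]
    refine Finset.sum_congr rfl ?_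
    intro m _
    split_ifs with h1 h2
    · rfl
    · exact (h2 ((Submodule.span_singleton_le_iff_mem u m).2 h1 hv)).elim
    · rfl
  · rw [Finset.sum_eq_single (Submodule.span F {u, v})]
    · have a : u ∈ Submodule.span F {u, v} := Submodule.subset_span (by simp)
      have b : v ∈ Submodule.span F {u, v} := Submodule.subset_span (by simp)
      simp [a, b]
    · intro m hm hne
      split_ifs with h1 h2
      · exact (hne (unique_line hu hv (mem_lines.1 hm) h1 h2)).elim
      · rfl
      · rfl
    · intro h
      exact (h (mem_lines.2 (finrank_pair hu hv))).elim

lemma num_lines (h4 : Fintype.card V = Fintype.card F ^ 4) {u : V} (hu : u ≠ 0) :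
    (∑ m ∈ lines F V, if u ∈ m then (1 : ℝ) else 0) = (Fintype.card F : ℝ) ^ 2 + Fintype.card F + 1 := by
  set N := ∑ m ∈ lines F V, if u ∈ m then (1 : ℝ) else 0 with hN
  set q : ℝ := (Fintype.card F : ℝ) with hq
  have hq1 : 1 < q := by
    rw [hq]; exact_mod_cast Fintype.one_lt_card
  have e1 : ∑ v : V, ∑ m ∈ lines F V, (if u ∈ m then (if v ∈ m then (1 : ℝ) else 0) else 0) = N * q ^ 2 := by
    rw [Finset.sum_comm, hN, Finset.sum_mul]
    refine Finset.sum_congr rfl ?_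
    intro m hm
    split_ifs with h
    · rw [card_sub, mem_lines.1 hm]; simp [hq]
    · simp
  have e2 : ∑ v : V, ∑ m ∈ lines F V, (if u ∈ m then (if v ∈ m then (1 : ℝ) else 0) else 0) = q ^ 4 + q * (N - 1) := by
    simp only [pair_count hu]
    rw [Finset.sum_add_distrib]
    have : ∀ v : V, (if v ∈ Submodule.span F {u} then N - 1 else 0) = (if v ∈ Submodule.span F {u} then (1 : ℝ) else 0) * (N - 1) := by
      intro v; split_ifs <;> simp
    simp only [← hN, this]
    rw [← Finset.sum_mul, card_sub, finrank_span_singleton hu]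
    simp [h4, hq]
  have e3 : (q ^ 2 - q) * (N - (q ^ 2 + q + 1)) = 0 := by
    have := e1.symm.trans e2
    linear_combination this
  rcases mul_eq_zero.1 e3 with h | h
  · nlinarith
  · linarith

lemma point_sum (h4 : Fintype.card V = Fintype.card F ^ 4) (w : V → ℝ) (w0 : w 0 = 0)
    (hom : ∀ (c : F) (v : V), c ≠ 0 → w (c • v) = w v) {u : V} (hu : u ≠ 0) :
    (∑ m ∈ lines F V, if u ∈ m then (∑ v : V, if v ∈ m then w v else 0) else 0) =
      (∑ v : V, w v) + ((Fintype.card F : ℝ) ^ 2 + Fintype.card F) * (((Fintype.card F : ℝ) - 1) * w u) := by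
  have e1 : ∀ m ∈ lines F V, (if u ∈ m then (∑ v : V, if v ∈ m then w v else 0) else 0) =
      ∑ v : V, (if u ∈ m then (if v ∈ m then (1 : ℝ) else 0) else 0) * w v := by
    intro m _
    split_ifs with h
    · refine Finset.sum_congr rfl ?_
      intro v _
      split_ifs <;> simp
    · simp
  rw [Finset.sum_congr rfl e1, Finset.sum_comm]
  simp only [← Finset.sum_mul, pair_count hu, num_lines h4 hu]
  rw [← sum_span w w0 hom hu, Finset.mul_sum, ← Finset.sum_add_distrib]
  refine Finset.sum_congr rfl ?_
  intro v _
  split_ifs <;> ring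

lemma inter_count {l m : Submodule F V} (hl : Module.finrank F l = 2) (hm : Module.finrank F m = 2) :
    (∑ u : V, if u ∈ l ∧ u ≠ 0 then (if u ∈ m then (1 : ℝ) else 0) else 0) =
      (if m = l then (Fintype.card F : ℝ) ^ 2 - Fintype.card F else 0) +
      (if m ⊓ l ≠ ⊥ then (Fintype.card F : ℝ) - 1 else 0) := by
  have e : (∑ u : V, if u ∈ l ∧ u ≠ 0 then (if u ∈ m then (1 : ℝ) else 0) else 0) =
      (Fintype.card F : ℝ) ^ Module.finrank F (m ⊓ l : Submodule F V) - 1 := by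
    rw [← card_sub]
    have : (1 : ℝ) = ∑ u : V, if u = 0 then (1 : ℝ) else 0 := by simp
    conv_rhs => rw [this]
    rw [← Finset.sum_sub_distrib]
    refine Finset.sum_congr rfl ?_
    intro u _
    by_cases h0 : u = 0
    · simp [h0]
    · by_cases h1 : u ∈ l <;> by_cases h2 : u ∈ m <;> simp [h0, h1, h2]
  rw [e]
  by_cases hml : m = l
  · subst hml
    have : m ≠ ⊥ := by
      rintro rfl
      simp at hm
    rw [inf_idem, hm, if_pos rfl, if_pos this]
    ring
  · by_cases hb : m ⊓ l = ⊥
    · rw [hb, if_neg hml, finrank_bot]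
      simp
    · have h1 : Module.finrank F (m ⊓ l : Submodule F V) = 1 := by
        have hpos : Module.finrank F (m ⊓ l : Submodule F V) ≠ 0 := by
          rw [Ne, Submodule.finrank_eq_zero]; exact hb
        have hle : Module.finrank F (m ⊓ l : Submodule F V) ≤ 2 := by
          rw [← hm]; exact Submodule.finrank_mono inf_le_left
        have hne : Module.finrank F (m ⊓ l : Submodule F V) ≠ 2 := by
          intro h
          apply hml
          have a := Submodule.eq_of_le_of_finrank_eq (inf_le_left : m ⊓ l ≤ m) (by rw [h, hm])
          have b := Submodule.eq_of_le_of_finrank_eq (inf_le_right : m ⊓ l ≤ l) (by rw [h, hl])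
          exact a.symm.trans b
        omega
      simp [h1, hml, hb]

lemma count (h4 : Fintype.card V = Fintype.card F ^ 4) (w : V → ℝ) (w0 : w 0 = 0)
    (hom : ∀ (c : F) (v : V), c ≠ 0 → w (c • v) = w v) (L : Set (Submodule F V))
    (hL : ∀ m ∈ L, Module.finrank F m = 2)
    (hI : ∀ m : Submodule F V, Module.finrank F m = 2 →
      (∑ v : V, if v ∈ m then w v else 0) = ((Fintype.card F : ℝ) - 1) * (if m ∈ L then 1 else 0))
    (l : Submodule F V) (hl : Module.finrank F l = 2) :
    ((Fintype.card F : ℝ) - 1) * ({m ∈ L | m ≠ l ∧ m ⊓ l ≠ ⊥}.ncard : ℝ) =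
      ((Fintype.card F : ℝ) + 1) * (∑ v : V, w v) +
      ((Fintype.card F : ℝ) - 1) * (((Fintype.card F : ℝ) ^ 2 - 1) * (if l ∈ L then 1 else 0)) := by
  set q : ℝ := (Fintype.card F : ℝ) with hq
  have hq1 : 1 < q := by
    rw [hq]; exact_mod_cast Fintype.one_lt_card
  set C : ℝ := ({m ∈ L | m ≠ l ∧ m ⊓ l ≠ ⊥}.ncard : ℝ) with hC
  have hCs : C = ∑ m ∈ lines F V, if m ∈ L ∧ m ≠ l ∧ m ⊓ l ≠ ⊥ then (1 : ℝ) else 0 := by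
    rw [hC, Finset.sum_boole, ← Set.ncard_coe_finset]
    congr 2
    ext m
    simp only [Set.mem_ofPred_eq, Finset.coe_filter, mem_lines]
    constructor
    · rintro ⟨a, b⟩; exact ⟨hL m a, a, b⟩
    · rintro ⟨_, b⟩; exact b
  have hlb : l ≠ ⊥ := by rintro rfl; simp at hl
  have e1 : ∑ u : V, (if u ∈ l ∧ u ≠ 0 then
      (∑ m ∈ lines F V, if u ∈ m then (∑ v : V, if v ∈ m then w v else 0) else 0) else 0) =
      (q ^ 2 - 1) * ((q - 1) * (if l ∈ L then 1 else 0)) + (q - 1) ^ 2 * C := by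
    have a : ∀ u : V, (if u ∈ l ∧ u ≠ 0 then
      (∑ m ∈ lines F V, if u ∈ m then (∑ v : V, if v ∈ m then w v else 0) else 0) else 0) =
      ∑ m ∈ lines F V, (if u ∈ l ∧ u ≠ 0 then (if u ∈ m then (1 : ℝ) else 0) else 0) *
        ((q - 1) * (if m ∈ L then 1 else 0)) := by
      intro u
      split_ifs with h
      · refine Finset.sum_congr rfl ?_
        intro m hm
        rw [hI m (mem_lines.1 hm)]
        split_ifs <;> simp
      · simp
    simp only [a]
    rw [Finset.sum_comm]
    simp only [← Finset.sum_mul]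
    have b : ∀ m ∈ lines F V, (∑ u : V, (if u ∈ l ∧ u ≠ 0 then (if u ∈ m then (1 : ℝ) else 0) else 0)) *
        ((q - 1) * (if m ∈ L then 1 else 0)) =
        (if m = l then (q ^ 2 - 1) * ((q - 1) * (if l ∈ L then 1 else 0)) else 0) +
          (q - 1) ^ 2 * (if m ∈ L ∧ m ≠ l ∧ m ⊓ l ≠ ⊥ then (1 : ℝ) else 0) := by
      intro m hm
      rw [inter_count hl (mem_lines.1 hm)]
      by_cases h1 : m = l
      · subst h1
        simp [hlb, ← hq]
      · by_cases h2 : m ∈ L <;> by_cases h3 : m ⊓ l = ⊥ <;> simp [h1, h2, h3, ← hq]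
        ring
    rw [Finset.sum_congr rfl b, Finset.sum_add_distrib, ← Finset.mul_sum, ← hCs]
    simp [mem_lines, hl]
  have e2 : ∑ u : V, (if u ∈ l ∧ u ≠ 0 then
      (∑ m ∈ lines F V, if u ∈ m then (∑ v : V, if v ∈ m then w v else 0) else 0) else 0) =
      (q ^ 2 - 1) * (∑ v : V, w v) + (q ^ 2 + q) * (q - 1) * ((q - 1) * (if l ∈ L then 1 else 0)) := by
    have a : ∀ u : V, (if u ∈ l ∧ u ≠ 0 then
      (∑ m ∈ lines F V, if u ∈ m then (∑ v : V, if v ∈ m then w v else 0) else 0) else 0) =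
      ((if u ∈ l then (1 : ℝ) else 0) - (if u = 0 then 1 else 0)) * (∑ v : V, w v) +
        (q ^ 2 + q) * (q - 1) * (if u ∈ l then w u else 0) := by
      intro u
      by_cases h0 : u = 0
      · simp [h0, w0]
      · by_cases h1 : u ∈ l
        · simp only [h1, h0, ne_eq, not_false_eq_true, and_self, if_true, if_false]
          rw [point_sum h4 w w0 hom h0]
          ring
        · simp [h0, h1]
    simp only [a]
    rw [Finset.sum_add_distrib, ← Finset.sum_mul, ← Finset.mul_sum, hI l hl, Finset.sum_sub_distrib,
      card_sub, hl]
    simp [← hq]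
  have e3 := e1.symm.trans e2
  have : (q - 1) * ((q - 1) * C) = (q - 1) * ((q + 1) * (∑ v : V, w v) + (q - 1) * ((q ^ 2 - 1) * (if l ∈ L then 1 else 0))) := by
    linear_combination e3
  exact mul_left_cancel₀ (by linarith) this

end CLCount

namespace CLExt
variable {F E : Type*} [Field F] [Fintype F] [Field E] [Fintype E] [Algebra F E]

/-- The affine weight. -/
noncomputable def gw (χ : MulChar F ℂ) (c : ℂ) (a : E) : ℝ :=
  ((c * chiE χ a).re + 1 / (Fintype.card F : ℝ) - (if a = 0 then 1 else 0)) / 2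

/-- The point weight on `F × E`. -/
noncomputable def pw (χ : MulChar F ℂ) (c : ℂ) (v : F × E) : ℝ :=
  if v.1 = 0 then 0 else gw χ c (v.1⁻¹ • v.2)

lemma pw_zero (χ : MulChar F ℂ) (c : ℂ) : pw χ c (0 : F × E) = 0 := by simp [pw]

lemma pw_smul (χ : MulChar F ℂ) (c : ℂ) (k : F) (v : F × E) (hk : k ≠ 0) :
    pw χ c (k • v) = pw χ c v := by
  unfold pw
  by_cases hv : v.1 = 0
  · simp [hv]
  · have : (v.1⁻¹ * k⁻¹) • k • v.2 = v.1⁻¹ • v.2 := by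
      rw [smul_smul]; congr 1; field_simp
    simp [hv, hk, this]

lemma pw_one (χ : MulChar F ℂ) (c : ℂ) (a : E) : pw χ c ((1, a) : F × E) = gw χ c a := by
  simp [pw]

lemma sum_const_ne (x : ℝ) : (∑ k : F, if k = 0 then 0 else x) = ((Fintype.card F : ℝ) - 1) * x := by
  have : ∀ k : F, (if k = 0 then 0 else x) = x - (if k = 0 then x else 0) := by
    intro k; split_ifs <;> simp
  simp only [this]
  simp [Finset.sum_sub_distrib]
  ring

lemma chiE_sum (h3 : Module.finrank F E = 3) {χ : MulChar F ℂ} (hχ : orderOf χ = 4) :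
    ∑ a : E, chiE (F := F) χ a = 0 := by
  have : FiniteDimensional F E := FiniteDimensional.of_finrank_pos (by omega)
  obtain ⟨s, hs⟩ : ∃ s : F, χ s ^ 3 ≠ 1 ∧ s ≠ 0 := by
    by_contra hcon
    push Not at hcon
    have hne : χ ^ 3 ≠ 1 := by
      intro h
      have := orderOf_dvd_of_pow_eq_one h
      rw [hχ] at this
      norm_num at this
    apply hne
    ext x
    rw [MulChar.pow_apply' _ (by norm_num), MulChar.one_apply x.isUnit]
    by_contra h
    exact x.ne_zero (hcon _ h)
  have hs0 : algebraMap F E s ≠ 0 := by simpa using hs.2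
  have hb : Function.Bijective (fun x : E => algebraMap F E s * x) := mulLeft_bijective₀ _ hs0
  have h1 := hb.sum_comp (fun x => chiE (F := F) χ x)
  simp only [chiE_mul, chiE_alg h3] at h1
  rw [← Finset.mul_sum] at h1
  have h2 : (χ s ^ 3 - 1) * ∑ a : E, chiE (F := F) χ a = 0 := by linear_combination h1
  rcases mul_eq_zero.1 h2 with h | h
  · exact (hs.1 (sub_eq_zero.1 h)).elim
  · exact h

lemma total (h3 : Module.finrank F E = 3) {χ : MulChar F ℂ} (hχ : orderOf χ = 4) (c : ℂ) :
    ∑ v : F × E, pw χ c v = ((Fintype.card F : ℝ) - 1) * (((Fintype.card F : ℝ) ^ 2 - 1) / 2) := by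
  have hq0 : (Fintype.card F : ℝ) ≠ 0 := by
    have := Fintype.card_ne_zero (α := F)
    exact_mod_cast this
  have hg : ∑ a : E, gw χ c a = ((Fintype.card F : ℝ) ^ 2 - 1) / 2 := by
    unfold gw
    rw [← Finset.sum_div, Finset.sum_sub_distrib, Finset.sum_add_distrib, ← Complex.re_sum,
      ← Finset.mul_sum, chiE_sum h3 hχ]
    have := Module.card_eq_pow_finrank (K := F) (V := E)
    rw [h3] at this
    simp [this]
    field_simp
  rw [Fintype.sum_prod_type, ← hg, ← sum_const_ne (F := F)]
  refine Finset.sum_congr rfl ?_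
  intro k _
  by_cases hk : k = 0
  · simp [pw, hk]
  · simp only [pw, hk, if_false]
    have hb : Function.Bijective (fun x : E => k⁻¹ • x) := MulAction.bijective₀ (inv_ne_zero hk)
    exact hb.sum_comp (fun x => gw χ c x)

lemma line_param (χ : MulChar F ℂ) (c : ℂ) (m : Submodule F (F × E)) (hm : Module.finrank F m = 2) :
    (∑ v : F × E, if v ∈ m then pw χ c v else 0) = 0 ∨
    ∃ a b : E, b ≠ 0 ∧ (∑ v : F × E, if v ∈ m then pw χ c v else 0) =
      ((Fintype.card F : ℝ) - 1) * ∑ t : F, gw χ c (a + t • b) := by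
  by_cases hall : ∀ v ∈ m, v.1 = 0
  · left
    refine Finset.sum_eq_zero ?_
    intro v _
    split_ifs with h
    · simp [pw, hall v h]
    · rfl
  right
  push Not at hall
  obtain ⟨v, hv, hv1⟩ := hall
  set a : E := v.1⁻¹ • v.2 with ha
  have hu : ((1, a) : F × E) ∈ m := by
    have := m.smul_mem v.1⁻¹ hv
    convert this using 1
    ext
    · simp [hv1]
    · simp [ha]
  obtain ⟨b, hb, hbm⟩ : ∃ b : E, b ≠ 0 ∧ ((0, b) : F × E) ∈ m := by
    let T : m →ₗ[F] F := (LinearMap.fst F F E) ∘ₗ m.subtype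
    have hT : ¬ Function.Injective T := by
      intro hinj
      have := LinearMap.finrank_le_finrank_of_injective hinj
      rw [hm] at this
      simp at this
    have hk : LinearMap.ker T ≠ ⊥ := fun h => hT (LinearMap.ker_eq_bot.1 h)
    obtain ⟨x, hxk, hx⟩ := Submodule.exists_mem_ne_zero_of_ne_bot hk
    have hx1 : (x : F × E).1 = 0 := hxk
    have hxe : (x : F × E) = (0, (x : F × E).2) := by ext <;> simp [hx1]
    refine ⟨(x : F × E).2, ?_, ?_⟩
    · intro h
      apply hx
      ext
      · simp [hx1]
      · simp [h]
    · rw [← hxe]; exact x.2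
  refine ⟨a, b, hb, ?_⟩
  have hmem : ∀ z : F × E, z ∈ m ↔ ∃ x y : F, x • ((1, a) : F × E) + y • ((0, b) : F × E) = z := by
    intro z
    rw [← Submodule.mem_span_pair, ← CLCount.unique_line (m := m) _ _ hm hu hbm]
    · simp
    · intro h
      obtain ⟨r, hr⟩ := Submodule.mem_span_singleton.1 h
      have h1 := congrArg Prod.fst hr
      have h2 := congrArg Prod.snd hr
      simp at h1 h2
      rw [h1] at h2
      simp at h2
      exact hb h2.symm
  have hinj : Function.Injective (fun x : F × F => x.1 • ((1, a) : F × E) + x.2 • ((0, b) : F × E)) := by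
    rintro ⟨x, y⟩ ⟨x', y'⟩ h
    have h1 := congrArg Prod.fst h
    have h2 := congrArg Prod.snd h
    simp at h1 h2
    subst h1
    simp only [add_right_inj] at h2
    rw [smul_left_injective F hb h2]
  rw [← Finset.sum_filter]
  have himg : (Finset.univ.filter (fun z : F × E => z ∈ m)) =
      Finset.univ.image (fun x : F × F => x.1 • ((1, a) : F × E) + x.2 • ((0, b) : F × E)) := by
    ext z
    simp only [Finset.mem_filter, Finset.mem_univ, true_and, Finset.mem_image, hmem, Prod.exists]
  rw [himg, Finset.sum_image (fun x _ y _ h => hinj h), Fintype.sum_prod_type, ← sum_const_ne (F := F)]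
  refine Finset.sum_congr rfl ?_
  intro k _
  by_cases hk : k = 0
  · simp [hk, pw]
  · simp only [hk, if_false]
    have hbb : Function.Bijective (fun x : F => k * x) := mulLeft_bijective₀ k hk
    rw [← hbb.sum_comp]
    refine Finset.sum_congr rfl ?_
    intro t _
    rw [← pw_one, ← pw_smul χ c k ((1, a + t • b) : F × E) hk]
    congr 1
    ext
    · simp
    · simp [mul_smul]

lemma line_val (h3 : Module.finrank F E = 3) {χ : MulChar F ℂ} (hF : ringChar F ≠ 2) (hχ : orderOf χ = 4)
    (hη : quadraticChar F (-1) = 1) {θ : E} (hθ : θ ∉ Set.range (algebraMap F E))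
    (m : Submodule F (F × E)) (hm : Module.finrank F m = 2) :
    (∑ v : F × E, if v ∈ m then pw χ ((1 + Complex.I) / SS χ θ) v else 0) = 0 ∨
    (∑ v : F × E, if v ∈ m then pw χ ((1 + Complex.I) / SS χ θ) v else 0) = (Fintype.card F : ℝ) - 1 := by
  have hq0 : (Fintype.card F : ℝ) ≠ 0 := by
    have := Fintype.card_ne_zero (α := F)
    exact_mod_cast this
  set c : ℂ := (1 + Complex.I) / SS χ θ with hc
  rcases line_param χ c m hm with h | ⟨a, b, hb, h⟩
  · exact Or.inl h
  rw [h]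
  have hs : ∑ t : F, chiE χ (a + t • b) = chiE χ b * SS χ (a / b) := by
    rw [SS, Finset.mul_sum]
    refine Finset.sum_congr rfl ?_
    intro t _
    rw [← chiE_mul, Algebra.smul_def]
    congr 1
    field_simp
    ring
  have hsum : ∑ t : F, gw χ c (a + t • b) =
      ((c * (chiE χ b * SS χ (a / b))).re + 1 - ∑ t : F, (if a + t • b = 0 then (1 : ℝ) else 0)) / 2 := by
    unfold gw
    rw [← Finset.sum_div, Finset.sum_sub_distrib, Finset.sum_add_distrib, ← Complex.re_sum,
      ← Finset.mul_sum, hs]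
    simp [hq0]
  rw [hsum]
  by_cases hr : a / b ∈ Set.range (algebraMap F E)
  · left
    obtain ⟨r, hr⟩ := hr
    have hS : SS χ (a / b) = 0 := by
      rw [← hr, SS, ← chi3_sum hχ]
      have hbb : Function.Bijective (fun x : F => x + r) := (Equiv.addRight r).bijective
      rw [← hbb.sum_comp (fun s => χ s ^ 3)]
      refine Finset.sum_congr rfl ?_
      intro t _
      rw [← map_add, chiE_alg h3]
    have hcnt : ∑ t : F, (if a + t • b = 0 then (1 : ℝ) else 0) = 1 := by
      rw [Finset.sum_eq_single (-r)]
      · rw [if_pos]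
        have hab : algebraMap F E r * b = a := by rw [hr, div_mul_cancel₀ _ hb]
        rw [Algebra.smul_def, map_neg]
        linear_combination -hab
      · intro t _ ht
        rw [if_neg]
        intro h0
        apply ht
        have : algebraMap F E t = algebraMap F E (-r) := by
          rw [map_neg, hr, ← neg_div, eq_div_iff hb]
          rw [Algebra.smul_def] at h0
          linear_combination h0
        exact (algebraMap F E).injective this
      · simp
    rw [hS, hcnt]
    simp
  · have hcnt : ∑ t : F, (if a + t • b = 0 then (1 : ℝ) else 0) = 0 := by
      refine Finset.sum_eq_zero ?_
      intro t _
      rw [if_neg]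
      intro h0
      apply hr
      refine ⟨-t, ?_⟩
      rw [map_neg, eq_div_iff hb]
      rw [Algebra.smul_def] at h0
      linear_combination -h0
    obtain ⟨u, hu, hu2⟩ := SS_ratio h3 hF hχ hη hr hθ
    have hS0 : SS χ θ ≠ 0 := by
      intro h0
      have := norm_SS h3 hF hχ hη hθ
      rw [h0] at this
      rw [map_zero] at this
      exact hq0 this.symm
    have hval : c * (chiE χ b * SS χ (a / b)) = (1 + Complex.I) * (chiE (F := F) χ b * u) := by
      rw [hu2, hc, div_mul_eq_mul_div, div_eq_iff hS0]; ring
    have hz : (chiE (F := F) χ b * u) ^ 4 = 1 := by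
      rw [mul_pow, hu, chiE_pow4 h3 hχ hb, one_mul]
    rw [hval, hcnt]
    rcases pow4_cases hz with hz | hz | hz | hz
    · right; rw [hz]; simp
    · left; rw [hz]; simp
    · left; rw [hz]; simp
    · right; rw [hz]; simp

end CLExt

lemma CL_exists {q : ℕ} (hq4 : q % 4 = 1)
    {F : Type*} [Field F] [Fintype F] (hF : Fintype.card F = q) :
    ∃ L : Set (Submodule F (Fin 4 → F)),
      (∀ l ∈ L, Module.finrank F l = 2) ∧
      ∀ l : Submodule F (Fin 4 → F), Module.finrank F l = 2 →
        {m ∈ L | m ≠ l ∧ m ⊓ l ≠ ⊥}.ncard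
          = (q ^ 2 - 1) / 2 * (q + 1) + (q ^ 2 - 1) * (if l ∈ L then 1 else 0) := by
  have hprime : Fact (ringChar F).Prime := ⟨CharP.char_is_prime F (ringChar F)⟩
  let E := FiniteField.Extension F (ringChar F) 3
  have h3 : Module.finrank F E = 3 := FiniteField.finrank_extension F (ringChar F) 3
  let _ : Fintype E := Fintype.ofFinite E
  have hfd : FiniteDimensional F E := FiniteDimensional.of_finrank_pos (by omega)
  have hc2 : ringChar F ≠ 2 := by
    intro h
    have := FiniteField.even_card_of_char_two h
    omega
  have hη : quadraticChar F (-1) = 1 := by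
    rw [quadraticChar_one_iff_isSquare (by simp), FiniteField.isSquare_neg_one_iff]
    omega
  obtain ⟨χ, hχ⟩ := MulChar.exists_mulChar_orderOf F (n := 4) (by omega) Complex.isPrimitiveRoot_I
  obtain ⟨θ, hθ⟩ : ∃ θ : E, θ ∉ Set.range (algebraMap F E) := by
    by_contra hcon
    push Not at hcon
    have h1 := Fintype.card_le_of_surjective _ (fun x => hcon x)
    have h2 := Module.card_eq_pow_finrank (K := F) (V := E)
    rw [h2, h3] at h1
    have h5 : 1 < Fintype.card F := Fintype.one_lt_card
    nlinarith [pow_lt_pow_right₀ h5 (show 1 < 3 by norm_num)]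
  let e : (Fin 4 → F) ≃ₗ[F] (F × E) := LinearEquiv.ofFinrankEq _ _ (by simp [h3])
  set c : ℂ := (1 + Complex.I) / CLExt.SS χ θ with hc
  let w : (Fin 4 → F) → ℝ := fun v => CLExt.pw χ c (e v)
  have hIe : ∀ m : Submodule F (Fin 4 → F), Module.finrank F m = 2 →
      (∑ v, if v ∈ m then w v else 0) = 0 ∨ (∑ v, if v ∈ m then w v else 0) = (Fintype.card F : ℝ) - 1 := by
    intro m hm
    have := CLExt.line_val h3 hc2 hχ hη hθ (m.map (e : (Fin 4 → F) →ₗ[F] (F × E)))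
      (by rw [LinearEquiv.finrank_map_eq]; exact hm)
    rw [← e.toEquiv.sum_comp] at this
    have hmm : ∀ v : Fin 4 → F, e.toEquiv v ∈ m.map (e : (Fin 4 → F) →ₗ[F] (F × E)) ↔ v ∈ m := by
      intro v
      simp
    simp only [hmm] at this
    exact this
  have hq1 : (1 : ℝ) < Fintype.card F := by exact_mod_cast Fintype.one_lt_card
  let L : Set (Submodule F (Fin 4 → F)) :=
    {m | Module.finrank F m = 2 ∧ (∑ v, if v ∈ m then w v else 0) = (Fintype.card F : ℝ) - 1}
  have hLdef : ∀ m, m ∈ L ↔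
      Module.finrank F m = 2 ∧ (∑ v, if v ∈ m then w v else 0) = (Fintype.card F : ℝ) - 1 := fun m => Iff.rfl
  clear_value L
  refine ⟨L, fun l hl => ((hLdef l).1 hl).1, ?_⟩
  intro l hl
  have key := CLCount.count (F := F) (V := Fin 4 → F) (by simp) w (by simp [w, CLExt.pw_zero])
    (by intro k v hk; simp only [w, map_smul]; exact CLExt.pw_smul χ c k _ hk) L (fun m hm => ((hLdef m).1 hm).1)
    (by
      intro m hm
      by_cases hmL : m ∈ L
      · rw [if_pos hmL, ((hLdef m).1 hmL).2, mul_one]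
      · rw [if_neg hmL, mul_zero]
        rcases hIe m hm with h | h
        · exact h
        · exact (hmL ((hLdef m).2 ⟨hm, h⟩)).elim) l hl
  have hW : ∑ v, w v = ((Fintype.card F : ℝ) - 1) * (((Fintype.card F : ℝ) ^ 2 - 1) / 2) := by
    rw [← CLExt.total h3 hχ c]
    exact e.toEquiv.sum_comp (fun v => CLExt.pw χ c v)
  rw [hW, hF] at key
  rw [hF] at hq1
  obtain ⟨k, hk⟩ : ∃ k, q ^ 2 = 2 * k + 1 := by
    have : Odd q := by rw [Nat.odd_iff]; omega
    exact this.pow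
  have hkR : (q : ℝ) ^ 2 = 2 * k + 1 := by exact_mod_cast hk
  rw [hk, show 2 * k + 1 - 1 = 2 * k by omega, show 2 * k / 2 = k by omega]
  have hfin : (({m ∈ L | m ≠ l ∧ m ⊓ l ≠ ⊥}.ncard : ℕ) : ℝ) =
      ((k * (q + 1) + 2 * k * (if l ∈ L then 1 else 0) : ℕ) : ℝ) := by
    apply mul_left_cancel₀ (show (q : ℝ) - 1 ≠ 0 by linarith)
    rw [key, hkR]
    split_ifs <;> push_cast <;> ring
  exact_mod_cast hfin

/-- Let `q` be a prime power with `q ≡ 5 or 9 (mod 12)`.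
Then `PG(3,q)` admits a Cameron–Liebler line class with parameter
`x = (q² − 1)/2`: identifying lines with 2-dimensional subspaces of `𝔽_q⁴`,
there is a set `ℒ` of lines such that for every line `ℓ`, the number of
`m ∈ ℒ` with `m ≠ ℓ` and `m ∩ ℓ ≠ {0}` equals
`((q² − 1)/2)·(q + 1) + (q² − 1)·[ℓ ∈ ℒ]` (Penttila's characterization). -/
theorem stmt_17 {q : ℕ} (hq12 : q % 12 = 5 ∨ q % 12 = 9)
    (hpp : ∃ p n : ℕ, p.Prime ∧ 0 < n ∧ q = p ^ n)
    {F : Type*} [Field F] [Fintype F] (hF : Fintype.card F = q) :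
    ∃ L : Set (Submodule F (Fin 4 → F)),
      (∀ l ∈ L, Module.finrank F l = 2) ∧
      ∀ l : Submodule F (Fin 4 → F), Module.finrank F l = 2 →
        {m ∈ L | m ≠ l ∧ m ⊓ l ≠ ⊥}.ncard
          = (q ^ 2 - 1) / 2 * (q + 1) + (q ^ 2 - 1) * (if l ∈ L then 1 else 0) := by
  exact CL_exists (by omega) hF
end

section
/- For every positive integer e, setting q = 3^{2e}, the projective space PG(3,q) admits a symmetric tactical decomposition with four point classes and four line classes: there exist a partition of the set of points (1-dimensional subspaces of 𝔽_q⁴) into four nonempty classes P₁, P₂, P₃, P₄ and a partition of the set of lines (2-dimensional subspaces of 𝔽_q⁴) into four nonempty classes L₁, L₂, L₃, L₄ such that for all i, j ∈ {1,2,3,4}: the number of lines of L_j containing a given point of P_i depends only on (i, j) and not on the chosen point, and the number of points of P_j contained in a given line of L_i depends only on (i, j) and not on the chosen line. -/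
section helpers
open Finset
set_option linter.unusedSectionVars false

section chars
variable {F : Type*} [Field F] [Fintype F] [DecidableEq F]

lemma sum_sq_sub (h2 : ringChar F ≠ 2) (Φ : F → ℂ) :
    ∑ x, Φ (x ^ 2) = ∑ v, (1 + ((quadraticChar F v : ℤ) : ℂ)) * Φ v := by
  have h : ∀ v : F, (1 + ((quadraticChar F v : ℤ) : ℂ)) = ∑ x : F, if x ^ 2 = v then (1:ℂ) else 0 := by
    intro v
    have := quadraticChar_card_sqrts h2 v
    rw [Finset.sum_boole, add_comm]
    have h3 : ((quadraticChar F v + 1 : ℤ) : ℂ) = (#{x : F | x ^ 2 = v} : ℂ) := by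
      rw [← this]
      simp
    rw [← h3]; push_cast; ring
  simp_rw [h, Finset.sum_mul]
  rw [Finset.sum_comm]
  simp

lemma two_eq [CharP F 3] : (2 : F) = -1 := by
  have h := CharP.cast_eq_zero F 3
  have : (3 : F) = 0 := by exact_mod_cast h
  linear_combination this

lemma three_eq [CharP F 3] : (3 : F) = 0 := by
  have h := CharP.cast_eq_zero F 3
  exact_mod_cast h

lemma ringChar_ne [CharP F 3] : ringChar F ≠ 2 := by
  rw [ringChar.eq F 3]; norm_num

lemma sum_add_inv [CharP F 3] (Φ : F → ℂ) :
    ∑ x : F, (if x = 0 then 0 else Φ (x + x⁻¹)) =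
      ∑ w, (1 + ((quadraticChar F (w ^ 2 - 1) : ℤ) : ℂ)) * Φ w := by
  have h3 : (3 : F) = 0 := three_eq
  have h : ∀ v : F, (1 + ((quadraticChar F v : ℤ) : ℂ)) = ∑ x : F, if x ^ 2 = v then (1:ℂ) else 0 := by
    intro v
    have := quadraticChar_card_sqrts ringChar_ne v
    rw [Finset.sum_boole, add_comm]
    have h3 : ((quadraticChar F v + 1 : ℤ) : ℂ) = (#{x : F | x ^ 2 = v} : ℂ) := by
      rw [← this]
      simp
    rw [← h3]; push_cast; ring
  simp_rw [h, Finset.sum_mul]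
  have h' : ∀ w : F, (∑ d : F, (if d ^ 2 = w ^ 2 - 1 then (1:ℂ) else 0) * Φ w) =
      ∑ x : F, (if x ^ 2 - x * w + 1 = 0 then (1:ℂ) else 0) * Φ w := by
    intro w
    rw [← Equiv.sum_comp (Equiv.addRight w)]
    refine Finset.sum_congr rfl fun x _ => ?_
    congr 1
    refine if_congr ?_ rfl rfl
    simp only [Equiv.coe_addRight]
    constructor
    · intro hh; linear_combination hh - (x * w) * h3
    · intro hh; linear_combination hh + (x * w) * h3
  simp_rw [h']
  rw [Finset.sum_comm]
  refine Finset.sum_congr rfl fun x _ => ?_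
  by_cases hx : x = 0
  · simp [hx]
  · rw [if_neg hx, Finset.sum_eq_single (x + x⁻¹)]
    · rw [if_pos, one_mul]; field_simp; ring
    · intro b _ hb
      rw [if_neg, zero_mul]
      intro h0; apply hb
      field_simp
      linear_combination -h0
    · simp

/-- `∑ χ(x) Φ(x + 1/x)` is a sum over shifted quadratic characters. -/
lemma sum_chi_add_inv [CharP F 3] (Φ : F → ℂ) :
    ∑ x : F, ((quadraticChar F x : ℤ) : ℂ) * Φ (x + x⁻¹) =
      ∑ w, (((quadraticChar F (w - 1) : ℤ) : ℂ) + ((quadraticChar F (w + 1) : ℤ) : ℂ)) * Φ w := by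
  have h3 : (3 : F) = 0 := three_eq
  have e1 := sum_sq_sub (F := F) ringChar_ne (fun v => if v = 0 then 0 else Φ (v + v⁻¹))
  have e2 := sum_add_inv (F := F) Φ
  have e3 := sum_add_inv (F := F) (fun z => Φ (z ^ 2 + 1))
  have e4 := sum_sq_sub (F := F) ringChar_ne
    (fun v => (1 + ((quadraticChar F (v - 1) : ℤ) : ℂ)) * Φ (v + 1))
  have e5 : ∀ x : F, (if x ^ 2 = 0 then (0:ℂ) else Φ (x ^ 2 + (x ^ 2)⁻¹)) =
      (if x = 0 then 0 else Φ ((x + x⁻¹) ^ 2 + 1)) := by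
    intro x
    by_cases hx : x = 0
    · simp [hx]
    · rw [if_neg hx, if_neg (pow_ne_zero 2 hx)]
      congr 1
      field_simp
      linear_combination -(x^2) * h3
  simp only [e5] at e1
  rw [e3] at e1
  have e6 : ∑ v : F, (1 + ((quadraticChar F v : ℤ) : ℂ)) *
      ((1 + ((quadraticChar F (v - 1) : ℤ) : ℂ)) * Φ (v + 1)) =
      ∑ w : F, (1 + ((quadraticChar F (w - 1) : ℤ) : ℂ)) *
      ((1 + ((quadraticChar F (w + 1) : ℤ) : ℂ)) * Φ w) := by
    rw [← Equiv.sum_comp (Equiv.addRight (-1 : F))]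
    refine Finset.sum_congr rfl fun x _ => ?_
    have e : x - 1 - 1 = x + 1 := by linear_combination -h3
    simp only [Equiv.coe_addRight, ← sub_eq_add_neg, sub_add_cancel, e]
  rw [e4, e6] at e1
  have e7 : ∑ v : F, (1 + ((quadraticChar F v : ℤ) : ℂ)) * (if v = 0 then 0 else Φ (v + v⁻¹)) =
      ∑ v : F, (if v = 0 then 0 else Φ (v + v⁻¹)) +
      ∑ x : F, ((quadraticChar F x : ℤ) : ℂ) * Φ (x + x⁻¹) := by
    rw [← Finset.sum_add_distrib]
    refine Finset.sum_congr rfl fun x _ => ?_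
    by_cases hx : x = 0
    · simp [hx]
    · simp only [if_neg hx]; ring
  rw [e7, e2] at e1
  have e8 := sub_eq_of_eq_add' e1
  rw [← e8, ← Finset.sum_sub_distrib]
  refine Finset.sum_congr rfl fun w _ => ?_
  have : w ^ 2 - 1 = (w - 1) * (w + 1) := by ring
  rw [this, map_mul]; push_cast; ring

/-- sums of F₃-quadratic polynomials: norm-square -/
lemma quad_normSq [CharP F 3] (ψ : AddChar F ℂ) (a b c : F) :
    ∃ κ : ℂ, IsIntegral ℤ κ ∧
      (∑ z : F, ψ (a * z ^ 4 + b * z ^ 2 + c * z)) *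
        (starRingEnd ℂ) (∑ z : F, ψ (a * z ^ 4 + b * z ^ 2 + c * z)) = (Fintype.card F : ℂ) * κ := by
  have h3 : (3 : F) = 0 := three_eq
  have hintg : ∀ x : F, IsIntegral ℤ (ψ x) := by
    intro x
    refine IsIntegral.of_pow (n := 3) (by norm_num) ?_
    rw [← AddChar.map_nsmul_eq_pow]
    have : 3 • x = 0 := by rw [nsmul_eq_mul]; push_cast; rw [h3, zero_mul]
    rw [this, AddChar.map_zero_eq_one]; exact isIntegral_one
  let B : F → (F →+ F) := fun h =>
    { toFun := fun z => a * (z ^ 3 * h + z * h ^ 3) + 2 * b * z * h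
      map_zero' := by ring
      map_add' := by
        intro x y
        linear_combination (a * h * (x^2*y + x*y^2)) * h3 }
  refine ⟨∑ h : F, ψ (a * h ^ 4 + b * h ^ 2 + c * h) *
    (if ψ.compAddMonoidHom (B h) = 0 then 1 else 0), ?_, ?_⟩
  · refine IsIntegral.sum _ fun h _ => (hintg _).mul ?_
    split_ifs
    · exact isIntegral_one
    · exact isIntegral_zero
  · rw [map_sum, Finset.sum_mul_sum, Finset.sum_comm]
    have : ∀ y : F, ∑ x : F, ψ (a * x ^ 4 + b * x ^ 2 + c * x) *
        (starRingEnd ℂ) (ψ (a * y ^ 4 + b * y ^ 2 + c * y)) =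
        ∑ h : F, ψ (a * h ^ 4 + b * h ^ 2 + c * h) * ψ (B h y) := by
      intro y
      rw [← Equiv.sum_comp (Equiv.addRight y)]
      refine Finset.sum_congr rfl fun h _ => ?_
      rw [← AddChar.map_neg_eq_conj, ← AddChar.map_add_eq_mul, ← AddChar.map_add_eq_mul]
      congr 1
      simp only [Equiv.coe_addRight, B, AddMonoidHom.coe_mk, ZeroHom.coe_mk]
      linear_combination (a * (h^3*y + h*y^3 + 2*h^2*y^2)) * h3
    simp_rw [this]
    rw [Finset.sum_comm, Finset.mul_sum]
    refine Finset.sum_congr rfl fun h _ => ?_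
    rw [← Finset.mul_sum]
    have := AddChar.sum_eq_ite (ψ.compAddMonoidHom (B h))
    simp only [AddChar.compAddMonoidHom_apply] at this
    rw [this]
    split_ifs <;> ring

lemma descent_omega (e : ℕ) : ∀ a b : ℤ, (9 : ℤ) ^ e ∣ a ^ 2 - a * b + b ^ 2 →
    (3 : ℤ) ^ e ∣ a ∧ (3 : ℤ) ^ e ∣ b := by
  induction e with
  | zero => simp
  | succ e ih =>
    intro a b h
    have h9 : (9 : ℤ) ∣ a ^ 2 - a * b + b ^ 2 := (dvd_pow_self 9 (Nat.succ_ne_zero e)).trans h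
    have h1 : (3 : ℤ) ∣ a + b := by
      apply Int.prime_three.dvd_of_dvd_pow (n := 2)
      obtain ⟨k, hk⟩ := h9
      exact ⟨3 * k + a * b, by linear_combination hk⟩
    obtain ⟨k, hk⟩ := h1
    have hb : b = 3 * k - a := by linear_combination hk
    have h2 : (3 : ℤ) ∣ a := by
      apply Int.prime_three.dvd_of_dvd_pow (n := 2)
      obtain ⟨m, hm⟩ := h9
      rw [hb] at hm
      exact ⟨m + a * k - k ^ 2 , by linarith⟩
    obtain ⟨a', rfl⟩ := h2
    have hb' : b = 3 * (k - a') := by rw [hb]; ring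
    rw [hb'] at h ⊢
    have h4 : (9 : ℤ) ^ e ∣ a' ^ 2 - a' * (k - a') + (k - a') ^ 2 := by
      obtain ⟨m, hm⟩ := h
      exact ⟨m, by rw [pow_succ (9 : ℤ)] at hm; linarith⟩
    obtain ⟨h5, h6⟩ := ih _ _ h4
    rw [pow_succ, mul_comm]
    exact ⟨mul_dvd_mul_left _ h5, mul_dvd_mul_left _ h6⟩

lemma descent_i (e : ℕ) : ∀ a b : ℤ, (9 : ℤ) ^ e ∣ a ^ 2 + b ^ 2 →
    (3 : ℤ) ^ e ∣ a ∧ (3 : ℤ) ^ e ∣ b := by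
  induction e with
  | zero => simp
  | succ e ih =>
    intro a b h
    have h9 : (9 : ℤ) ∣ a ^ 2 + b ^ 2 := (dvd_pow_self 9 (Nat.succ_ne_zero e)).trans h
    have h3 : (3:ℤ) ∣ a ∧ (3:ℤ) ∣ b := by
      have h3 : (a ^ 2 + b ^ 2) % 3 = 0 := by omega
      have ha : a % 3 = 0 ∨ a % 3 = 1 ∨ a % 3 = 2 := by omega
      have hb : b % 3 = 0 ∨ b % 3 = 1 ∨ b % 3 = 2 := by omega
      rcases ha with ha | ha | ha <;> rcases hb with hb | hb | hb <;>
        simp [pow_two, Int.add_emod, Int.mul_emod, ha, hb] at h3 <;> omega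
    obtain ⟨⟨a', rfl⟩, ⟨b', rfl⟩⟩ := h3
    have h4 : (9 : ℤ) ^ e ∣ a' ^ 2 + b' ^ 2 := by
      obtain ⟨m, hm⟩ := h
      exact ⟨m, by rw [pow_succ (9 : ℤ)] at hm; linarith⟩
    obtain ⟨h5, h6⟩ := ih _ _ h4
    rw [pow_succ, mul_comm]
    exact ⟨mul_dvd_mul_left _ h5, mul_dvd_mul_left _ h6⟩

lemma int_of_integral_div (n m : ℤ) (hm : m ≠ 0) (κ : ℂ) (hκ : IsIntegral ℤ κ)
    (h : (n : ℂ) = m * κ) : m ∣ n := by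
  have hm' : (m : ℂ) ≠ 0 := by exact_mod_cast hm
  have h1 : κ = algebraMap ℚ ℂ ((n : ℚ) / m) := by
    have : κ = n / m := by rw [h]; field_simp
    rw [this]; simp
  rw [h1] at hκ
  have h2 : IsIntegral ℤ ((n : ℚ) / m) :=
    (isIntegral_algebraMap_iff (algebraMap ℚ ℂ).injective).1 hκ
  obtain ⟨k, hk⟩ := IsIntegrallyClosed.isIntegral_iff.1 h2
  refine ⟨k, ?_⟩
  have hm'' : (m : ℚ) ≠ 0 := by exact_mod_cast hm
  have : (k : ℚ) * m = n := by
    have h5 : (k : ℚ) = n / m := by simpa using hk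
    rw [h5]; field_simp
  have : k * m = n := by exact_mod_cast this
  rw [← this]; ring

lemma quad_dvd [CharP F 3] (e : ℕ) (hF : Fintype.card F = 3 ^ (2 * e)) (ψ : AddChar F ℂ)
    (a b c : F) :
    ∃ κ : ℂ, IsIntegral ℤ κ ∧ ∑ z : F, ψ (a * z ^ 4 + b * z ^ 2 + c * z) = 3 ^ e * κ := by
  have h3 : (3 : F) = 0 := three_eq
  obtain ⟨κ, hκ, hZ⟩ := quad_normSq ψ a b c
  let w : ℂ := ⟨-1/2, Real.sqrt 3 / 2⟩
  have hs : Real.sqrt 3 * Real.sqrt 3 = 3 := Real.mul_self_sqrt (by norm_num)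
  have hw : w ^ 2 + w + 1 = 0 := by
    apply Complex.ext
    · simp [w, pow_two]; nlinarith
    · simp [w, pow_two]; ring
  have hwc : (starRingEnd ℂ) w = -1 - w := by
    apply Complex.ext
    · simp [w]; norm_num
    · simp [w]
  have hval : ∀ x : F, ∃ m n : ℤ, ψ x = m + n * w := by
    intro x
    have h1 : ψ x ^ 3 = 1 := by
      rw [← AddChar.map_nsmul_eq_pow]
      have : 3 • x = 0 := by rw [nsmul_eq_mul]; push_cast; rw [h3, zero_mul]
      rw [this, AddChar.map_zero_eq_one]
    have h2 : (ψ x - 1) * ((ψ x - w) * (ψ x + 1 + w)) = 0 := by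
      linear_combination h1 + (1 - ψ x) * hw
    rcases mul_eq_zero.1 h2 with h | h
    · exact ⟨1, 0, by push_cast; linear_combination h⟩
    · rcases mul_eq_zero.1 h with h | h
      · exact ⟨0, 1, by push_cast; linear_combination h⟩
      · exact ⟨-1, -1, by push_cast; linear_combination h⟩
  obtain ⟨m, n, hmn⟩ : ∃ m n : ℤ, ∑ z : F, ψ (a * z ^ 4 + b * z ^ 2 + c * z) = m + n * w := by
    refine Finset.sum_induction _ (fun t => ∃ m n : ℤ, t = m + n * w) ?_ ⟨0, 0, by simp⟩
      (fun x _ => hval _)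
    rintro _ _ ⟨m, n, rfl⟩ ⟨m', n', rfl⟩
    exact ⟨m + m', n + n', by push_cast; ring⟩
  rw [hmn] at hZ ⊢
  have hN : ((m ^ 2 - m * n + n ^ 2 : ℤ) : ℂ) = ((9 ^ e : ℤ) : ℂ) * κ := by
    have h9 : ((9 ^ e : ℤ) : ℂ) = (Fintype.card F : ℂ) := by
      rw [hF, pow_mul]; push_cast; norm_num
    rw [h9, ← hZ]
    simp only [map_add, map_mul, map_intCast, hwc]
    push_cast
    linear_combination ((n:ℂ)^2) * hw
  have := int_of_integral_div _ _ (by positivity) κ hκ hN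
  obtain ⟨⟨m', rfl⟩, ⟨n', rfl⟩⟩ := descent_omega e _ _ this
  refine ⟨m' + n' * w, ?_, by push_cast; ring⟩
  have hwi : IsIntegral ℤ w := by
    refine IsIntegral.of_pow (n := 3) (by norm_num) ?_
    have : w ^ 3 = 1 := by linear_combination (w - 1) * hw
    rw [this]; exact isIntegral_one
  exact (isIntegral_algebraMap (R := ℤ) (x := m')).add
    ((isIntegral_algebraMap (R := ℤ) (x := n')).mul hwi)

end chars

section chars2
variable {F : Type*} [Field F] [Fintype F] [DecidableEq F]

lemma eta_inv (η : MulChar F ℂ) (hη2 : ∀ v, η v ^ 2 = ((quadraticChar F v : ℤ) : ℂ)) (v : F) :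
    η⁻¹ v = η v ^ 3 := by
  by_cases hv : v = 0
  · subst hv; rw [MulChar.map_zero, MulChar.map_zero]; norm_num
  · rw [MulChar.inv_apply']
    have h1 : η v * η v⁻¹ = 1 := by rw [← map_mul, mul_inv_cancel₀ hv, map_one]
    have h2 : η v ^ 4 = 1 := by
      have : η v ^ 4 = (η v ^ 2) ^ 2 := by ring
      rw [this, hη2]
      have := quadraticChar_sq_one hv
      exact_mod_cast this
    linear_combination (-(η v⁻¹)) * h2 + (η v)^3 * h1

lemma kloo_eq [CharP F 3] (ψ : AddChar F ℂ) (η : MulChar F ℂ)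
    (hη2 : ∀ v, η v ^ 2 = ((quadraticChar F v : ℤ) : ℂ)) (hneg : quadraticChar F (-1) = 1) (ρ : F) :
    ∑ v, η⁻¹ v * ψ (ρ * (v + v⁻¹)) =
      ψ (2 * ρ) * (∑ z, ψ (ρ * z ^ 4 + 2 * ρ * z ^ 2 + 0 * z) -
        ∑ z, ψ (0 * z ^ 4 + ρ * z ^ 2 + 2 * ρ * z)) := by
  have h3 : (3 : F) = 0 := three_eq
  have e1 : ∑ v, η⁻¹ v * ψ (ρ * (v + v⁻¹)) = ∑ v, η v * ψ (ρ * (v + v⁻¹)) := by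
    rw [← Equiv.sum_comp (Equiv.inv F)]
    refine Finset.sum_congr rfl fun x _ => ?_
    simp only [Equiv.inv_apply, MulChar.inv_apply', inv_inv, add_comm]
  have e2 := sum_sq_sub (F := F) ringChar_ne (fun v => η v * ψ (ρ * (v + v⁻¹)))
  have e3 : ∑ v, (1 + ((quadraticChar F v : ℤ) : ℂ)) * (η v * ψ (ρ * (v + v⁻¹))) =
      ∑ v, η v * ψ (ρ * (v + v⁻¹)) + ∑ v, η⁻¹ v * ψ (ρ * (v + v⁻¹)) := by
    rw [← Finset.sum_add_distrib]
    refine Finset.sum_congr rfl fun x _ => ?_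
    rw [eta_inv η hη2, ← hη2]; ring
  have e4 : ∑ x : F, η (x ^ 2) * ψ (ρ * (x ^ 2 + (x ^ 2)⁻¹)) =
      ∑ x : F, ((quadraticChar F x : ℤ) : ℂ) * ψ (ρ * ((x + x⁻¹) ^ 2 + 1)) := by
    refine Finset.sum_congr rfl fun x _ => ?_
    rw [map_pow, hη2]
    by_cases hx : x = 0
    · simp [hx]
    · congr 3
      field_simp
      linear_combination -(x^2) * h3
  have e5 := sum_chi_add_inv (F := F) (fun w => ψ (ρ * (w ^ 2 + 1)))
  have e6 : ∑ w : F, ((quadraticChar F (w + 1) : ℤ) : ℂ) * ψ (ρ * (w ^ 2 + 1)) =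
      ∑ w : F, ((quadraticChar F (w - 1) : ℤ) : ℂ) * ψ (ρ * (w ^ 2 + 1)) := by
    rw [← Equiv.sum_comp (Equiv.neg F)]
    refine Finset.sum_congr rfl fun x _ => ?_
    simp only [Equiv.neg_apply]
    have : -x + 1 = (-1) * (x - 1) := by ring
    rw [this, map_mul, hneg, one_mul, neg_sq]
  have e7 : ∑ v, η⁻¹ v * ψ (ρ * (v + v⁻¹)) =
      ∑ w : F, ((quadraticChar F (w - 1) : ℤ) : ℂ) * ψ (ρ * (w ^ 2 + 1)) := by
    have h : ∑ w : F, (((quadraticChar F (w - 1) : ℤ) : ℂ) + ((quadraticChar F (w + 1) : ℤ) : ℂ)) *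
        ψ (ρ * (w ^ 2 + 1)) =
        ∑ w : F, ((quadraticChar F (w - 1) : ℤ) : ℂ) * ψ (ρ * (w ^ 2 + 1)) +
        ∑ w : F, ((quadraticChar F (w + 1) : ℤ) : ℂ) * ψ (ρ * (w ^ 2 + 1)) := by
      rw [← Finset.sum_add_distrib]
      exact Finset.sum_congr rfl fun x _ => by ring
    rw [h, e6, ← e4, e2, e3, e1] at e5
    rw [e1]
    linear_combination e5 / 2
  rw [e7]
  have e8 := sum_sq_sub (F := F) ringChar_ne (fun v => ψ (ρ * v ^ 2 + 2 * ρ * v))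
  rw [← Equiv.sum_comp (Equiv.addRight (1 : F))]
  have e9 : ∑ v, (1 + ((quadraticChar F v : ℤ) : ℂ)) * ψ (ρ * v ^ 2 + 2 * ρ * v) =
      ∑ z, ψ (0 * z ^ 4 + ρ * z ^ 2 + 2 * ρ * z) +
      ∑ v, ((quadraticChar F v : ℤ) : ℂ) * ψ (ρ * v ^ 2 + 2 * ρ * v) := by
    rw [← Finset.sum_add_distrib]
    exact Finset.sum_congr rfl fun x _ => by ring_nf
  have e10 : ∑ z, ψ (ρ * z ^ 4 + 2 * ρ * z ^ 2 + 0 * z) =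
      ∑ x : F, ψ (ρ * (x ^ 2) ^ 2 + 2 * ρ * (x ^ 2)) :=
    Finset.sum_congr rfl fun x _ => by ring_nf
  rw [e10, e8, e9, add_sub_cancel_left, Finset.mul_sum]
  refine Finset.sum_congr rfl fun x _ => ?_
  simp only [Equiv.coe_addRight, add_sub_cancel_right]
  rw [mul_left_comm, ← AddChar.map_add_eq_mul]
  congr 2
  ring

lemma psi_int [CharP F 3] (ψ : AddChar F ℂ) (x : F) : IsIntegral ℤ (ψ x) := by
  have h3 : (3 : F) = 0 := three_eq
  refine IsIntegral.of_pow (n := 3) (by norm_num) ?_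
  rw [← AddChar.map_nsmul_eq_pow]
  have : 3 • x = 0 := by rw [nsmul_eq_mul]; push_cast; rw [h3, zero_mul]
  rw [this, AddChar.map_zero_eq_one]; exact isIntegral_one

lemma chi_int (v : F) : IsIntegral ℤ ((quadraticChar F v : ℤ) : ℂ) :=
  isIntegral_algebraMap (R := ℤ) (x := quadraticChar F v)

lemma eta_int (η : MulChar F ℂ) (hη2 : ∀ v, η v ^ 2 = ((quadraticChar F v : ℤ) : ℂ)) (v : F) :
    IsIntegral ℤ (η v) := by
  refine IsIntegral.of_pow (n := 2) (by norm_num) ?_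
  rw [hη2]; exact chi_int v

lemma kloo_dvd [CharP F 3] (e : ℕ) (hF : Fintype.card F = 3 ^ (2 * e)) (ψ : AddChar F ℂ)
    (η : MulChar F ℂ)
    (hη2 : ∀ v, η v ^ 2 = ((quadraticChar F v : ℤ) : ℂ)) (hneg : quadraticChar F (-1) = 1)
    (α γ ρ : F) (hα : α ≠ 0) (hρ0 : ρ ≠ 0) (hρ : α * γ = ρ ^ 2) :
    ∃ κ : ℂ, IsIntegral ℤ κ ∧ ∑ v, η⁻¹ v * ψ (α * v + γ * v⁻¹) = 3 ^ e * κ := by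
  obtain ⟨k1, hk1, e1⟩ := quad_dvd e hF ψ ρ (2 * ρ) 0
  obtain ⟨k2, hk2, e2⟩ := quad_dvd e hF ψ 0 ρ (2 * ρ)
  have e3 := kloo_eq ψ η hη2 hneg ρ
  rw [e1, e2] at e3
  refine ⟨η⁻¹ (ρ / α) * (ψ (2 * ρ) * (k1 - k2)), ?_, ?_⟩
  · rw [eta_inv η hη2]
    exact ((eta_int η hη2 _).pow 3).mul ((psi_int ψ _).mul (hk1.sub hk2))
  · have e4 : ∑ v, η⁻¹ v * ψ (α * v + γ * v⁻¹) =
        η⁻¹ (ρ / α) * ∑ v, η⁻¹ v * ψ (ρ * (v + v⁻¹)) := by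
      rw [← Equiv.sum_comp (Equiv.mulLeft₀ (ρ / α) (div_ne_zero hρ0 hα)), Finset.mul_sum]
      refine Finset.sum_congr rfl fun x _ => ?_
      simp only [Equiv.mulLeft₀_apply]
      rw [map_mul, mul_assoc]
      congr 3
      by_cases hx : x = 0
      · simp [hx]
      · field_simp
        linear_combination hρ
    rw [e4, e3]; ring

lemma gauss_shift (η : MulChar F ℂ) (hη1 : η ≠ 1) (ψ : AddChar F ℂ) (z : F) :
    η z * gaussSum η⁻¹ ψ = ∑ b, η⁻¹ b * ψ (b * z) := by
  by_cases hz : z = 0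
  · subst hz
    simp only [MulChar.map_zero, zero_mul, mul_zero, AddChar.map_zero_eq_one, mul_one]
    rw [MulChar.sum_eq_zero_of_ne_one]
    simpa using hη1
  · unfold gaussSum
    rw [← Equiv.sum_comp (Equiv.mulRight₀ z hz), Finset.mul_sum]
    refine Finset.sum_congr rfl fun x _ => ?_
    simp only [Equiv.mulRight₀_apply]
    rw [map_mul, MulChar.inv_apply' η z]
    have h1 : η z * η z⁻¹ = 1 := by rw [← map_mul, mul_inv_cancel₀ hz, map_one]
    linear_combination (η⁻¹ x * ψ (x * z)) * h1

lemma quad_gauss [CharP F 3] (ψ : AddChar F ℂ) (hψ : ψ.IsPrimitive) (P Q : F) (hP : P ≠ 0) :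
    ∑ s, ψ (P * s ^ 2 + Q * s) = ((quadraticChar F P : ℤ) : ℂ) *
      (∑ v, ((quadraticChar F v : ℤ) : ℂ) * ψ v) * ψ (- Q ^ 2 / P) := by
  have h3 : (3 : F) = 0 := three_eq
  rw [← Equiv.sum_comp (Equiv.addRight (Q / P))]
  have e1 : ∀ s : F, ψ (P * (s + Q / P) ^ 2 + Q * (s + Q / P)) =
      ψ (P * s ^ 2) * ψ (- Q ^ 2 / P) := by
    intro s
    rw [← AddChar.map_add_eq_mul]
    congr 1
    field_simp
    linear_combination (P * Q * s + Q ^ 2) * h3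
  simp only [Equiv.coe_addRight, e1]
  rw [← Finset.sum_mul]
  congr 1
  have e2 := sum_sq_sub (F := F) ringChar_ne (fun v => ψ (P * v))
  rw [e2]
  have e3 : ∑ v : F, (1 + ((quadraticChar F v : ℤ) : ℂ)) * ψ (P * v) =
     ∑ v : F, ψ (P * v) + ∑ v : F, ((quadraticChar F v : ℤ) : ℂ) * ψ (P * v) := by
    rw [← Finset.sum_add_distrib]
    exact Finset.sum_congr rfl fun x _ => by ring
  have e4 : ∑ v : F, ψ (P * v) = 0 := by
    have := AddChar.sum_eq_zero_of_ne_one (hψ hP)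
    simpa [AddChar.mulShift_apply] using this
  rw [e3, e4, zero_add, ← Equiv.sum_comp (Equiv.mulLeft₀ P hP) (fun v => ((quadraticChar F v : ℤ) : ℂ) * ψ v),
    Finset.mul_sum]
  refine Finset.sum_congr rfl fun x _ => ?_
  simp only [Equiv.mulLeft₀_apply]
  rw [map_mul (quadraticChar F)]
  have : ((quadraticChar F P : ℤ) : ℂ) ^ 2 = 1 := by exact_mod_cast quadraticChar_sq_one hP
  push_cast
  linear_combination (-((quadraticChar F x : ℤ) : ℂ) * ψ (P * x)) * this

lemma chi_gauss_sq [CharP F 3] (e : ℕ) (hF : Fintype.card F = 3 ^ (2 * e)) (ψ : AddChar F ℂ)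
    (hψ : ψ.IsPrimitive) (hneg : quadraticChar F (-1) = 1) :
    ∃ κ : ℂ, IsIntegral ℤ κ ∧ ∑ v, ((quadraticChar F v : ℤ) : ℂ) * ψ v = 3 ^ e * κ := by
  have h1 : (quadraticChar F).ringHomComp (Int.castRingHom ℂ) ≠ 1 := by
    obtain ⟨a, ha⟩ := quadraticChar_exists_neg_one' (F := F) ringChar_ne
    intro h
    have := congrArg (fun c : MulChar F ℂ => c a) h
    simp [ha, MulChar.one_apply_coe] at this
    norm_num at this
  have h2 : ((quadraticChar F).ringHomComp (Int.castRingHom ℂ)).IsQuadratic :=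
    (quadraticChar_isQuadratic F).comp _
  have hg := gaussSum_sq h1 h2 hψ
  simp only [gaussSum, MulChar.ringHomComp_apply, hneg, hF] at hg
  simp only [eq_intCast, Int.cast_one, one_mul] at hg
  have h3 : (∑ v, ((quadraticChar F v : ℤ) : ℂ) * ψ v - 3 ^ e) *
     (∑ v, ((quadraticChar F v : ℤ) : ℂ) * ψ v + 3 ^ e) = 0 := by
    have : ((3 ^ (2 * e) : ℕ) : ℂ) = (3 ^ e) ^ 2 := by push_cast; ring
    linear_combination hg + this
  rcases mul_eq_zero.1 h3 with h | h
  · exact ⟨1, isIntegral_one, by linear_combination h⟩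
  · exact ⟨-1, isIntegral_one.neg, by linear_combination h⟩

end chars2

section chars3
variable {F : Type*} [Field F] [Fintype F] [DecidableEq F]

/-- The quartic character sum over an irreducible-type cubic, times a Gauss sum, is divisible by `q`. -/
lemma T_gauss [CharP F 3] (e : ℕ) (hF : Fintype.card F = 3 ^ (2 * e)) (ψ : AddChar F ℂ)
    (hψ : ψ.IsPrimitive) (hψ3 : ∀ x, ψ (x ^ 3) = ψ x) (η : MulChar F ℂ) (hη1 : η ≠ 1)
    (hη2 : ∀ v, η v ^ 2 = ((quadraticChar F v : ℤ) : ℂ)) (hneg : quadraticChar F (-1) = 1)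
    (A B C Δ : F) (hΔ0 : Δ ≠ 0) (hΔ : Δ ^ 2 = A ^ 2 * B ^ 2 - B ^ 3 - A ^ 3 * C) :
    ∃ κ : ℂ, IsIntegral ℤ κ ∧
      (∑ s, η (s ^ 3 + A * s ^ 2 + B * s + C)) * gaussSum η⁻¹ ψ = (Fintype.card F : ℂ) * κ := by
  have h3 : (3 : F) = 0 := three_eq
  have hcub : Function.Bijective (fun x : F => x ^ 3) := by
    have : Function.Injective (fun x : F => x ^ 3) := frobenius_inj F 3
    exact Finite.injective_iff_bijective.1 this
  let cube : F ≃ F := Equiv.ofBijective _ hcub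
  have hη3 : ∀ u, η⁻¹ (u ^ 3) = η u := by
    intro u
    rw [map_pow, eta_inv η hη2]
    by_cases hu : u = 0
    · subst hu; rw [MulChar.map_zero]; norm_num
    · have h2 : η u ^ 4 = 1 := by
        have : η u ^ 4 = (η u ^ 2) ^ 2 := by ring
        rw [this, hη2]
        exact_mod_cast quadraticChar_sq_one hu
      linear_combination (η u ^ 5 + η u) * h2
  have e1 : (∑ s, η (s ^ 3 + A * s ^ 2 + B * s + C)) * gaussSum η⁻¹ ψ =
      ∑ u, η u * ∑ s, ψ (u ^ 3 * A * s ^ 2 + (u + u ^ 3 * B) * s + u ^ 3 * C) := by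
    rw [Finset.sum_mul]
    simp_rw [gauss_shift η hη1 ψ]
    rw [Finset.sum_comm, ← Equiv.sum_comp cube]
    refine Finset.sum_congr rfl fun u _ => ?_
    rw [Finset.mul_sum]
    refine Finset.sum_congr rfl fun s _ => ?_
    simp only [cube, Equiv.ofBijective_apply]
    rw [hη3]
    congr 1
    have : u ^ 3 * (s ^ 3 + A * s ^ 2 + B * s + C) =
      (u * s) ^ 3 + (u ^ 3 * A * s ^ 2 + u ^ 3 * B * s + u ^ 3 * C) := by ring
    rw [this, AddChar.map_add_eq_mul, hψ3, ← AddChar.map_add_eq_mul]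
    congr 1; ring
  rw [e1]
  by_cases hA : A = 0
  · subst hA
    refine ⟨∑ u, η u * (ψ (u ^ 3 * C) * if u + u ^ 3 * B = 0 then 1 else 0), ?_, ?_⟩
    · refine IsIntegral.sum _ fun u _ => (eta_int η hη2 u).mul ((psi_int ψ _).mul ?_)
      split_ifs
      · exact isIntegral_one
      · exact isIntegral_zero
    · rw [Finset.mul_sum]
      refine Finset.sum_congr rfl fun u _ => ?_
      rw [mul_left_comm]
      congr 1
      have := AddChar.sum_mulShift (u + u ^ 3 * B) hψ
      have e2 : ∀ s : F, ψ (u ^ 3 * 0 * s ^ 2 + (u + u ^ 3 * B) * s + u ^ 3 * C) =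
        ψ (s * (u + u ^ 3 * B)) * ψ (u ^ 3 * C) := by
        intro s; rw [← AddChar.map_add_eq_mul]; congr 1; ring
      simp_rw [e2]
      rw [← Finset.sum_mul, this]
      split_ifs <;> simp [mul_comm]
  · obtain ⟨α', hα'⟩ := hcub.2 (C - B ^ 2 / A)
    obtain ⟨ρ, hρ⟩ := hcub.2 (Δ / A ^ 3)
    simp only at hα' hρ
    set α := α' + B / A with hαdef
    have hα3 : α ^ 3 = -(Δ ^ 2) / A ^ 3 := by
      have : α ^ 3 = α' ^ 3 + (B / A) ^ 3 := by
        rw [hαdef]; linear_combination (α' ^ 2 * (B / A) + α' * (B / A) ^ 2) * h3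
      rw [this, hα', hΔ]
      field_simp
      ring
    have hα0 : α ≠ 0 := by
      intro h
      rw [h] at hα3
      have : -(Δ ^ 2) / A ^ 3 ≠ 0 := div_ne_zero (neg_ne_zero.2 (pow_ne_zero 2 hΔ0)) (pow_ne_zero 3 hA)
      apply this; rw [← hα3]; ring
    have hρ0 : ρ ≠ 0 := by
      intro h
      rw [h] at hρ
      have : Δ / A ^ 3 ≠ 0 := div_ne_zero hΔ0 (pow_ne_zero 3 hA)
      apply this; rw [← hρ]; ring
    have hαγ : α * (-1 / A) = ρ ^ 2 := by
      apply hcub.1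
      simp only
      have e : (ρ ^ 2) ^ 3 = (ρ ^ 3) ^ 2 := by ring
      rw [mul_pow, hα3, e, hρ]
      field_simp
    obtain ⟨k1, hk1, e2⟩ := kloo_dvd e hF ψ η hη2 hneg α (-1 / A) ρ hα0 hρ0 hαγ
    obtain ⟨k2, hk2, e3⟩ := chi_gauss_sq e hF ψ hψ hneg
    refine ⟨((quadraticChar F A : ℤ) : ℂ) * k2 * k1, ((chi_int A).mul hk2).mul hk1, ?_⟩
    have e4 : ∀ u : F, η u * ∑ s, ψ (u ^ 3 * A * s ^ 2 + (u + u ^ 3 * B) * s + u ^ 3 * C) =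
        ((quadraticChar F A : ℤ) : ℂ) * (3 ^ e * k2) * (η⁻¹ u * ψ (α * u + (-1 / A) * u⁻¹)) := by
      intro u
      by_cases hu : u = 0
      · subst hu; rw [MulChar.map_zero, MulChar.map_zero]; ring
      · simp_rw [AddChar.map_add_eq_mul _ _ (u ^ 3 * C)]
        rw [← Finset.sum_mul, quad_gauss ψ hψ _ _ (mul_ne_zero (pow_ne_zero 3 hu) hA), e3,
          mul_assoc _ (ψ _) (ψ _), ← AddChar.map_add_eq_mul]
        have e5 : -(u + u ^ 3 * B) ^ 2 / (u ^ 3 * A) + u ^ 3 * C =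
            (u * α') ^ 3 + (u * (B / A) + (-1 / A) * u⁻¹) := by
          rw [mul_pow, hα']
          field_simp
          linear_combination (-u^2*B) * h3
        have e6 : ψ (-(u + u ^ 3 * B) ^ 2 / (u ^ 3 * A) + u ^ 3 * C) =
            ψ (α * u + (-1 / A) * u⁻¹) := by
          rw [e5, AddChar.map_add_eq_mul, hψ3, ← AddChar.map_add_eq_mul, hαdef]
          congr 1; ring
        rw [e6, map_mul, map_pow, eta_inv η hη2]
        have e7 : quadraticChar F u ^ 3 = quadraticChar F u := by
          have := quadraticChar_sq_one hu
          rw [pow_succ, this, one_mul]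
        rw [e7]
        push_cast
        rw [← hη2 u]
        ring
    simp_rw [e4]
    rw [← Finset.mul_sum, e2, hF]
    push_cast
    ring

lemma T_dvd [CharP F 3] (e : ℕ) (hF : Fintype.card F = 3 ^ (2 * e)) (ψ : AddChar F ℂ)
    (hψ : ψ.IsPrimitive) (hψ3 : ∀ x, ψ (x ^ 3) = ψ x) (η : MulChar F ℂ) (hη1 : η ≠ 1)
    (hη2 : ∀ v, η v ^ 2 = ((quadraticChar F v : ℤ) : ℂ)) (hneg : quadraticChar F (-1) = 1)
    (re im : F → ℤ) (hre : ∀ v, η v = re v + im v * Complex.I)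
    (A B C Δ D : F) (hΔ0 : Δ ≠ 0) (hΔ : Δ ^ 2 = A ^ 2 * B ^ 2 - B ^ 3 - A ^ 3 * C) :
    (3 : ℤ) ^ e ∣ ∑ s, (re (D * (s ^ 3 + A * s ^ 2 + B * s + C)) +
      im (D * (s ^ 3 + A * s ^ 2 + B * s + C))) := by
  obtain ⟨κ, hκ, hT⟩ := T_gauss e hF ψ hψ hψ3 η hη1 hη2 hneg A B C Δ hΔ0 hΔ
  set a := ∑ s, re (D * (s ^ 3 + A * s ^ 2 + B * s + C)) with ha
  set b := ∑ s, im (D * (s ^ 3 + A * s ^ 2 + B * s + C)) with hb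
  set G := gaussSum η⁻¹ ψ with hG
  have hq0 : (Fintype.card F : ℂ) ≠ 0 := Nat.cast_ne_zero.2 Fintype.card_ne_zero
  have e1 : ((a : ℂ) + b * Complex.I) * G = (Fintype.card F : ℂ) * (η D * κ) := by
    rw [mul_left_comm, ← hT, ← mul_assoc]
    congr 1
    rw [ha, hb, Finset.mul_sum]
    push_cast
    rw [Finset.sum_mul, ← Finset.sum_add_distrib]
    refine Finset.sum_congr rfl fun s _ => ?_
    rw [← map_mul, hre]
  have hGG : G * (starRingEnd ℂ) G = (Fintype.card F : ℂ) := by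
    have h1 : η⁻¹ ≠ 1 := by simpa using hη1
    have := gaussSum_mul_gaussSum_eq_card h1 hψ
    rw [← this]
    congr 1
    rw [hG]; unfold gaussSum
    rw [map_sum]
    refine Finset.sum_congr rfl fun s _ => ?_
    rw [map_mul, AddChar.inv_apply, AddChar.map_neg_eq_conj]
    congr 1
    exact MulChar.star_apply' _ _
  have hκ' : IsIntegral ℤ ((starRingEnd ℂ) (η D * κ)) :=
    ((eta_int η hη2 D).mul hκ).map (starRingEnd ℂ).toIntAlgHom
  have e2 : ((a ^ 2 + b ^ 2 : ℤ) : ℂ) = ((9 ^ e : ℤ) : ℂ) * ((η D * κ) * (starRingEnd ℂ) (η D * κ)) := by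
    have h9 : ((9 ^ e : ℤ) : ℂ) = (Fintype.card F : ℂ) := by
      rw [hF, pow_mul]; push_cast; norm_num
    rw [h9]
    apply mul_left_cancel₀ hq0
    have e3 := congrArg (starRingEnd ℂ) e1
    rw [map_mul, map_mul _ (Fintype.card F : ℂ)] at e3
    simp only [map_add, map_mul, map_intCast, map_natCast, Complex.conj_I] at e3
    rw [map_mul]
    have hI := Complex.I_sq
    calc (Fintype.card F : ℂ) * ((a ^ 2 + b ^ 2 : ℤ) : ℂ)
        = (((a : ℂ) + b * Complex.I) * G) * (((a : ℂ) + b * -Complex.I) * (starRingEnd ℂ) G) := by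
          push_cast
          linear_combination (-((a:ℂ)^2 + b^2)) * hGG + (b:ℂ)^2 * (G * (starRingEnd ℂ) G) * hI
      _ = _ := by rw [e1, e3]; ring
  have h4 := int_of_integral_div _ _ (by positivity) _ (((eta_int η hη2 D).mul hκ).mul hκ') e2
  obtain ⟨h5, h6⟩ := descent_i e _ _ h4
  rw [Finset.sum_add_distrib]
  exact dvd_add h5 h6

/-- Existence of a ±1 valued function with all needed properties. -/
lemma exists_g (e : ℕ) (he : 0 < e) (hF : Fintype.card F = 3 ^ (2 * e)) [CharP F 3] :
    ∃ g : F → ℤ, g 0 = 0 ∧ (∀ v, v ≠ 0 → g v = 1 ∨ g v = -1) ∧ (∑ v, g v = 0) ∧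
      ∀ A B C Δ D : F, Δ ≠ 0 → Δ ^ 2 = A ^ 2 * B ^ 2 - B ^ 3 - A ^ 3 * C →
        (3 : ℤ) ^ e ∣ ∑ s, g (D * (s ^ 3 + A * s ^ 2 + B * s + C)) := by
  have h3 : (3 : F) = 0 := three_eq
  have h9 : Fintype.card F = 9 ^ e := by rw [hF, pow_mul]; norm_num
  have hmod : Fintype.card F % 8 = 1 := by rw [h9, Nat.pow_mod]; norm_num
  have hpos : 0 < Fintype.card F := Fintype.card_pos
  -- additive character
  have : Fact (Nat.Prime 3) := ⟨Nat.prime_three⟩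
  let := ZMod.algebra F 3
  obtain ⟨ψ, hψ, hψ3⟩ : ∃ ψ : AddChar F ℂ, ψ.IsPrimitive ∧ ∀ x, ψ (x ^ 3) = ψ x := by
    let ψ : AddChar F ℂ := (ZMod.stdAddChar (N := 3)).compAddMonoidHom
      (Algebra.trace (ZMod 3) F).toAddMonoidHom
    refine ⟨ψ, ?_, ?_⟩
    · apply AddChar.IsPrimitive.of_ne_one
      obtain ⟨a, ha⟩ := Algebra.trace_surjective (ZMod 3) F 1
      intro h
      have h1 : ψ a = 1 := by rw [h]; rfl
      have h2 : ψ a = ZMod.stdAddChar (N := 3) 1 := by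
        simp [ψ, ha]
      rw [h2] at h1
      have h3 : ZMod.stdAddChar (N := 3) 1 = ZMod.stdAddChar (N := 3) 0 := by
        rw [h1, AddChar.map_zero_eq_one]
      exact one_ne_zero (ZMod.injective_stdAddChar h3)
    · intro x
      have : Algebra.trace (ZMod 3) F (x ^ 3) = Algebra.trace (ZMod 3) F x := by
        have := Algebra.trace_eq_of_algEquiv (FiniteField.frobeniusAlgEquivOfAlgebraic (ZMod 3) F) x
        simpa using this
      simp [ψ, this]
  obtain ⟨η, hη⟩ := MulChar.exists_mulChar_orderOf F (n := 4) (R := ℂ) (ζ := Complex.I)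
    (by omega) Complex.isPrimitiveRoot_I
  have hη4 : η ^ 4 = 1 := by rw [← hη]; exact pow_orderOf_eq_one η
  have hη1 : η ≠ 1 := by rintro rfl; simp at hη
  have hη22 : η ^ 2 ≠ 1 := by
    intro h; have := orderOf_dvd_of_pow_eq_one h; rw [hη] at this; norm_num at this
  have hp4 : ∀ v, v ≠ 0 → η v ^ 4 = 1 := by
    intro v hv
    have := congrArg (fun c : MulChar F ℂ => c v) hη4
    simpa [MulChar.pow_apply' _ (by norm_num : 4 ≠ 0), MulChar.one_apply (isUnit_iff_ne_zero.2 hv)] using this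
  have hη2 : ∀ v, η v ^ 2 = ((quadraticChar F v : ℤ) : ℂ) := by
    have hsq : ∀ v, v ≠ 0 → IsSquare v → η v ^ 2 = 1 := by
      rintro v hv ⟨r, rfl⟩
      have hr : r ≠ 0 := by rintro rfl; simp at hv
      rw [map_mul]
      linear_combination hp4 r hr
    obtain ⟨u, hu⟩ := MulChar.ne_one_iff.1 hη22
    rw [MulChar.pow_apply' _ (by norm_num : 2 ≠ 0)] at hu
    have hu0 : (u : F) ≠ 0 := u.ne_zero
    have hu1 : η u ^ 2 = -1 := by
      have := hp4 u hu0
      have h : (η u ^ 2 - 1) * (η u ^ 2 + 1) = 0 := by linear_combination this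
      rcases mul_eq_zero.1 h with h | h
      · exact absurd (by linear_combination h) hu
      · linear_combination h
    have hus : ¬ IsSquare (u : F) := fun h => hu (hsq u hu0 h)
    intro v
    by_cases hv : v = 0
    · subst hv; rw [MulChar.map_zero, MulChar.map_zero]; norm_num
    · by_cases hs : IsSquare v
      · rw [hsq v hv hs, (quadraticChar_one_iff_isSquare hv).2 hs]; simp
      · rw [quadraticChar_neg_one_iff_not_isSquare.2 hs]
        have h1 : IsSquare (v * u) := by
          rw [← quadraticChar_one_iff_isSquare (mul_ne_zero hv hu0), map_mul,
            quadraticChar_neg_one_iff_not_isSquare.2 hs, quadraticChar_neg_one_iff_not_isSquare.2 hus]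
          norm_num
        have h2 := hsq _ (mul_ne_zero hv hu0) h1
        rw [map_mul] at h2
        push_cast
        linear_combination (-1) * h2 + (η v ^ 2) * hu1
  have hneg : quadraticChar F (-1) = 1 := by
    rw [quadraticChar_one_iff_isSquare (by simp)]
    exact FiniteField.isSquare_neg_one_iff.2 (by omega)
  have hvals : ∀ v, ∃ ab : ℤ × ℤ, η v = ab.1 + ab.2 * Complex.I ∧ (v = 0 → ab = 0) ∧
      (v ≠ 0 → ab.1 + ab.2 = 1 ∨ ab.1 + ab.2 = -1) := by
    intro v
    by_cases hv : v = 0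
    · exact ⟨0, by subst hv; rw [MulChar.map_zero]; simp, fun _ => rfl, fun h => absurd hv h⟩
    · have h := hp4 v hv
      have hI := Complex.I_sq
      have : (η v - 1) * ((η v + 1) * ((η v - Complex.I) * (η v + Complex.I))) = 0 := by
        linear_combination h + (1 - η v ^ 2) * hI
      rcases mul_eq_zero.1 this with h | this
      · exact ⟨(1, 0), by push_cast; linear_combination h, fun h => absurd h hv, fun _ => by simp⟩
      rcases mul_eq_zero.1 this with h | this
      · exact ⟨(-1, 0), by push_cast; linear_combination h, fun h => absurd h hv, fun _ => by simp⟩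
      rcases mul_eq_zero.1 this with h | h
      · exact ⟨(0, 1), by push_cast; linear_combination h, fun h => absurd h hv, fun _ => by simp⟩
      · exact ⟨(0, -1), by push_cast; linear_combination h, fun h => absurd h hv, fun _ => by simp⟩
  choose ab hab hab0 habn using hvals
  refine ⟨fun v => (ab v).1 + (ab v).2, ?_, ?_, ?_, ?_⟩
  · simp [hab0 0 rfl]
  · exact fun v hv => habn v hv
  · have h0 : ∑ v, η v = 0 := MulChar.sum_eq_zero_of_ne_one hη1
    have h1 : ((∑ v, (ab v).1 : ℤ) : ℂ) + ((∑ v, (ab v).2 : ℤ) : ℂ) * Complex.I = 0 := by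
      rw [← h0]; push_cast
      rw [Finset.sum_mul, ← Finset.sum_add_distrib]
      exact Finset.sum_congr rfl fun v _ => (hab v).symm
    have h2 := congrArg Complex.re h1
    have h3 := congrArg Complex.im h1
    simp only [Complex.add_re, Complex.intCast_re, Complex.mul_re, Complex.I_re, mul_zero,
      Complex.intCast_im, zero_mul, sub_zero, add_zero, Complex.zero_re] at h2
    simp only [Complex.add_im, Complex.intCast_im, Complex.mul_im, Complex.I_im, mul_one,
      Complex.intCast_re, zero_mul, zero_add, add_zero, Complex.zero_im] at h3
    rw [Finset.sum_add_distrib]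
    have h2' : (∑ v, (ab v).1 : ℤ) = 0 := by exact_mod_cast h2
    have h3' : (∑ v, (ab v).2 : ℤ) = 0 := by exact_mod_cast h3
    rw [h2', h3', add_zero]
  · intro A B C Δ D hΔ0 hΔ
    exact T_dvd e hF ψ hψ hψ3 η hη1 hη2 hneg (fun v => (ab v).1) (fun v => (ab v).2) hab A B C Δ D hΔ0 hΔ

end chars3

section ext
variable {F : Type*} [Field F] [Fintype F] [DecidableEq F]
variable {K : Type*} [Field K] [Fintype K] [Algebra F K]

lemma cubic_data [CharP F 3] (h3 : Module.finrank F K = 3) (y : K)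
    (hy : y ∉ Set.range (algebraMap F K)) :
    ∃ A B C Δ : F, Δ ≠ 0 ∧ Δ ^ 2 = A ^ 2 * B ^ 2 - B ^ 3 - A ^ 3 * C ∧
      ∀ t : F, Algebra.norm F (y + algebraMap F K t) = t ^ 3 + A * t ^ 2 + B * t + C := by
  have hF3 : (3 : F) = 0 := three_eq
  have hK3 : (3 : K) = 0 := by
    have := congrArg (algebraMap F K) hF3
    rwa [map_ofNat, map_zero] at this
  let σ := FiniteField.frobeniusAlgEquivOfAlgebraic F K
  have hσ3 : σ ^ 3 = 1 := by
    have := pow_orderOf_eq_one σ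
    rwa [FiniteField.orderOf_frobeniusAlgEquivOfAlgebraic, h3] at this
  have hσ3' : ∀ x, σ (σ (σ x)) = x := by
    intro x
    have := congrArg (fun f : K ≃ₐ[F] K => f x) hσ3
    simpa [pow_succ] using this
  have hfix : ∀ x, σ x = x → ∃ t, algebraMap F K t = x := by
    intro x hx
    have : x ∈ Set.range (algebraMap F K) := by
      rw [IsGalois.mem_range_algebraMap_iff_fixed]
      intro f
      obtain ⟨n, hn⟩ := (FiniteField.bijective_frobeniusAlgEquivOfAlgebraic_pow F K).2 f
      simp only at hn
      rw [← hn]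
      generalize n.1 = m
      induction m with
      | zero => simp
      | succ m ih =>
        rw [pow_succ, AlgEquiv.mul_apply]
        change (FiniteField.frobeniusAlgEquivOfAlgebraic F K ^ m) (σ x) = x
        rw [hx]; exact ih
    exact this
  have hnorm : ∀ x, algebraMap F K (Algebra.norm F x) = x * σ x * σ (σ x) := by
    intro x
    rw [FiniteField.algebraMap_norm_eq_prod_pow, h3]
    simp only [Finset.prod_range_succ, Finset.prod_range_zero, one_mul, pow_zero, pow_one]
    simp only [σ, FiniteField.coe_frobeniusAlgEquivOfAlgebraic, Nat.card_eq_fintype_card]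
    ring
  set y1 := σ y with hy1
  set y2 := σ y1 with hy2
  have hy3 : σ y2 = y := hσ3' y
  obtain ⟨A, hA⟩ := hfix (y + y1 + y2) (by simp only [map_add, ← hy1, ← hy2, hy3]; ring)
  obtain ⟨B, hB⟩ := hfix (y * y1 + y1 * y2 + y2 * y)
    (by simp only [map_add, map_mul, ← hy1, ← hy2, hy3]; ring)
  obtain ⟨C, hC⟩ := hfix (y * y1 * y2) (by simp only [map_mul, ← hy1, ← hy2, hy3]; ring)
  obtain ⟨Δ, hΔ⟩ := hfix ((y - y1) * (y1 - y2) * (y2 - y))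
    (by simp only [map_sub, map_mul, ← hy1, ← hy2, hy3]; ring)
  have hinj := (algebraMap F K).injective
  refine ⟨A, B, C, Δ, ?_, ?_, ?_⟩
  · intro h0
    rw [h0, map_zero] at hΔ
    have n1 : y ≠ y1 := fun h => hy (hfix y h.symm)
    have n2 : y1 ≠ y2 := fun h => n1 (σ.injective h)
    have n3 : y2 ≠ y := fun h => n2 (σ.injective (by rw [← hy2, hy3]; exact h))
    exact mul_ne_zero (mul_ne_zero (sub_ne_zero.2 n1) (sub_ne_zero.2 n2)) (sub_ne_zero.2 n3) hΔ.symm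
  · apply hinj
    simp only [map_pow, map_sub, map_mul, hA, hB, hC, hΔ]
    generalize y1 = b
    generalize y2 = c
    linear_combination (-(y * b + b * c + c * y)^3 - (y + b + c)^3 * (y * b * c)
      - 9 * (y*b*c)^2 + 6 * (y+b+c) * (y * b + b * c + c * y) * (y*b*c)) * hK3
  · intro t
    apply hinj
    rw [hnorm]
    simp only [map_add, map_pow, map_mul, hA, hB, hC, AlgEquiv.commutes, ← hy1, ← hy2]
    ring

open Classical in
lemma second_moment (e : ℕ) (hF : Fintype.card F = 3 ^ (2 * e)) (f : K → ℤ) (f0 : f 0 = 0)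
    (f1 : ∀ x, x ≠ 0 → f x = 1 ∨ f x = -1) (hline : ∀ x, ∑ c : F, f (c • x) = 0)
    (hdvd : ∀ a b : K, LinearIndependent F ![a, b] → (3 : ℤ) ^ e ∣ ∑ t : F, f (a + t • b)) :
    ∀ a b : K, LinearIndependent F ![a, b] →
      ∑ t : F, f (a + t • b) = 3 ^ e ∨ ∑ t : F, f (a + t • b) = - 3 ^ e := by
  have hJ : ∀ a b : K, LinearIndependent F ![a, b] → ∀ t : F, a + t • b ≠ 0 := by
    intro a b h t h0
    have := (LinearIndependent.pair_iff.1 h 1 t (by simpa using h0)).1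
    exact one_ne_zero this
  have htot : ∑ y : K, f y = 0 := by
    have h1 : ∑ c : F, ∑ y : K, f (c • y) = 0 := by
      rw [Finset.sum_comm]; exact Finset.sum_eq_zero fun y _ => hline y
    have h2 : ∀ c : F, ∑ y : K, f (c • y) = if c = 0 then 0 else ∑ y : K, f y := by
      intro c
      split_ifs with hc
      · simp [hc, f0]
      · exact Equiv.sum_comp (MulAction.toPerm (Units.mk0 c hc)) f
    simp_rw [h2] at h1
    have h3 := h1
    rw [Finset.sum_ite, Finset.sum_const_zero, zero_add, Finset.sum_const, nsmul_eq_mul] at h3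
    rcases mul_eq_zero.1 h3 with h | h
    · exfalso
      have h' : (univ.filter fun x : F => ¬ x = 0).card = 0 := by exact_mod_cast h
      rw [Finset.card_eq_zero] at h'
      have : (1 : F) ∈ univ.filter fun x : F => ¬ x = 0 := by simp
      rw [h'] at this
      simp at this
    · exact h
  set I : Finset (K × K) := univ.filter fun p => LinearIndependent F ![p.1, p.2] with hI
  have hzero : ∑ p ∈ I, f p.1 * f p.2 = 0 := by
    rw [hI, Finset.sum_filter, Fintype.sum_prod_type]
    apply Finset.sum_eq_zero
    intro x _
    by_cases hx : x = 0
    · simp [hx, f0]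
    have h1 : ∀ y, (if LinearIndependent F ![x, y] then f x * f y else 0)
        = f x * f y - f x * (if y ∈ univ.image (fun c : F => c • x) then f y else 0) := by
      intro y
      rw [LinearIndependent.pair_iff' hx]
      by_cases h : ∃ c : F, c • x = y
      · rw [if_neg (by push Not; exact h), if_pos (by simpa using h)]; ring
      · rw [if_pos (by push Not at h; exact h), if_neg (by simpa using h)]; ring
    simp only [h1]
    rw [Finset.sum_sub_distrib, ← Finset.mul_sum, ← Finset.mul_sum, htot, ← Finset.sum_filter,
      Finset.filter_mem_eq_inter, Finset.univ_inter, Finset.sum_image, hline]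
    · simp
    · intro c _ d _ hcd
      exact smul_left_injective F hx hcd
  have hcross : ∀ t t' : F, ∑ p ∈ I, f (p.1 + t • p.2) * f (p.1 + t' • p.2)
      = if t = t' then (I.card : ℤ) else 0 := by
    intro t t'
    split_ifs with h
    · subst h
      rw [Finset.card_eq_sum_ones, Nat.cast_sum]
      apply Finset.sum_congr rfl
      intro p hp
      rcases f1 _ (hJ p.1 p.2 (by simpa [hI] using hp) t) with h | h <;> rw [h] <;> norm_num
    · have hd : t - t' ≠ 0 := sub_ne_zero.2 h
      rw [← hzero]
      refine Finset.sum_nbij' (fun p => (p.1 + t • p.2, p.1 + t' • p.2))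
        (fun p => (p.1 - t • (t - t')⁻¹ • (p.1 - p.2), (t - t')⁻¹ • (p.1 - p.2))) ?_ ?_ ?_ ?_ ?_
      · rintro ⟨a, b⟩ hp
        simp only [hI, mem_filter, mem_univ, true_and] at hp ⊢
        rw [LinearIndependent.pair_iff] at hp ⊢
        intro u v huv
        obtain ⟨h1, h2⟩ := hp (u + v) (u * t + v * t') (by rw [← huv]; module)
        have h3 : u * (t - t') = 0 := by linear_combination h2 - t' * h1
        have h4 : u = 0 := (mul_eq_zero.1 h3).resolve_right hd
        exact ⟨h4, by rw [h4, zero_add] at h1; exact h1⟩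
      · rintro ⟨a, b⟩ hp
        simp only [hI, mem_filter, mem_univ, true_and] at hp ⊢
        rw [LinearIndependent.pair_iff] at hp ⊢
        intro u v huv
        obtain ⟨h1, h2⟩ := hp (u - u * t * (t - t')⁻¹ + v * (t - t')⁻¹)
          (u * t * (t - t')⁻¹ - v * (t - t')⁻¹) (by rw [← huv]; module)
        have h3 : u = 0 := by linear_combination h1 + h2
        have h4 : v * (t - t')⁻¹ = 0 := by linear_combination - h2 + t * (t-t')⁻¹ * h3
        exact ⟨h3, (mul_eq_zero.1 h4).resolve_right (inv_ne_zero hd)⟩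
      · rintro ⟨a, b⟩ hp
        have h1 : (t - t')⁻¹ • (a + t • b - (a + t' • b)) = b := by
          rw [show a + t • b - (a + t' • b) = (t - t') • b by module, smul_smul,
            inv_mul_cancel₀ hd, one_smul]
        simp only [h1]
        ext <;> simp
      · rintro ⟨a, b⟩ hp
        have h1 : (t - t') • (t - t')⁻¹ • (a - b) = a - b := by
          rw [smul_smul, mul_inv_cancel₀ hd, one_smul]
        ext
        · simp
        · simp only
          generalize (t - t')⁻¹ • (a - b) = w at *
          have : a - t • w + t' • w = a - (t - t') • w := by module
          rw [this, h1]; abel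
      · intro p _; rfl
  have hq : (Fintype.card F : ℤ) = (3 ^ e) ^ 2 := by
    rw [hF]; push_cast; ring
  have hsq : ∑ p ∈ I, ((∑ t : F, f (p.1 + t • p.2)) ^ 2 - (3 ^ e) ^ 2) = 0 := by
    have h1 : ∑ p ∈ I, (∑ t : F, f (p.1 + t • p.2)) ^ 2 = (Fintype.card F : ℤ) * I.card := by
      simp_rw [sq, Finset.sum_mul_sum]
      rw [Finset.sum_comm]
      have : ∀ t : F, ∑ p ∈ I, ∑ t' : F, f (p.1 + t • p.2) * f (p.1 + t' • p.2) = I.card := by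
        intro t
        rw [Finset.sum_comm]
        simp_rw [hcross]
        simp
      simp_rw [this]
      simp
    rw [Finset.sum_sub_distrib, h1, hq]
    simp; ring
  have hge : ∀ p ∈ I, 0 ≤ (∑ t : F, f (p.1 + t • p.2)) ^ 2 - (3 ^ e) ^ 2 := by
    intro p hp
    have hp' : LinearIndependent F ![p.1, p.2] := by simpa [hI] using hp
    have hne : ∑ t : F, f (p.1 + t • p.2) ≠ 0 := by
      intro h0
      have h2 := congrArg (Int.cast : ℤ → ZMod 2) h0
      rw [Int.cast_sum] at h2
      have h3 : ∀ t : F, ((f (p.1 + t • p.2) : ℤ) : ZMod 2) = 1 := by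
        intro t
        rcases f1 _ (hJ p.1 p.2 hp' t) with h | h <;> rw [h]
        · simp
        · decide
      simp_rw [h3] at h2
      simp only [sum_const, card_univ, hF, nsmul_eq_mul, mul_one, Nat.cast_pow, Int.cast_zero] at h2
      have h4 : ((3 : ℕ) : ZMod 2) = 1 := by decide
      rw [h4, one_pow] at h2
      exact one_ne_zero h2
    have h5 := Int.le_of_dvd (abs_pos.2 hne) ((dvd_abs _ _).2 (hdvd _ _ hp'))
    rw [sub_nonneg, ← sq_abs (∑ t : F, f (p.1 + t • p.2))]
    exact pow_le_pow_left₀ (by positivity) h5 2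
  intro a b hab
  have h6 := (Finset.sum_eq_zero_iff_of_nonneg hge).1 hsq (a, b) (by simpa [hI] using hab)
  exact sq_eq_sq_iff_eq_or_eq_neg.1 (sub_eq_zero.1 h6)

lemma exists_f [CharP F 3] (h3 : Module.finrank F K = 3) (e : ℕ) (he : 0 < e)
    (hF : Fintype.card F = 3 ^ (2 * e)) :
    ∃ f : K → ℤ, f 0 = 0 ∧ (∀ x, x ≠ 0 → f x = 1 ∨ f x = -1) ∧
      (∀ x, ∑ c : F, f (c • x) = 0) ∧
      ∀ a b : K, LinearIndependent F ![a, b] →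
      ∑ t : F, f (a + t • b) = 3 ^ e ∨ ∑ t : F, f (a + t • b) = - 3 ^ e := by
  obtain ⟨g, g0, g1, gs, gd⟩ := exists_g (F := F) e he hF
  have : FiniteDimensional F K := Module.finite_of_finrank_pos (by omega)
  have e0 : g (Algebra.norm F (0 : K)) = 0 := by
    rw [Algebra.norm_zero, g0]
  have e1 : ∀ x : K, x ≠ 0 → g (Algebra.norm F x) = 1 ∨ g (Algebra.norm F x) = -1 :=
    fun x hx => g1 _ (Algebra.norm_ne_zero_iff.2 hx)
  have hbij : Function.Bijective (fun c : F => c ^ 3) := by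
    apply Finite.injective_iff_bijective.1
    exact frobenius_inj F 3
  have e2 : ∀ x : K, ∑ c : F, g (Algebra.norm F (c • x)) = 0 := by
    intro x
    by_cases hx : x = 0
    · simp [hx, g0]
    have hn : Algebra.norm F x ≠ 0 := Algebra.norm_ne_zero_iff.2 hx
    have h1 : ∀ c : F, Algebra.norm F (c • x) = c ^ 3 * Algebra.norm F x := by
      intro c
      rw [Algebra.smul_def, map_mul, Algebra.norm_algebraMap, h3]
    simp_rw [h1]
    rw [← gs]
    have h2 : Function.Bijective (fun c : F => c ^ 3 * Algebra.norm F x) :=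
      (Equiv.mulRight₀ _ hn).bijective.comp hbij
    exact h2.sum_comp g
  refine ⟨fun x => g (Algebra.norm F x), e0, e1, e2,
    second_moment e hF _ e0 e1 e2 ?_⟩
  intro a b hab
  have hb : b ≠ 0 := by
    rintro rfl
    have := LinearIndependent.ne_zero 1 hab
    simp at this
  obtain ⟨A, B, C, Δ, hΔ, hd, hn⟩ := cubic_data h3 (a / b) (by
    rintro ⟨t, ht⟩
    have h := LinearIndependent.pair_iff.1 hab 1 (-t) (by
      rw [Algebra.smul_def (-t), map_neg, ht]; field_simp; simp)
    exact one_ne_zero h.1)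
  have h1 : ∀ t : F, Algebra.norm F (a + t • b)
      = Algebra.norm F b * (t ^ 3 + A * t ^ 2 + B * t + C) := by
    intro t
    rw [← hn, ← map_mul]
    congr 1
    rw [Algebra.smul_def]; field_simp
  simp_rw [h1]
  exact gd A B C Δ _ hΔ hd

end ext

section comb
variable {F : Type*} [Field F] [Fintype F]
variable {V : Type*} [AddCommGroup V] [Module F V] [Fintype V]
variable [Fintype (Submodule F V)]

open Classical in
/-- Sum of a function over a subspace. -/
noncomputable def sg (h : V → ℤ) (S : Submodule F V) : ℤ := ∑ v with v ∈ S, h v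

open Classical in
/-- Rank `k` subspaces between `W` and `U`. -/
noncomputable def TT (k : ℕ) (W U : Submodule F V) : Finset (Submodule F V) :=
  univ.filter fun l => Module.finrank F l = k ∧ W ≤ l ∧ l ≤ U

lemma mem_TT {k : ℕ} {W U l : Submodule F V} :
    l ∈ TT k W U ↔ Module.finrank F l = k ∧ W ≤ l ∧ l ≤ U := by
  simp [TT]

lemma finrank_sup_span (W : Submodule F V) (v : V) (hv : v ∉ W) :
    Module.finrank F (W ⊔ Submodule.span F {v} : Submodule F V) = Module.finrank F W + 1 := by
  have h1 := Submodule.finrank_sup_add_finrank_inf_eq W (Submodule.span F {v})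
  have hv0 : v ≠ 0 := by rintro rfl; exact hv W.zero_mem
  rw [finrank_span_singleton hv0] at h1
  have h2 : W ⊓ Submodule.span F {v} = ⊥ := by
    rw [Submodule.eq_bot_iff]
    rintro x ⟨hx1, hx2⟩
    obtain ⟨c, rfl⟩ := Submodule.mem_span_singleton.1 hx2
    by_cases hc : c = 0
    · simp [hc]
    · exact absurd ((W.smul_mem_iff hc).1 hx1) hv
  rw [h2, finrank_bot] at h1
  omega

lemma unique_sup {k : ℕ} {W l : Submodule F V} {v : V} (hk : Module.finrank F W = k) (hv : v ∉ W)
    (hl : Module.finrank F l = k + 1) (hW : W ≤ l) (hvl : v ∈ l) :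
    l = W ⊔ Submodule.span F {v} := by
  symm
  apply Submodule.eq_of_le_of_finrank_eq
  · exact sup_le hW ((Submodule.span_singleton_le_iff_mem _ _).2 hvl)
  · rw [finrank_sup_span W v hv, hk, hl]

open Classical in
lemma double_count (W U : Submodule F V) (hWU : W ≤ U) (k : ℕ) (hk : Module.finrank F W = k)
    (φ : V → ℤ) :
    ∑ l ∈ TT (k + 1) W U, ∑ v with (v ∈ l ∧ v ∉ W), φ v = ∑ v with (v ∈ U ∧ v ∉ W), φ v := by
  simp_rw [Finset.sum_filter]
  rw [Finset.sum_comm]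
  apply Finset.sum_congr rfl
  intro v _
  by_cases hv : v ∈ W
  · simp [hv]
  by_cases hU : v ∈ U
  · rw [if_pos ⟨hU, hv⟩, Finset.sum_eq_single (W ⊔ Submodule.span F {v})]
    · rw [if_pos ⟨Submodule.mem_sup_right (Submodule.mem_span_singleton_self v), hv⟩]
    · intro l hl hne
      rw [mem_TT] at hl
      rw [if_neg]
      rintro ⟨h1, h2⟩
      exact hne (unique_sup hk hv hl.1 hl.2.1 h1)
    · intro hn
      exfalso
      apply hn
      rw [mem_TT]
      refine ⟨by rw [finrank_sup_span W v hv, hk], le_sup_left, sup_le hWU ?_⟩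
      exact (Submodule.span_singleton_le_iff_mem _ _).2 hU
  · rw [if_neg (fun h => hU h.1)]
    apply Finset.sum_eq_zero
    intro l hl
    rw [mem_TT] at hl
    rw [if_neg (fun h => hU (hl.2.2 h.1))]

open Classical in
lemma sum_diff (W U : Submodule F V) (hWU : W ≤ U) (φ : V → ℤ) :
    ∑ v with (v ∈ U ∧ v ∉ W), φ v = sg φ U - sg φ W := by
  rw [eq_sub_iff_add_eq, sg, sg, ← Finset.sum_filter_add_sum_filter_not (univ.filter (· ∈ U)) (· ∈ W),
    add_comm]
  congr 1
  · apply Finset.sum_congr _ fun _ _ => rfl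
    ext v; simp only [mem_filter, mem_univ, true_and]
    exact ⟨fun h => ⟨hWU h, h⟩, fun h => h.2⟩
  · apply Finset.sum_congr _ fun _ _ => rfl
    ext v; simp only [mem_filter, mem_univ, true_and]

lemma sg_one (U : Submodule F V) :
    sg (fun _ => (1 : ℤ)) U = (Fintype.card F : ℤ) ^ (Module.finrank F U) := by
  classical
  rw [sg, Finset.sum_const, nsmul_eq_mul, mul_one]
  have h1 := Module.card_eq_pow_finrank (K := F) (V := U)
  rw [← Nat.cast_pow, ← h1]
  congr 1
  rw [Fintype.card_subtype]

lemma double_count' (W U : Submodule F V) (hWU : W ≤ U) (k : ℕ) (hk : Module.finrank F W = k)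
    (φ : V → ℤ) :
    ∑ l ∈ TT (k + 1) W U, sg φ l = ((TT (k + 1) W U).card - 1) * sg φ W + sg φ U := by
  classical
  have h := double_count W U hWU k hk φ
  rw [sum_diff W U hWU] at h
  have h2 : ∑ l ∈ TT (k + 1) W U, ∑ v with (v ∈ l ∧ v ∉ W), φ v
      = ∑ l ∈ TT (k + 1) W U, (sg φ l - sg φ W) :=
    Finset.sum_congr rfl fun l hl => sum_diff W l (mem_TT.1 hl).2.1 φ
  rw [h2, Finset.sum_sub_distrib, Finset.sum_const, nsmul_eq_mul] at h
  linear_combination h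

lemma card_TT (W U : Submodule F V) (hWU : W ≤ U) (k : ℕ) (hk : Module.finrank F W = k) :
    ((TT (k + 1) W U).card : ℤ) * ((Fintype.card F : ℤ) ^ (k + 1) - (Fintype.card F : ℤ) ^ k)
      = (Fintype.card F : ℤ) ^ (Module.finrank F U) - (Fintype.card F : ℤ) ^ k := by
  have h := double_count' W U hWU k hk (fun _ => 1)
  have h2 : ∑ l ∈ TT (k + 1) W U, sg (fun _ => (1 : ℤ)) l
      = ∑ l ∈ TT (k + 1) W U, (Fintype.card F : ℤ) ^ (k + 1) :=
    Finset.sum_congr rfl fun l hl => by rw [sg_one, (mem_TT.1 hl).1]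
  rw [h2, sg_one, sg_one, hk, Finset.sum_const, nsmul_eq_mul] at h
  linear_combination h

lemma card_gt_one : (1 : ℤ) < Fintype.card F := by
  exact_mod_cast Fintype.one_lt_card (α := F)

lemma pow_diff_pos (k : ℕ) :
    (0 : ℤ) < (Fintype.card F : ℤ) ^ (k + 1) - (Fintype.card F : ℤ) ^ k :=
  sub_pos.2 (pow_lt_pow_right₀ card_gt_one (Nat.lt_succ_self k))

lemma card_TT_congr {W U W' U' : Submodule F V} (hWU : W ≤ U) (hWU' : W' ≤ U') (k : ℕ)
    (hk : Module.finrank F W = k) (hk' : Module.finrank F W' = k)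
    (hU : Module.finrank F U = Module.finrank F U') :
    (TT (k + 1) W U).card = (TT (k + 1) W' U').card := by
  have h1 := card_TT W U hWU k hk
  have h2 := card_TT W' U' hWU' k hk'
  rw [hU, ← h2] at h1
  exact_mod_cast mul_right_cancel₀ (pow_diff_pos (F := F) k).ne' h1

lemma TT_nonempty {W U : Submodule F V} (hWU : W ≤ U) (k : ℕ) (hk : Module.finrank F W = k)
    (hU : k < Module.finrank F U) : (TT (k + 1) W U).Nonempty := by
  rw [← Finset.card_pos]
  have h1 := card_TT W U hWU k hk
  have h2 : (Fintype.card F : ℤ) ^ k < (Fintype.card F : ℤ) ^ (Module.finrank F U) :=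
    pow_lt_pow_right₀ card_gt_one hU
  by_contra h0
  have h3 : (TT (k + 1) W U).card = 0 := by omega
  rw [h3] at h1
  simp at h1
  linarith

open Classical in
/-- The class of a subspace (point or line). -/
noncomputable def cls (p : V) (H : Submodule F V) (h : V → ℤ) (S : Submodule F V) : Fin 4 :=
  if p ∈ S then 0 else if S ≤ H then 1 else if 0 < sg h S then 2 else 3

/-- Number of subspaces of class `j` among rank `k` spaces between `W` and `U`. -/
noncomputable def cnt (p : V) (H : Submodule F V) (h : V → ℤ) (k : ℕ) (W U : Submodule F V)
    (j : Fin 4) : ℕ := ((TT k W U).filter fun l => cls p H h l = j).card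

variable {p : V} {H : Submodule F V} {h : V → ℤ}

lemma cls_eq_zero {S : Submodule F V} : cls p H h S = 0 ↔ p ∈ S := by
  unfold cls; split_ifs <;> simp_all
lemma cls_eq_one (hp : p ∉ H) {S : Submodule F V} : cls p H h S = 1 ↔ S ≤ H := by
  unfold cls
  have : p ∈ S → ¬ S ≤ H := fun h1 h2 => hp (h2 h1)
  split_ifs <;> simp_all

/-- The sum hypothesis in rank `k`. -/
def SumHyp (p : V) (H : Submodule F V) (h : V → ℤ) (k : ℕ) (m : ℤ) : Prop :=
  0 < m ∧ ∀ S : Submodule F V, Module.finrank F S = k →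
    ((p ∈ S ∨ S ≤ H) → sg h S = 0) ∧ (p ∉ S → ¬ S ≤ H → sg h S = m ∨ sg h S = - m)

lemma sg_cls {k : ℕ} {m : ℤ} (hs : SumHyp p H h k m) (S : Submodule F V)
    (hS : Module.finrank F S = k) :
    sg h S = m * ((if cls p H h S = 2 then 1 else 0) - (if cls p H h S = 3 then 1 else 0)) := by
  obtain ⟨hm, hs⟩ := hs
  obtain ⟨h1, h2⟩ := hs S hS
  unfold cls
  by_cases c1 : p ∈ S
  · simp [c1, h1 (Or.inl c1)]
  by_cases c2 : S ≤ H
  · simp [c1, c2, h1 (Or.inr c2)]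
  rcases h2 c1 c2 with h3 | h3
  · have c3 : 0 < sg h S := by rw [h3]; exact hm
    rw [if_neg c1, if_neg c2, if_pos c3, h3]; simp
  · have c3 : ¬ 0 < sg h S := by rw [h3]; linarith
    rw [if_neg c1, if_neg c2, if_neg c3, h3]; simp

lemma cnt_sum (k : ℕ) (W U : Submodule F V) :
    cnt p H h k W U 0 + cnt p H h k W U 1 + cnt p H h k W U 2 + cnt p H h k W U 3
      = (TT k W U).card := by
  have := Finset.card_eq_sum_card_fiberwise (s := TT k W U) (t := univ) (f := cls p H h)
    (fun _ _ => Finset.mem_coe.2 (mem_univ _))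
  rw [this, Fin.sum_univ_four]
  rfl

lemma cnt_diff {k : ℕ} {m : ℤ} (hs : SumHyp p H h k m) (W U : Submodule F V) :
    ∑ l ∈ TT k W U, sg h l = m * ((cnt p H h k W U 2 : ℤ) - cnt p H h k W U 3) := by
  rw [Finset.sum_congr rfl fun l hl => sg_cls hs l (mem_TT.1 hl).1, ← Finset.mul_sum,
    Finset.sum_sub_distrib]
  simp [cnt]

lemma cnt_one (hp : p ∉ H) (k : ℕ) (W U : Submodule F V) :
    cnt p H h k W U 1 = (TT k W (U ⊓ H)).card := by
  unfold cnt
  congr 1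
  ext l
  simp only [mem_filter, mem_TT, cls_eq_one hp, le_inf_iff]
  tauto

lemma cnt_zero {k : ℕ} {W U : Submodule F V} (hWU : W ≤ U) (hk : Module.finrank F W = k)
    (hpW : p ∉ W) (hpU : p ∈ U) : cnt p H h (k + 1) W U 0 = 1 := by
  unfold cnt
  rw [Finset.card_eq_one]
  refine ⟨W ⊔ Submodule.span F {p}, ?_⟩
  ext l
  simp only [mem_filter, mem_TT, cls_eq_zero, mem_singleton]
  constructor
  · rintro ⟨⟨a, b, c⟩, d⟩
    exact unique_sup hk hpW a b d
  · rintro rfl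
    refine ⟨⟨by rw [finrank_sup_span W p hpW, hk], le_sup_left, sup_le hWU ?_⟩,
      Submodule.mem_sup_right (Submodule.mem_span_singleton_self p)⟩
    exact (Submodule.span_singleton_le_iff_mem _ _).2 hpU

lemma cnt_zero' {k : ℕ} {W U : Submodule F V} (hpU : p ∉ U) : cnt p H h k W U 0 = 0 := by
  unfold cnt
  rw [Finset.card_eq_zero, Finset.filter_eq_empty_iff]
  intro l hl
  rw [cls_eq_zero]
  exact fun h => hpU ((mem_TT.1 hl).2.2 h)

lemma cnt_zero_all {k : ℕ} {W U : Submodule F V} (hpW : p ∈ W) :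
    cnt p H h k W U 0 = (TT k W U).card := by
  unfold cnt
  rw [Finset.filter_true_of_mem]
  intro l hl
  rw [cls_eq_zero]
  exact (mem_TT.1 hl).2.1 hpW

lemma finrank_inf_H (hV : Module.finrank F V = 4) (hH : Module.finrank F H = 3)
    (S : Submodule F V) (hS : ¬ S ≤ H) :
    Module.finrank F (S ⊓ H : Submodule F V) + 1 = Module.finrank F S := by
  have h1 := Submodule.finrank_sup_add_finrank_inf_eq S H
  have h2 : H < S ⊔ H := by
    rw [right_lt_sup]; exact hS
  have h3 := Submodule.finrank_lt_finrank_of_lt h2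
  have h4 := Submodule.finrank_le (S ⊔ H)
  omega

end comb

section comb2
variable {F : Type*} [Field F] [Fintype F]
variable {V : Type*} [AddCommGroup V] [Module F V] [Fintype V]
variable [Fintype (Submodule F V)]
variable {p : V} {H : Submodule F V} {h : V → ℤ}

lemma sg_bot (h0 : h 0 = 0) : sg h (⊥ : Submodule F V) = 0 := by
  classical
  rw [sg]
  apply Finset.sum_eq_zero
  intro v hv
  simp only [mem_filter, mem_univ, true_and, Submodule.mem_bot] at hv
  rw [hv, h0]

lemma sg_top (htot : ∑ v, h v = 0) : sg h (⊤ : Submodule F V) = 0 := by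
  simpa [sg] using htot

lemma four_eq {a b : Fin 4 → ℕ} (h0 : a 0 = b 0) (h1 : a 1 = b 1)
    (hs : a 0 + a 1 + a 2 + a 3 = b 0 + b 1 + b 2 + b 3)
    (hd : (a 2 : ℤ) - a 3 = b 2 - b 3) (j : Fin 4) : a j = b j := by
  fin_cases j
  · exact h0
  · exact h1
  · change a 2 = b 2
    omega
  · change a 3 = b 3
    omega

lemma lines_congr (hp : p ∉ H) (h0 : h 0 = 0)
    (hV : Module.finrank F V = 4) (hH : Module.finrank F H = 3)
    {m1 m2 : ℤ} (hs1 : SumHyp p H h 1 m1) (hs2 : SumHyp p H h 2 m2)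
    {l l' : Submodule F V} (hl : Module.finrank F l = 2) (hl' : Module.finrank F l' = 2)
    (hc : cls p H h l = cls p H h l') (j : Fin 4) :
    cnt p H h 1 ⊥ l j = cnt p H h 1 ⊥ l' j := by
  have hb : Module.finrank F (⊥ : Submodule F V) = 0 := finrank_bot F V
  have hpb : p ∉ (⊥ : Submodule F V) := by
    intro h1; rw [Submodule.mem_bot] at h1; exact hp (h1 ▸ H.zero_mem)
  have hp' : p ∈ l ↔ p ∈ l' := by
    rw [← cls_eq_zero (H := H) (h := h), hc, cls_eq_zero]
  have hH' : l ≤ H ↔ l' ≤ H := by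
    rw [← cls_eq_one (h := h) hp, hc, cls_eq_one hp]
  refine four_eq ?_ ?_ ?_ ?_ j
  · by_cases h1 : p ∈ l
    · rw [cnt_zero bot_le hb hpb h1, cnt_zero bot_le hb hpb (hp'.1 h1)]
    · rw [cnt_zero' h1, cnt_zero' (fun h2 => h1 (hp'.2 h2))]
  · rw [cnt_one hp, cnt_one hp]
    apply card_TT_congr bot_le bot_le 0 hb hb
    by_cases h1 : l ≤ H
    · rw [inf_eq_left.2 h1, inf_eq_left.2 (hH'.1 h1), hl, hl']
    · have := finrank_inf_H hV hH l h1
      have := finrank_inf_H hV hH l' (fun h2 => h1 (hH'.2 h2))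
      omega
  · rw [cnt_sum, cnt_sum]
    exact card_TT_congr bot_le bot_le 0 hb hb (by rw [hl, hl'])
  · have e1 := cnt_diff hs1 ⊥ l
    have e2 := cnt_diff hs1 ⊥ l'
    have d1 := double_count' ⊥ l bot_le 0 hb h
    have d2 := double_count' ⊥ l' bot_le 0 hb h
    simp only [sg_bot h0, mul_zero, zero_add] at d1 d2
    have e3 : sg h l = sg h l' := by rw [sg_cls hs2 l hl, sg_cls hs2 l' hl', hc]
    apply mul_left_cancel₀ hs1.1.ne'
    rw [← e1, ← e2]
    exact d1.trans (e3.trans d2.symm)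

lemma points_congr (hp : p ∉ H) (htot : ∑ v, h v = 0)
    {m1 m2 : ℤ} (hs1 : SumHyp p H h 1 m1) (hs2 : SumHyp p H h 2 m2)
    {l l' : Submodule F V} (hl : Module.finrank F l = 1) (hl' : Module.finrank F l' = 1)
    (hc : cls p H h l = cls p H h l') (j : Fin 4) :
    cnt p H h 2 l ⊤ j = cnt p H h 2 l' ⊤ j := by
  have hp' : p ∈ l ↔ p ∈ l' := by
    rw [← cls_eq_zero (H := H) (h := h), hc, cls_eq_zero]
  have hH' : l ≤ H ↔ l' ≤ H := by
    rw [← cls_eq_one (h := h) hp, hc, cls_eq_one hp]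
  have hcard : (TT 2 l ⊤).card = (TT 2 l' ⊤).card :=
    card_TT_congr le_top le_top 1 hl hl' rfl
  refine four_eq ?_ ?_ ?_ ?_ j
  · by_cases h1 : p ∈ l
    · rw [cnt_zero_all h1, cnt_zero_all (hp'.1 h1), hcard]
    · rw [cnt_zero le_top hl h1 trivial, cnt_zero le_top hl' (fun h2 => h1 (hp'.2 h2)) trivial]
  · rw [cnt_one hp, cnt_one hp, top_inf_eq]
    by_cases h1 : l ≤ H
    · exact card_TT_congr h1 (hH'.1 h1) 1 hl hl' rfl
    · have h2 : ∀ S : Submodule F V, ¬ S ≤ H → TT 2 S H = ∅ := by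
        intro S hS
        rw [Finset.eq_empty_iff_forall_notMem]
        intro x hx
        rw [mem_TT] at hx
        exact hS (hx.2.1.trans hx.2.2)
      rw [h2 l h1, h2 l' (fun h2 => h1 (hH'.2 h2))]
  · rw [cnt_sum, cnt_sum, hcard]
  · have e1 := cnt_diff hs2 l ⊤
    have e2 := cnt_diff hs2 l' ⊤
    have d1 := double_count' l ⊤ le_top 1 hl h
    have d2 := double_count' l' ⊤ le_top 1 hl' h
    rw [sg_top htot, add_zero] at d1 d2
    have e3 : sg h l = sg h l' := by rw [sg_cls hs1 l hl, sg_cls hs1 l' hl', hc]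
    apply mul_left_cancel₀ hs2.1.ne'
    rw [← e1, ← e2]
    refine d1.trans (Eq.trans ?_ d2.symm)
    rw [e3]
    congr 3

lemma exists_of_cnt {k : ℕ} {W U : Submodule F V} {j : Fin 4} (hc : 0 < cnt p H h k W U j) :
    ∃ S : Submodule F V, Module.finrank F S = k ∧ cls p H h S = j := by
  unfold cnt at hc
  obtain ⟨S, hS⟩ := Finset.card_pos.1 hc
  rw [mem_filter, mem_TT] at hS
  exact ⟨S, hS.1.1, hS.2⟩

lemma points_nonempty (hp : p ∉ H) (h0 : h 0 = 0)
    (hV : Module.finrank F V = 4) (hH : Module.finrank F H = 3)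
    {m1 m2 : ℤ} (hs1 : SumHyp p H h 1 m1) (hs2 : SumHyp p H h 2 m2) (j : Fin 4) :
    ∃ S : Submodule F V, Module.finrank F S = 1 ∧ cls p H h S = j := by
  have hb : Module.finrank F (⊥ : Submodule F V) = 0 := finrank_bot F V
  have hp0 : p ≠ 0 := by rintro rfl; exact hp H.zero_mem
  have hpb : p ∉ (⊥ : Submodule F V) := by rwa [Submodule.mem_bot]
  have hP : Module.finrank F (Submodule.span F {p}) = 1 := finrank_span_singleton hp0
  obtain ⟨l, hl⟩ := TT_nonempty (W := Submodule.span F {p}) (U := ⊤) le_top 1 hP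
    (by rw [finrank_top, hV]; norm_num)
  rw [mem_TT] at hl
  obtain ⟨hl, hpl, -⟩ := hl
  rw [Submodule.span_singleton_le_iff_mem] at hpl
  have hlH : ¬ l ≤ H := fun h1 => hp (h1 hpl)
  have c0 : cnt p H h 1 ⊥ l 0 = 1 := cnt_zero bot_le hb hpb hpl
  have c1 := cnt_one (h := h) hp 1 ⊥ l
  have t1 := card_TT (⊥ : Submodule F V) (l ⊓ H) bot_le 0 hb
  have hr := finrank_inf_H hV hH l hlH
  have hr' : Module.finrank F (l ⊓ H : Submodule F V) = 1 := by omega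
  have t2 := card_TT (⊥ : Submodule F V) l bot_le 0 hb
  have cs := cnt_sum (p := p) (H := H) (h := h) 1 ⊥ l
  rw [hr'] at t1
  rw [hl] at t2
  simp only [zero_add] at t1 t2
  rw [← c1] at t1
  rw [← cs] at t2
  have hq := card_gt_one (F := F)
  have e1 := cnt_diff hs1 ⊥ l
  have d1 := double_count' ⊥ l bot_le 0 hb h
  simp only [sg_bot h0, mul_zero, zero_add, ((hs2.2 l hl).1 (Or.inl hpl))] at d1
  have e2 := e1.symm.trans d1
  have e3 : (cnt p H h 1 ⊥ l 2 : ℤ) - cnt p H h 1 ⊥ l 3 = 0 :=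
    (mul_eq_zero.1 e2).resolve_left hs1.1.ne'
  set q : ℤ := (Fintype.card F : ℤ) with hqd
  have hq1 : q - 1 ≠ 0 := by linarith
  have c1' : (cnt p H h 1 ⊥ l 1 : ℤ) = 1 := by
    apply mul_right_cancel₀ hq1
    linear_combination t1
  have s' : ((cnt p H h 1 ⊥ l 0 : ℤ) + cnt p H h 1 ⊥ l 1 + cnt p H h 1 ⊥ l 2
      + cnt p H h 1 ⊥ l 3) = q + 1 := by
    apply mul_right_cancel₀ hq1
    push_cast at t2
    linear_combination t2
  apply exists_of_cnt (W := ⊥) (U := l)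
  fin_cases j
  · change 0 < cnt p H h 1 ⊥ l 0
    omega
  · change 0 < cnt p H h 1 ⊥ l 1
    omega
  · change 0 < cnt p H h 1 ⊥ l 2
    omega
  · change 0 < cnt p H h 1 ⊥ l 3
    omega

lemma lines_nonempty (hp : p ∉ H) (h0 : h 0 = 0) (htot : ∑ v, h v = 0)
    (hV : Module.finrank F V = 4) (hH : Module.finrank F H = 3)
    {m1 m2 : ℤ} (hs1 : SumHyp p H h 1 m1) (hs2 : SumHyp p H h 2 m2) (j : Fin 4) :
    ∃ S : Submodule F V, Module.finrank F S = 2 ∧ cls p H h S = j := by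
  obtain ⟨x, hx, hxc⟩ := points_nonempty hp h0 hV hH hs1 hs2 1
  have hxH := (cls_eq_one hp).1 hxc
  have hpx : p ∉ x := fun h1 => hp (hxH h1)
  have c0 : cnt p H h 2 x ⊤ 0 = 1 := cnt_zero le_top hx hpx trivial
  have c1 := cnt_one (h := h) hp 2 x ⊤
  rw [top_inf_eq] at c1
  have t1 := card_TT x H hxH 1 hx
  have t2 := card_TT x ⊤ le_top 1 hx
  have cs := cnt_sum (p := p) (H := H) (h := h) 2 x ⊤
  rw [hH] at t1
  rw [finrank_top, hV] at t2
  norm_num only at t1 t2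
  rw [← c1] at t1
  rw [← cs] at t2
  have hq := card_gt_one (F := F)
  have e1 := cnt_diff hs2 x ⊤
  have d1 := double_count' x ⊤ le_top 1 hx h
  rw [((hs1.2 x hx).1 (Or.inr hxH)), mul_zero, zero_add, sg_top htot] at d1
  have e2 := e1.symm.trans d1
  have e3 : (cnt p H h 2 x ⊤ 2 : ℤ) - cnt p H h 2 x ⊤ 3 = 0 :=
    (mul_eq_zero.1 e2).resolve_left hs2.1.ne'
  set q : ℤ := (Fintype.card F : ℤ) with hqd
  have hq1 : q ^ 2 - q ≠ 0 := by nlinarith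
  have c1' : (cnt p H h 2 x ⊤ 1 : ℤ) = q + 1 := by
    apply mul_right_cancel₀ hq1
    linear_combination t1
  have s' : ((cnt p H h 2 x ⊤ 0 : ℤ) + cnt p H h 2 x ⊤ 1 + cnt p H h 2 x ⊤ 2
      + cnt p H h 2 x ⊤ 3) = q ^ 2 + q + 1 := by
    apply mul_right_cancel₀ hq1
    push_cast at t2
    linear_combination t2
  have hq2 : 1 < q ^ 2 := by nlinarith
  apply exists_of_cnt (W := x) (U := ⊤)
  fin_cases j
  · change 0 < cnt p H h 2 x ⊤ 0
    omega
  · change 0 < cnt p H h 2 x ⊤ 1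
    omega
  · change 0 < cnt p H h 2 x ⊤ 2
    omega
  · change 0 < cnt p H h 2 x ⊤ 3
    omega

lemma ncard_lines (k : ℕ) (W : Submodule F V) (j : Fin 4) :
    {l ∈ {S : Submodule F V | Module.finrank F S = k ∧ cls p H h S = j} | W ≤ l}.ncard
      = cnt p H h k W ⊤ j := by
  unfold cnt
  rw [← Set.ncard_coe_finset]
  congr 1
  ext l
  simp only [Set.mem_ofPred_eq, coe_filter, mem_TT, le_top, and_true]
  tauto

lemma ncard_points (k : ℕ) (U : Submodule F V) (j : Fin 4) :
    {l ∈ {S : Submodule F V | Module.finrank F S = k ∧ cls p H h S = j} | l ≤ U}.ncard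
      = cnt p H h k ⊥ U j := by
  unfold cnt
  rw [← Set.ncard_coe_finset]
  congr 1
  ext l
  simp only [Set.mem_ofPred_eq, coe_filter, mem_TT, bot_le, true_and]
  tauto

theorem comb_main (p : V) (H : Submodule F V) (h : V → ℤ)
    (hp : p ∉ H) (h0 : h 0 = 0) (htot : ∑ v, h v = 0)
    (hV : Module.finrank F V = 4) (hH : Module.finrank F H = 3)
    {m1 m2 : ℤ} (hs1 : SumHyp p H h 1 m1) (hs2 : SumHyp p H h 2 m2) :
    ∃ P L : Fin 4 → Set (Submodule F V),
      (∀ i, (P i).Nonempty) ∧ (∀ i, (L i).Nonempty) ∧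
      (∀ i j, i ≠ j → Disjoint (P i) (P j)) ∧
      (∀ i j, i ≠ j → Disjoint (L i) (L j)) ∧
      (⋃ i, P i) = {x : Submodule F V | Module.finrank F x = 1} ∧
      (⋃ i, L i) = {x : Submodule F V | Module.finrank F x = 2} ∧
      (∃ a : Fin 4 → Fin 4 → ℕ, ∀ i j, ∀ pt ∈ P i,
        {l ∈ L j | pt ≤ l}.ncard = a i j) ∧
      (∃ b : Fin 4 → Fin 4 → ℕ, ∀ i j, ∀ l ∈ L i,
        {pt ∈ P j | pt ≤ l}.ncard = b i j) := by
  choose P0 hP0 using points_nonempty hp h0 hV hH hs1 hs2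
  choose L0 hL0 using lines_nonempty hp h0 htot hV hH hs1 hs2
  refine ⟨fun i => {S | Module.finrank F S = 1 ∧ cls p H h S = i},
    fun i => {S | Module.finrank F S = 2 ∧ cls p H h S = i},
    fun i => ⟨P0 i, hP0 i⟩, fun i => ⟨L0 i, hL0 i⟩, ?_, ?_, ?_, ?_,
    ⟨fun i j => cnt p H h 2 (P0 i) ⊤ j, ?_⟩, ⟨fun i j => cnt p H h 1 ⊥ (L0 i) j, ?_⟩⟩
  · intro i j hij
    rw [Set.disjoint_left]
    rintro S ⟨-, h1⟩ ⟨-, h2⟩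
    exact hij (h1.symm.trans h2)
  · intro i j hij
    rw [Set.disjoint_left]
    rintro S ⟨-, h1⟩ ⟨-, h2⟩
    exact hij (h1.symm.trans h2)
  · ext S; simp
  · ext S; simp
  · rintro i j pt ⟨h1, h2⟩
    rw [ncard_lines]
    exact points_congr hp htot hs1 hs2 h1 (hP0 i).1 (h2.trans (hP0 i).2.symm) j
  · rintro i j l ⟨h1, h2⟩
    rw [ncard_points]
    exact lines_congr hp h0 hV hH hs1 hs2 h1 (hL0 i).1 (h2.trans (hL0 i).2.symm) j

end comb2

section concrete
variable {F : Type*} [Field F] [Fintype F]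
variable {K : Type*} [Field K] [Fintype K] [Algebra F K]
variable {V : Type*} [AddCommGroup V] [Module F V] [Fintype V]
variable [Fintype (Submodule F V)]

open Classical in
/-- The extension of `f` from the affine part to the whole space. -/
noncomputable def hh (f : K → ℤ) (τ : V →ₗ[F] F) (π : V →ₗ[F] K) (v : V) : ℤ :=
  if τ v = 0 then 0 else f ((τ v)⁻¹ • π v)

variable {f : K → ℤ} {τ : V →ₗ[F] F} {π : V →ₗ[F] K}

lemma sg_le_ker (S : Submodule F V) (hS : S ≤ LinearMap.ker τ) : sg (hh f τ π) S = 0 := by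
  classical
  rw [sg]
  apply Finset.sum_eq_zero
  intro v hv
  have : τ v = 0 := hS (by simpa using hv)
  simp [hh, this]

lemma exists_one (S : Submodule F V) (hS : ¬ S ≤ LinearMap.ker τ) : ∃ a ∈ S, τ a = 1 := by
  obtain ⟨v, hv, hv'⟩ := SetLike.not_le_iff_exists.1 hS
  rw [LinearMap.mem_ker] at hv'
  exact ⟨(τ v)⁻¹ • v, S.smul_mem _ hv, by simp [hv']⟩

lemma sum_ne_zero_const (X : ℤ) [DecidableEq F] :
    ∑ s : F, (if s = 0 then 0 else X) = (Fintype.card F - 1) * X := by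
  have h1 : ∀ s : F, (if s = 0 then 0 else X) = X - (if s = 0 then X else 0) := by
    intro s; split_ifs <;> simp
  simp_rw [h1]
  rw [Finset.sum_sub_distrib]
  simp
  ring

lemma sg_rank_one (S : Submodule F V) (hS : Module.finrank F S = 1) {a : V} (ha : a ∈ S)
    (ha1 : τ a = 1) : sg (hh f τ π) S = (Fintype.card F - 1) * f (π a) := by
  classical
  have ha0 : a ≠ 0 := by rintro rfl; simp at ha1
  have hspan : Submodule.span F {a} = S := by
    apply Submodule.eq_of_le_of_finrank_eq
    · exact (Submodule.span_singleton_le_iff_mem _ _).2 ha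
    · rw [finrank_span_singleton ha0, hS]
  have himg : (univ.filter fun v => v ∈ S) = univ.image (fun c : F => c • a) := by
    ext v
    rw [← hspan]
    simp [Submodule.mem_span_singleton]
  rw [sg, himg, Finset.sum_image (fun c _ d _ hcd => smul_left_injective F ha0 hcd),
    ← sum_ne_zero_const]
  apply Finset.sum_congr rfl
  intro c _
  unfold hh
  simp only [map_smul, ha1, smul_eq_mul, mul_one]
  by_cases hc : c = 0
  · simp [hc]
  · rw [if_neg hc, if_neg hc, smul_smul, inv_mul_cancel₀ hc, one_smul]

lemma sg_rank_two (S : Submodule F V) (hS : Module.finrank F S = 2) {a b : V} (ha : a ∈ S)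
    (ha1 : τ a = 1) (hb : b ∈ S) (hb1 : τ b = 0) (hb0 : b ≠ 0) :
    sg (hh f τ π) S = (Fintype.card F - 1) * ∑ t : F, f (π a + t • π b) := by
  classical
  have hli : LinearIndependent F ![a, b] := by
    rw [LinearIndependent.pair_iff]
    intro s t hst
    have h1 := congrArg τ hst
    simp only [map_add, map_smul, ha1, hb1, smul_eq_mul, mul_one, mul_zero, add_zero,
      map_zero] at h1
    rw [h1, zero_smul, zero_add] at hst
    exact ⟨h1, (smul_eq_zero.1 hst).resolve_right hb0⟩
  have hspan : Submodule.span F {a, b} = S := by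
    apply Submodule.eq_of_le_of_finrank_eq
    · rw [Submodule.span_le]
      rintro x (rfl | rfl)
      · exact ha
      · exact hb
    · have := finrank_span_eq_card hli
      rw [Matrix.range_cons_cons_empty, Fintype.card_fin] at this
      rw [hS]
      exact this
  have himg : (univ.filter fun v => v ∈ S)
      = univ.image (fun c : F × F => c.1 • a + c.2 • b) := by
    ext v
    rw [← hspan]
    simp [Submodule.mem_span_pair]
  have hinj : Function.Injective (fun c : F × F => c.1 • a + c.2 • b) := by
    rintro ⟨s, t⟩ ⟨s', t'⟩ hst
    simp only at hst
    obtain ⟨h1, h2⟩ := LinearIndependent.pair_iff.1 hli (s - s') (t - t')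
      (by rw [sub_smul, sub_smul]; rw [← sub_eq_zero] at hst; rw [← hst]; abel)
    rw [sub_eq_zero] at h1 h2
    rw [h1, h2]
  rw [sg, himg, Finset.sum_image hinj.injOn, Fintype.sum_prod_type, ← sum_ne_zero_const]
  apply Finset.sum_congr rfl
  intro s _
  unfold hh
  simp only [map_add, map_smul, ha1, hb1, smul_eq_mul, mul_one, mul_zero, add_zero]
  by_cases hs : s = 0
  · simp [hs]
  · simp only [hs, if_false]
    rw [← Equiv.sum_comp (Equiv.mulLeft₀ s⁻¹ (inv_ne_zero hs)) (fun t => f (π a + t • π b))]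
    apply Finset.sum_congr rfl
    intro t _
    rw [smul_add, smul_smul, smul_smul, inv_mul_cancel₀ hs, one_smul]
    rfl

lemma sumHyp_one (hinj : ∀ v, τ v = 0 → π v = 0 → v = 0) (p : V) (hp1 : τ p = 1) (hp0 : π p = 0)
    (f0 : f 0 = 0) (f1 : ∀ x, x ≠ 0 → f x = 1 ∨ f x = -1) :
    SumHyp p (LinearMap.ker τ) (hh f τ π) 1 (Fintype.card F - 1) := by
  refine ⟨by have := card_gt_one (F := F); linarith, fun S hS => ⟨?_, ?_⟩⟩
  · rintro (h | h)
    · rw [sg_rank_one S hS h hp1, hp0, f0, mul_zero]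
    · exact sg_le_ker S h
  · intro hpS hSH
    obtain ⟨a, ha, ha1⟩ := exists_one S hSH
    rw [sg_rank_one S hS ha ha1]
    have : π a ≠ 0 := by
      intro h0
      have := hinj (a - p) (by simp [ha1, hp1]) (by simp [h0, hp0])
      rw [sub_eq_zero] at this
      exact hpS (this ▸ ha)
    rcases f1 _ this with h | h <;> rw [h] <;> simp

lemma sumHyp_two (hV : Module.finrank F V = 4) (hH : Module.finrank F (LinearMap.ker τ) = 3)
    (hinj : ∀ v, τ v = 0 → π v = 0 → v = 0) (p : V) (hp1 : τ p = 1) (hp0 : π p = 0)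
    (hline : ∀ x, ∑ c : F, f (c • x) = 0) (M : ℤ) (hM : 0 < M)
    (h2 : ∀ a b : K, LinearIndependent F ![a, b] →
      ∑ t : F, f (a + t • b) = M ∨ ∑ t : F, f (a + t • b) = - M) :
    SumHyp p (LinearMap.ker τ) (hh f τ π) 2 ((Fintype.card F - 1) * M) := by
  have hq := card_gt_one (F := F)
  refine ⟨mul_pos (by linarith) hM, fun S hS => ?_⟩
  by_cases hSH : S ≤ LinearMap.ker τ
  · exact ⟨fun _ => sg_le_ker S hSH, fun _ h => absurd hSH h⟩
  have hr := finrank_inf_H hV hH S hSH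
  have hr' : S ⊓ LinearMap.ker τ ≠ ⊥ := by
    intro h0
    rw [h0, finrank_bot] at hr
    omega
  obtain ⟨b, hb, hb0⟩ := Submodule.exists_mem_ne_zero_of_ne_bot hr'
  have hbS : b ∈ S := hb.1
  have hb1 : τ b = 0 := hb.2
  have hπb : π b ≠ 0 := fun h => hb0 (hinj b hb1 h)
  constructor
  · rintro (h | h)
    · rw [sg_rank_two S hS h hp1 hbS hb1 hb0, hp0]
      simp [hline]
    · exact absurd h hSH
  · intro hpS _
    obtain ⟨a, ha, ha1⟩ := exists_one S hSH
    rw [sg_rank_two S hS ha ha1 hbS hb1 hb0]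
    have hli : LinearIndependent F ![π b, π a] := by
      rw [LinearIndependent.pair_iff' hπb]
      intro c hc
      have := hinj (a - c • b - p) (by simp [ha1, hp1, hb1]) (by simp [hp0, hc])
      rw [sub_eq_zero] at this
      exact hpS (this ▸ S.sub_mem ha (S.smul_mem c hbS))
    rcases h2 _ _ (LinearIndependent.pair_symm_iff.1 hli) with h | h <;> rw [h] <;> simp

lemma total_zero {p : V} {H : Submodule F V} {h : V → ℤ} (hp0 : p ≠ 0) {m1 m2 : ℤ}
    (hs1 : SumHyp p H h 1 m1) (hs2 : SumHyp p H h 2 m2) : ∑ v, h v = 0 := by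
  have hP : Module.finrank F (Submodule.span F {p}) = 1 := finrank_span_singleton hp0
  have d := double_count' (Submodule.span F {p}) ⊤ le_top 1 hP h
  rw [(hs1.2 _ hP).1 (Or.inl (Submodule.mem_span_singleton_self p)), mul_zero, zero_add,
    Finset.sum_eq_zero] at d
  · simpa [sg] using d.symm
  · intro l hl
    rw [mem_TT] at hl
    exact (hs2.2 l hl.1).1 (Or.inl (hl.2.1 (Submodule.mem_span_singleton_self p)))

end concrete

end helpers

/-- For every positive integer `e`, with `q = 3^{2e}`, the
projective space `PG(3,q)` admits a symmetric tactical decomposition with four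
point classes and four line classes: the points (1-dimensional subspaces of
`𝔽_q⁴`) can be partitioned into four nonempty classes `P i` and the lines
(2-dimensional subspaces) into four nonempty classes `L i` such that the number
of lines of `L j` through a point of `P i` depends only on `(i,j)`, and the
number of points of `P j` on a line of `L i` depends only on `(i,j)`.  (This
gives counterexamples to a conjecture of Cameron and Liebler.) -/
theorem stmt_18 (e : ℕ) (he : 0 < e)
    {F : Type*} [Field F] [Fintype F] (hF : Fintype.card F = 3 ^ (2 * e)) :
    ∃ P L : Fin 4 → Set (Submodule F (Fin 4 → F)),
      (∀ i, (P i).Nonempty) ∧ (∀ i, (L i).Nonempty) ∧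
      (∀ i j, i ≠ j → Disjoint (P i) (P j)) ∧
      (∀ i j, i ≠ j → Disjoint (L i) (L j)) ∧
      (⋃ i, P i) = {x : Submodule F (Fin 4 → F) | Module.finrank F x = 1} ∧
      (⋃ i, L i) = {x : Submodule F (Fin 4 → F) | Module.finrank F x = 2} ∧
      (∃ a : Fin 4 → Fin 4 → ℕ, ∀ i j, ∀ pt ∈ P i,
        {l ∈ L j | pt ≤ l}.ncard = a i j) ∧
      (∃ b : Fin 4 → Fin 4 → ℕ, ∀ i j, ∀ l ∈ L i,
        {pt ∈ P j | pt ≤ l}.ncard = b i j) := by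
  classical
  have hchar : CharP F 3 := by
    obtain ⟨r, hr⟩ := CharP.exists F
    obtain ⟨n, hrp, hn⟩ := FiniteField.card F r
    rw [hF] at hn
    have h3 : (3 : ℕ) = r := by
      have h1 : 3 ∣ r ^ (n : ℕ) := by
        rw [← hn]; exact dvd_pow_self 3 (by omega)
      exact (Nat.prime_dvd_prime_iff_eq Nat.prime_three hrp).1 (Nat.prime_three.dvd_of_dvd_pow h1)
    rw [h3]; exact hr
  have : Fact (Nat.Prime 3) := ⟨Nat.prime_three⟩
  let K := FiniteField.Extension F 3 3
  let _ : Fintype K := Fintype.ofFinite K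
  let _ : Fintype (Submodule F (Fin 4 → F)) := Fintype.ofFinite _
  have h3 : Module.finrank F K = 3 := FiniteField.finrank_extension F 3 3
  have hV : Module.finrank F (Fin 4 → F) = 4 := by simp
  have hψ : Module.finrank F (Fin 4 → F) = Module.finrank F (F × K) := by
    rw [Module.finrank_prod, h3, hV, Module.finrank_self]
  let ψ : (Fin 4 → F) ≃ₗ[F] (F × K) := LinearEquiv.ofFinrankEq _ _ hψ
  obtain ⟨f, f0, f1, hline, h2⟩ := exists_f (K := K) h3 e he hF
  let τ : (Fin 4 → F) →ₗ[F] F := LinearMap.fst F F K ∘ₗ ψ.toLinearMap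
  let π : (Fin 4 → F) →ₗ[F] K := LinearMap.snd F F K ∘ₗ ψ.toLinearMap
  let p : Fin 4 → F := ψ.symm (1, 0)
  have hp1 : τ p = 1 := by simp [τ, p]
  have hp0 : π p = 0 := by simp [π, p]
  have hinj : ∀ v, τ v = 0 → π v = 0 → v = 0 := by
    intro v h1 h2
    apply ψ.injective
    rw [map_zero]
    exact Prod.ext h1 h2
  have hH : Module.finrank F (LinearMap.ker τ) = 3 := by
    have h1 := LinearMap.finrank_range_add_finrank_ker τ
    have hsur : LinearMap.range τ = ⊤ := by
      rw [LinearMap.range_eq_top]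
      intro c
      exact ⟨c • p, by rw [map_smul, hp1, smul_eq_mul, mul_one]⟩
    rw [hsur, finrank_top, Module.finrank_self, hV] at h1
    omega
  have hs1 := sumHyp_one (f := f) hinj p hp1 hp0 f0 f1
  have hs2 := sumHyp_two (f := f) hV hH hinj p hp1 hp0 hline (3 ^ e) (by positivity) h2
  have hpne : p ≠ 0 := by
    intro h
    rw [h, map_zero] at hp1
    exact zero_ne_one hp1
  exact comb_main p (LinearMap.ker τ) (hh f τ π)
    (by rw [LinearMap.mem_ker, hp1]; exact one_ne_zero) (by simp [hh])
    (total_zero hpne hs1 hs2) hV hH hs1 hs2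
end
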